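/- For every fixed ε > 0 there exists ε₁ > 0 such that for all sufficiently large cubefree integers m and positive integers N₁, N₂, N₃, N₄ with N₁N₂N₃N₄ > m^(1+ε), the number of units λ ∈ (ℤ/mℤ)* not representable as λ ≡ x₁x₂x₃x₄ (mod m) with x_j ∈ [1, N_j] is O(m^(1-ε₁)). -/

import Mathlib

section CharacterSums

open Polynomial Finset

set_option maxHeartbeats 1600000 in
/-- The auxiliary polynomial identity behind Stepanov's method, in Bombieri's form: the number of
points of a finite field with `Q ^ 2` elements at which `g ^ ((Q ^ 2 - 1) / d)` takes a given
value. -/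
theorem stepanov_of_params {K : Type*} [Field K] [Fintype K] [DecidableEq K] (p : ℕ)
    [Fact p.Prime] [CharP K p] (μ Q d D L A : ℕ) (hQ : Q = p ^ μ) (hK : Fintype.card K = Q ^ 2)
    (hd : 0 < d) (hdvd : d ∣ Q ^ 2 - 1) (g : K[X]) (hg : g.natDegree = D) (hg0 : g ≠ 0)
    (hdD : Nat.Coprime d D) (hL : d * L + d * D ≤ Q)
    (hA : L * Q + A + D * (Q + 1) < d * A * L) (ζ : K) :
    #{x : K | g.eval x ^ ((Q ^ 2 - 1) / d) = ζ} ≤ L + A * Q + D * (Q + 1) := by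
  classical
  have hQ1 : 1 ≤ Q := by rw [hQ]; exact Nat.one_le_pow _ _ (Fact.out : p.Prime).pos
  obtain ⟨q', hq'⟩ := hdvd
  have hq'd : (Q ^ 2 - 1) / d = q' := by rw [hq']; exact Nat.mul_div_cancel_left _ hd
  rw [hq'd]
  have hq2 : Q * Q = d * q' + 1 := by
    have : 1 ≤ Q ^ 2 := Nat.one_le_pow _ _ hQ1
    rw [← hq', ← pow_two]; omega
  set e : ℕ → ℕ := fun j => (j * Q + (d - 1)) / d with he
  have he1 : ∀ j, j * Q ≤ d * e j := fun j => by
    have := Nat.div_add_mod (j * Q + (d - 1)) d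
    have h2 := Nat.mod_lt (j * Q + (d - 1)) hd
    simp only [he]; omega
  have he2 : ∀ j, d * e j ≤ j * Q + (d - 1) := fun j => Nat.mul_div_le _ _
  set f : ℕ → ℕ := fun j => e j * Q - j * q' with hf
  have hf1 : ∀ j, e j * Q = f j + j * q' := fun j => by
    have : j * q' ≤ e j * Q := by
      have h1 := Nat.mul_le_mul_right Q (he1 j)
      have : d * (j * q') ≤ d * (e j * Q) := by nlinarith
      exact Nat.le_of_mul_le_mul_left this hd
    simp only [hf]; omega
  have hf2 : ∀ j < d, f j ≤ Q + 1 := fun j hj => by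
    have h1 := Nat.mul_le_mul_right Q (he2 j)
    have h2 := hf1 j
    have h3 : d * f j ≤ d * (Q + 1) := by
      zify [hd] at h1 h2 hq2 hj ⊢
      nlinarith
    exact Nat.le_of_mul_le_mul_left h3 hd
  have he3 : ∀ j < d, e j ≤ Q + 1 := fun j hj => by
    have h1 := he2 j
    have h3 : d * e j ≤ d * (Q + 1) := by
      zify [hd] at h1 hj ⊢
      nlinarith
    exact Nat.le_of_mul_le_mul_left h3 hd
  let P : (Fin d × Fin A → Fin L → K) → Fin d × Fin A → K[X] :=
    fun c i => ∑ l : Fin L, C (c i l) * X ^ (l : ℕ)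
  let B := L * Q + A + D * (Q + 1)
  let Φ : (Fin d × Fin A → Fin L → K) → K[X] := fun c =>
    ∑ i, C (ζ ^ (i.1 : ℕ)) * (P c i) ^ Q * X ^ (i.2 : ℕ) * g ^ f i.1
  have hP : ∀ c i, (P c i).degree < L := fun c i => by
    refine lt_of_le_of_lt (degree_sum_le _ _) ?_
    rw [Finset.sup_lt_iff (by exact WithBot.bot_lt_coe L)]
    intro l _
    refine lt_of_le_of_lt (degree_C_mul_X_pow_le _ _) ?_
    exact_mod_cast l.2
  have hPn : ∀ c i, P c i ≠ 0 → (P c i).natDegree < L := fun c i h =>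
    (natDegree_lt_iff_degree_lt h).2 (hP c i)
  have hPle : ∀ c i, (P c i).natDegree ≤ L := fun c i =>
    natDegree_le_of_degree_le (hP c i).le
  have hΦ : ∀ c, (Φ c).degree < B := fun c => by
    refine lt_of_le_of_lt (degree_sum_le _ _) ?_
    rw [Finset.sup_lt_iff (by exact WithBot.bot_lt_coe B)]
    intro i _
    by_cases h0 : C (ζ ^ (i.1 : ℕ)) * (P c i) ^ Q * X ^ (i.2 : ℕ) * g ^ f i.1 = 0
    · rw [h0, degree_zero]; exact WithBot.bot_lt_coe B
    rw [← natDegree_lt_iff_degree_lt h0]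
    have h1 : (C (ζ ^ (i.1 : ℕ)) * (P c i) ^ Q * X ^ (i.2 : ℕ) * g ^ f i.1).natDegree ≤
        0 + Q * (P c i).natDegree + i.2 + f i.1 * D := by
      refine natDegree_mul_le_of_le (natDegree_mul_le_of_le (natDegree_mul_le_of_le ?_ ?_) ?_) ?_
      · simp
      · exact natDegree_pow_le
      · exact natDegree_X_pow_le _
      · rw [← hg]; exact natDegree_pow_le
    have h2 := hPle c i
    have h3 := hf2 i.1 i.1.2
    have h4 := i.2.2
    simp only [B]
    nlinarith [Nat.mul_le_mul_left Q h2, Nat.mul_le_mul_right D h3]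
  have hsub : ∀ c c', Φ (c - c') = Φ c - Φ c' := fun c c' => by
    have hPs : ∀ i, P (c - c') i = P c i - P c' i := fun i => by
      simp only [P, ← Finset.sum_sub_distrib, Pi.sub_apply, C_sub, sub_mul]
    simp only [Φ, ← Finset.sum_sub_distrib]
    refine Finset.sum_congr rfl fun i _ => ?_
    rw [hPs, hQ, sub_pow_char_pow]
    ring
  obtain ⟨c, hc0, hc⟩ : ∃ c, c ≠ 0 ∧ Φ c = 0 := by
    let Ψ : (Fin d × Fin A → Fin L → K) → (Fin B → K) := fun c =>
      degreeLTEquiv K B ⟨Φ c, mem_degreeLT.2 (hΦ c)⟩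
    have hcard : Fintype.card (Fin B → K) < Fintype.card (Fin d × Fin A → Fin L → K) := by
      simp only [Fintype.card_fun, Fintype.card_fin, Fintype.card_prod]
      rw [← pow_mul]
      exact Nat.pow_lt_pow_right Fintype.one_lt_card (by rw [mul_comm L]; exact hA)
    obtain ⟨c, c', hne, heq⟩ := Fintype.exists_ne_map_eq_of_card_lt Ψ hcard
    refine ⟨c - c', sub_ne_zero.2 hne, ?_⟩
    rw [hsub, sub_eq_zero]
    have := (degreeLTEquiv K B).injective heq
    exact congrArg Subtype.val this
  let t : Fin d × Fin A → K[X] := fun i => P c i * X ^ ((i.2 : ℕ) * Q) * g ^ e i.1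
  let h : K[X] := ∑ i, t i
  have htdeg : ∀ i, P c i ≠ 0 → (t i).natDegree = (P c i).natDegree + i.2 * Q + e i.1 * D := by
    intro i hi
    simp only [t]
    rw [natDegree_mul (mul_ne_zero hi (pow_ne_zero _ X_ne_zero)) (pow_ne_zero _ hg0),
      natDegree_mul hi (pow_ne_zero _ X_ne_zero), natDegree_X_pow, natDegree_pow, hg]
  have ht0 : ∀ i, t i ≠ 0 ↔ P c i ≠ 0 := fun i => by
    simp [t, hg0]
  have hpair : Set.Pairwise {i | i ∈ univ ∧ t i ≠ 0} (Function.onFun Ne (degree ∘ t)) := by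
    rintro i ⟨-, hi⟩ i' ⟨-, hi'⟩ hne heq
    apply hne
    have h1 : (t i).natDegree = (t i').natDegree := natDegree_eq_of_degree_eq heq
    rw [ht0] at hi hi'
    rw [htdeg i hi, htdeg i' hi'] at h1
    have a1 := hPn c i hi
    have a2 := hPn c i' hi'
    have b1 := he1 i.1
    have b2 := he2 i.1
    have b3 := he1 i'.1
    have b4 := he2 i'.1
    obtain ⟨s, hs⟩ := Nat.exists_eq_add_of_le b1
    obtain ⟨s', hs'⟩ := Nat.exists_eq_add_of_le b3
    have hsd : s + 1 ≤ d := by omega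
    have hsd' : s' + 1 ≤ d := by omega
    have key : Q * (d * i.2 + D * i.1) + (d * (P c i).natDegree + D * s) =
        Q * (d * i'.2 + D * i'.1) + (d * (P c i').natDegree + D * s') := by
      have : d * ((P c i).natDegree + i.2 * Q + e i.1 * D) =
        d * ((P c i').natDegree + i'.2 * Q + e i'.1 * D) := by rw [h1]
      have e1 : d * (e i.1 * D) = (i.1 * Q + s) * D := by rw [← hs]; ring
      have e2 : d * (e i'.1 * D) = (i'.1 * Q + s') * D := by rw [← hs']; ring
      nlinarith
    have small : d * (P c i).natDegree + D * s < Q := by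
      have : d * ((P c i).natDegree + 1) ≤ d * L := Nat.mul_le_mul_left _ a1
      have : D * (s + 1) ≤ D * d := Nat.mul_le_mul_left _ hsd
      nlinarith
    have small' : d * (P c i').natDegree + D * s' < Q := by
      have : d * ((P c i').natDegree + 1) ≤ d * L := Nat.mul_le_mul_left _ a2
      have : D * (s' + 1) ≤ D * d := Nat.mul_le_mul_left _ hsd'
      nlinarith
    have hk : d * (i.2 : ℕ) + D * i.1 = d * i'.2 + D * i'.1 := by
      have := congrArg (· / Q) key
      simpa [Nat.mul_add_div hQ1, Nat.div_eq_of_lt small, Nat.div_eq_of_lt small'] using this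
    have hj : (i.1 : ℕ) = i'.1 := by
      have h5 : (D * i.1) ≡ (D * i'.1) [MOD d] := by
        have h6 : (d * (i.2 : ℕ) + D * i.1) % d = (d * i'.2 + D * i'.1) % d := by rw [hk]
        simpa [Nat.ModEq, Nat.add_mod, Nat.mul_mod] using h6
      exact (Nat.ModEq.cancel_left_of_coprime hdD h5).eq_of_lt_of_lt i.1.2 i'.1.2
    have ha : (i.2 : ℕ) = i'.2 := by
      rw [hj] at hk
      exact Nat.eq_of_mul_eq_mul_left hd (by omega)
    exact Prod.ext (Fin.ext hj) (Fin.ext ha)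
  have hh0 : h ≠ 0 := by
    obtain ⟨i, hi⟩ : ∃ i, P c i ≠ 0 := by
      by_contra! hall
      apply hc0
      funext i l
      have := congrArg (fun q => q.coeff (l : ℕ)) (hall i)
      simpa [P, finsetSum_coeff, coeff_C_mul, coeff_X_pow, Fin.val_inj] using this
    intro hh
    have := degree_sum_eq_of_disjoint t univ hpair
    rw [show (∑ i, t i) = 0 from hh, degree_zero] at this
    have h2 : (t i).degree ≤ univ.sup fun i => (t i).degree :=
      Finset.le_sup (f := fun i => (t i).degree) (mem_univ i)
    have h3 : univ.sup (fun i => (t i).degree) = ⊥ := this.symm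
    rw [h3, le_bot_iff, degree_eq_bot] at h2
    exact (ht0 i).2 hi h2
  have hhdeg : h.natDegree ≤ L + A * Q + D * (Q + 1) := by
    refine natDegree_sum_le_of_forall_le _ _ fun i _ => ?_
    by_cases hi : P c i = 0
    · simp [t, hi]
    rw [htdeg i hi]
    have := hPle c i
    have h1 := Nat.mul_le_mul_right Q i.2.2.le
    have h2 := Nat.mul_le_mul_right D (he3 i.1 i.1.2)
    nlinarith
  refine le_trans ?_ hhdeg
  have hroots : ({x : K | g.eval x ^ q' = ζ} : Finset K) ⊆ h.roots.toFinset := by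
    intro x hx
    simp only [mem_filter, mem_univ, true_and] at hx
    rw [Multiset.mem_toFinset, mem_roots hh0, IsRoot.def]
    have hxq : x ^ (Q * Q) = x := by
      rw [← pow_two, ← hK]; exact FiniteField.pow_card x
    have : (h.eval x) ^ Q = (Φ c).eval x := by
      simp only [h, Φ, eval_finsetSum]
      conv_lhs => rw [hQ, sum_pow_char_pow, ← hQ]
      refine Finset.sum_congr rfl fun i _ => ?_
      simp only [t, eval_mul, eval_pow, eval_X, eval_C]
      rw [mul_pow, mul_pow, ← pow_mul, ← pow_mul, hf1, pow_add, mul_comm (i.1 : ℕ) q',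
        pow_mul _ q', hx, mul_assoc (i.2 : ℕ), mul_comm (i.2 : ℕ), pow_mul, hxq]
      ring
    rw [hc, eval_zero] at this
    exact pow_eq_zero_iff (by omega) |>.1 this
  calc _ ≤ #h.roots.toFinset := card_le_card hroots
    _ ≤ _ := Multiset.toFinset_card_le _
    _ ≤ _ := card_roots' h

theorem stepanov_bound {K : Type*} [Field K] [Fintype K] [DecidableEq K] (p : ℕ)
    [Fact p.Prime] [CharP K p] (μ Q d D : ℕ) (hQ : Q = p ^ μ) (hK : Fintype.card K = Q ^ 2)
    (hd : 0 < d) (hD : 0 < D) (hdvd : d ∣ Q ^ 2 - 1) (g : K[X]) (hg : g.natDegree = D)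
    (hdD : Nat.Coprime d D) (hQl : 16 * (d * D) ≤ Q) (ζ : K) :
    d * #{x : K | g.eval x ^ ((Q ^ 2 - 1) / d) = ζ} ≤ Q ^ 2 + 12 * (d * D) * Q := by
  have hg0 : g ≠ 0 := by rintro rfl; simp at hg; omega
  have hdD1 : 1 ≤ d * D := Nat.mul_pos hd hD
  have hdd : d ≤ d * D := Nat.le_mul_of_pos_right _ hD
  have hDd : D ≤ d * D := Nat.le_mul_of_pos_left _ hd
  obtain ⟨L, hL⟩ : ∃ L, Q / d = L + D := by
    have : D ≤ Q / d := by rw [Nat.le_div_iff_mul_le hd]; nlinarith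
    exact ⟨Q / d - D, by omega⟩
  have h1 : d * (L + D) ≤ Q := by rw [← hL]; exact Nat.mul_div_le _ _
  have h2 : Q < d * (L + D) + d := by
    rw [← hL]
    have := Nat.div_add_mod Q d
    have := Nat.mod_lt Q hd
    omega
  set A := (Q + 8 * (d * D)) / d + 1 with hA
  have h3 : d * A ≤ Q + 8 * (d * D) + d := by
    rw [hA, mul_add]; have := Nat.mul_div_le (Q + 8 * (d * D)) d; omega
  have h4 : Q + 8 * (d * D) ≤ d * A := by
    rw [hA, mul_add]
    have := Nat.div_add_mod (Q + 8 * (d * D)) d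
    have := Nat.mod_lt (Q + 8 * (d * D)) hd
    omega
  have h5 : Q ≤ 2 * (d * L) := by nlinarith
  have h6 : A ≤ 2 * Q := by
    have : A ≤ d * A := Nat.le_mul_of_pos_left _ hd
    omega
  have := stepanov_of_params p μ Q d D L A hQ hK hd hdvd g hg hg0 hdD (by nlinarith) (by
    have a1 : (Q + 8 * (d * D)) * L ≤ d * A * L := Nat.mul_le_mul_right _ h4
    have a2 : 4 * D * Q ≤ 4 * D * (2 * (d * L)) := Nat.mul_le_mul_left _ h5
    have a3 : Q ≤ D * Q := Nat.le_mul_of_pos_left _ hD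
    have a4 : 16 * D ≤ D * Q := by nlinarith
    nlinarith) ζ
  calc _ ≤ d * (L + A * Q + D * (Q + 1)) := Nat.mul_le_mul_left _ this
    _ = d * L + d * A * Q + d * D * (Q + 1) := by ring
    _ ≤ Q + (Q + 8 * (d * D) + d) * Q + d * D * (Q + 1) := by
      have := Nat.mul_le_mul_right Q h3
      have : d * L ≤ Q := by nlinarith
      omega
    _ ≤ _ := by nlinarith

theorem finite_monic_natDegree (F : Type*) [Field F] [Finite F] (n : ℕ) :
    {h : F[X] | h.Monic ∧ h.natDegree = n}.Finite := by
  have : Finite (degreeLT F (n + 1)) := Finite.of_equiv _ (degreeLTEquiv F (n + 1)).symm.toEquiv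
  refine Set.Finite.subset (Set.toFinite (degreeLT F (n + 1) : Set F[X])) fun h hh => ?_
  rw [SetLike.mem_coe, mem_degreeLT, degree_eq_natDegree hh.1.ne_zero, hh.2]
  exact_mod_cast Nat.lt_succ_self n

/-- The monic polynomials of degree `n` over a finite field. -/
noncomputable def monics (F : Type*) [Field F] [Finite F] (n : ℕ) : Finset F[X] :=
  (finite_monic_natDegree F n).toFinset

theorem mem_monics {F : Type*} [Field F] [Finite F] {n : ℕ} {h : F[X]} :
    h ∈ monics F n ↔ h.Monic ∧ h.natDegree = n := by
  simp [monics]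

section Newton

variable {p : ℕ} [Fact p.Prime]

/-- The characteristic polynomial of `α`, an element of the field with `p ^ j` elements. -/
noncomputable def conjPoly (j : ℕ) (α : GaloisField p j) : (ZMod p)[X] :=
  minpoly (ZMod p) α ^ (j / (minpoly (ZMod p) α).natDegree)

theorem natDegree_minpoly_dvd {j : ℕ} (hj : j ≠ 0) (α : GaloisField p j) :
    (minpoly (ZMod p) α).natDegree ∣ j := by
  have := minpoly.degree_dvd (Algebra.IsIntegral.isIntegral (R := ZMod p) α)
  rwa [GaloisField.finrank p hj] at this

theorem monic_conjPoly (j : ℕ) (α : GaloisField p j) : (conjPoly j α).Monic :=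
  (minpoly.monic (Algebra.IsIntegral.isIntegral α)).pow _

theorem natDegree_conjPoly {j : ℕ} (hj : j ≠ 0) (α : GaloisField p j) :
    (conjPoly j α).natDegree = j := by
  rw [conjPoly, natDegree_pow, Nat.div_mul_cancel (natDegree_minpoly_dvd hj α)]

theorem card_minpoly_eq {j : ℕ} (hj : j ≠ 0) {P : (ZMod p)[X]} (hP : Irreducible P)
    (hm : P.Monic) (hd : P.natDegree ∣ j) [Fintype (GaloisField p j)] 
    [DecidablePred fun α : GaloisField p j => minpoly (ZMod p) α = P] :
    #{α : GaloisField p j | minpoly (ZMod p) α = P} = P.natDegree := by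
  classical
  have hdvd : P ∣ X ^ p ^ j - X := by
    have := hP.natDegree_dvd_iff_dvd_X_pow_card_pow_sub_X.1 hd
    rwa [Nat.card_zmod] at this
  have hspl : (P.map (algebraMap (ZMod p) (GaloisField p j))).Splits := by
    have := FiniteField.isSplittingField_of_nat_card_eq p j (GaloisField.card p j hj)
    have h1 := (Polynomial.IsSplittingField.splits (GaloisField p j) (X ^ p ^ j - X : (ZMod p)[X]))
    exact Splits.of_dvd h1 (map_ne_zero (FiniteField.X_pow_card_pow_sub_X_ne_zero _ hj
      (Fact.out : p.Prime).one_lt))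
      (map_dvd (mapRingHom (algebraMap (ZMod p) (GaloisField p j))) hdvd)
  have hcard := card_rootSet_eq_natDegree (K := GaloisField p j)
    (PerfectField.separable_of_irreducible hP) hspl
  rw [← hcard, ← Set.toFinset_card]
  congr 1
  ext α
  simp only [mem_filter, mem_univ, true_and, Set.mem_toFinset, mem_rootSet, ne_eq]
  constructor
  · rintro rfl
    exact ⟨hP.ne_zero, minpoly.aeval _ _⟩
  · rintro ⟨-, h⟩
    exact (minpoly.eq_of_irreducible_of_monic hP h hm).symm

theorem sum_card_conjPoly_dvd [∀ j, Fintype (GaloisField p j)] {n : ℕ} {h : (ZMod p)[X]}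
    (hh : h ∈ monics (ZMod p) n)
    [∀ j, DecidablePred fun α : GaloisField p j => conjPoly j α ∣ h] :
    ∑ j ∈ Icc 1 n, #{α : GaloisField p j | conjPoly j α ∣ h} = n := by
  classical
  obtain ⟨hm, hn⟩ := mem_monics.1 hh
  have h0 := hm.ne_zero
  let T := UniqueFactorizationMonoid.normalizedFactors h
  have hT : ∀ P, P ∈ T ↔ Irreducible P ∧ P.Monic ∧ P ∣ h := fun P => by
    simp only [T]
    rw [Polynomial.mem_normalizedFactors_iff h0]
  have hcount : ∀ P ∈ T, ∀ i, P ^ i ∣ h ↔ i ≤ T.count P := fun P hP i => by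
    have hP' := (hT P).1 hP
    rw [pow_dvd_iff_le_emultiplicity,
      UniqueFactorizationMonoid.emultiplicity_eq_count_normalizedFactors hP'.1 h0,
      hP'.2.1.normalize_eq_self]
    norm_cast
  have hdeg : ∑ P ∈ T.toFinset, T.count P * P.natDegree = n := by
    have h1 : T.prod = h := by
      have := UniqueFactorizationMonoid.prod_normalizedFactors_eq h0
      rw [this, hm.normalize_eq_self]
    have h2 : T.prod.natDegree = (T.map natDegree).sum :=
      natDegree_multiset_prod _ (UniqueFactorizationMonoid.zero_notMem_normalizedFactors h)
    rw [h1, hn, Finset.sum_multiset_map_count] at h2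
    simpa using h2.symm
  have hstep : ∀ j ∈ Icc 1 n, #{α : GaloisField p j | conjPoly j α ∣ h} =
      ∑ P ∈ T.toFinset, if P.natDegree ∣ j ∧ j / P.natDegree ≤ T.count P
        then P.natDegree else 0 := by
    intro j hj
    have hj0 : j ≠ 0 := by have := (mem_Icc.1 hj).1; omega
    rw [card_eq_sum_card_fiberwise (f := fun α => minpoly (ZMod p) α) (t := T.toFinset)]
    · refine Finset.sum_congr rfl fun P hP => ?_
      rw [Multiset.mem_toFinset] at hP
      have hP' := (hT P).1 hP
      split_ifs with hc
      · rw [← card_minpoly_eq hj0 hP'.1 hP'.2.1 hc.1]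
        congr 1
        ext α
        simp only [mem_filter, mem_univ, true_and, and_iff_right_iff_imp]
        rintro rfl
        rw [conjPoly, hcount _ hP]
        exact hc.2
      · rw [card_eq_zero, filter_eq_empty_iff]
        intro α hα hαP
        simp only [mem_filter, mem_univ, true_and] at hα
        apply hc
        subst hαP
        rw [conjPoly, hcount _ hP] at hα
        exact ⟨natDegree_minpoly_dvd hj0 α, hα⟩
    · intro α hα
      simp only [coe_filter, mem_univ, true_and, Set.mem_ofPred_eq] at hα
      rw [mem_coe, Multiset.mem_toFinset, hT]
      have hi := Algebra.IsIntegral.isIntegral (R := ZMod p) α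
      refine ⟨minpoly.irreducible hi, minpoly.monic hi, dvd_trans (dvd_pow_self _ ?_) hα⟩
      have := Nat.div_pos (Nat.le_of_dvd (by omega) (natDegree_minpoly_dvd hj0 α))
        (minpoly.natDegree_pos hi)
      omega
  rw [Finset.sum_congr rfl hstep, Finset.sum_comm]
  conv_rhs => rw [← hdeg]
  refine Finset.sum_congr rfl fun P hP => ?_
  have hP' := (hT P).1 (Multiset.mem_toFinset.1 hP)
  have hpos := hP'.1.natDegree_pos
  rw [← Finset.sum_filter, Finset.sum_const, smul_eq_mul]
  congr 1
  have : (Icc 1 n).filter (fun j => P.natDegree ∣ j ∧ j / P.natDegree ≤ T.count P) =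
      (Icc 1 (T.count P)).image (fun i => i * P.natDegree) := by
    ext j
    simp only [mem_filter, mem_Icc, mem_image]
    constructor
    · rintro ⟨⟨h1, h2⟩, ⟨i, rfl⟩, h3⟩
      rw [Nat.mul_div_cancel_left _ hpos] at h3
      exact ⟨i, ⟨Nat.pos_of_ne_zero (by rintro rfl; simp at h1), h3⟩, mul_comm _ _⟩
    · rintro ⟨i, ⟨h1, h2⟩, rfl⟩
      refine ⟨⟨Nat.mul_pos h1 hpos, ?_⟩, dvd_mul_left _ _, by rwa [Nat.mul_div_cancel _ hpos]⟩
      rw [← hdeg]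
      exact (Nat.mul_le_mul_right _ h2).trans
        (Finset.single_le_sum (f := fun P => T.count P * P.natDegree) (fun _ _ => Nat.zero_le _) hP)
  rw [this, card_image_of_injective _ (fun a b hab => Nat.eq_of_mul_eq_mul_right hpos hab)]
  simp

/-- Newton's identities for the coefficients of an `L`-function over `𝔽_p[X]`. -/
theorem newton_monics [∀ j, Fintype (GaloisField p j)] (lam : (ZMod p)[X] →* ℂ) (n : ℕ) :
    (n : ℂ) * ∑ h ∈ monics (ZMod p) n, lam h =
      ∑ j ∈ Icc 1 n, (∑ α : GaloisField p j, lam (conjPoly j α)) *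
        ∑ h ∈ monics (ZMod p) (n - j), lam h := by
  classical
  have h1 : (n : ℂ) * ∑ h ∈ monics (ZMod p) n, lam h = ∑ h ∈ monics (ZMod p) n,
      ∑ j ∈ Icc 1 n, ∑ α : GaloisField p j, if conjPoly j α ∣ h then lam h else 0 := by
    rw [Finset.mul_sum]
    refine Finset.sum_congr rfl fun h hh => ?_
    conv_lhs => rw [← sum_card_conjPoly_dvd hh]
    push_cast
    rw [Finset.sum_mul]
    refine Finset.sum_congr rfl fun j _ => ?_
    rw [← Finset.sum_filter, Finset.sum_const, nsmul_eq_mul]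
  rw [h1, Finset.sum_comm]
  refine Finset.sum_congr rfl fun j hj => ?_
  rw [mem_Icc] at hj
  rw [Finset.sum_comm, Finset.sum_mul]
  refine Finset.sum_congr rfl fun α _ => ?_
  rw [← Finset.sum_filter, Finset.mul_sum]
  have hcm := monic_conjPoly j α
  have hcd := natDegree_conjPoly (by omega) α
  symm
  refine Finset.sum_bij (fun w _ => conjPoly j α * w) ?_ ?_ ?_ ?_
  · intro w hw
    rw [mem_monics] at hw
    rw [mem_filter, mem_monics]
    refine ⟨⟨hcm.mul hw.1, ?_⟩, dvd_mul_right _ _⟩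
    rw [hcm.natDegree_mul hw.1, hcd, hw.2]; omega
  · intro w _ w' _ h
    exact mul_left_cancel₀ hcm.ne_zero h
  · intro h hh
    rw [mem_filter, mem_monics] at hh
    obtain ⟨⟨hm, hn⟩, w, rfl⟩ := hh
    have hw := hcm.of_mul_monic_left hm
    refine ⟨w, ?_, rfl⟩
    rw [mem_monics]
    refine ⟨hw, ?_⟩
    rw [hcm.natDegree_mul hw, hcd] at hn; omega
  · intro w _
    rw [map_mul]

end Newton

/-- The completely multiplicative function on polynomials attached to a family of characters. -/
noncomputable def polyChar {F : Type*} [Field F] (s : Finset F) (ψ : F → MulChar F ℂ) :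
    F[X] →* ℂ where
  toFun h := ∏ ρ ∈ s, ψ ρ (h.eval ρ)
  map_one' := by simp
  map_mul' a b := by simp [Finset.prod_mul_distrib]

theorem polyChar_apply {F : Type*} [Field F] (s : Finset F) (ψ : F → MulChar F ℂ) (h : F[X]) :
    polyChar s ψ h = ∏ ρ ∈ s, ψ ρ (h.eval ρ) := rfl

theorem sum_monics_polyChar_eq_zero {F : Type*} [Field F] [Fintype F] [DecidableEq F] (s : Finset F)
    (ψ : F → MulChar F ℂ) (ρ₀ : F) (hρ : ρ₀ ∈ s) (hψ : ψ ρ₀ ≠ 1) (n : ℕ) (hn : #s ≤ n) :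
    ∑ h ∈ monics F n, polyChar s ψ h = 0 := by
  let l : F[X] := ∏ ρ ∈ s.erase ρ₀, (X - C ρ)
  have hl : ∀ v : F, (C v * l).degree < n := fun v => by
    have h1 : l.natDegree = #s - 1 := by
      simp only [l]; rw [natDegree_prod_of_monic _ _ fun _ _ => monic_X_sub_C _]
      simp [card_erase_of_mem hρ]
    have : (C v * l).natDegree ≤ #s - 1 := h1 ▸ natDegree_C_mul_le _ _
    refine lt_of_le_of_lt degree_le_natDegree ?_
    have h3 := card_pos.2 ⟨_, hρ⟩
    exact_mod_cast (by omega : (C v * l).natDegree < n)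
  have hl0 : l.eval ρ₀ ≠ 0 := by
    simp only [l, eval_prod, eval_sub, eval_X, eval_C]
    exact Finset.prod_ne_zero_iff.2 fun ρ h => sub_ne_zero.2 (ne_of_mem_erase h).symm
  have hl1 : ∀ ρ ∈ s.erase ρ₀, l.eval ρ = 0 := fun ρ h => by
    simp only [l, eval_prod, eval_sub, eval_X, eval_C]
    exact Finset.prod_eq_zero h (sub_self _)
  have hshift : ∀ v : F, ∑ h ∈ monics F n, polyChar s ψ (h + C v * l) =
      ∑ h ∈ monics F n, polyChar s ψ h := fun v => by
    have key : ∀ u : F[X], u.degree < n → ∀ h ∈ monics F n, h + u ∈ monics F n := by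
      intro u hu h hh
      rw [mem_monics] at hh ⊢
      have hd : u.degree < h.degree := by rwa [degree_eq_natDegree hh.1.ne_zero, hh.2]
      exact ⟨hh.1.add_of_left hd, by rw [natDegree_add_eq_left_of_degree_lt hd, hh.2]⟩
    refine Finset.sum_bij' (fun h _ => h + C v * l) (fun h _ => h + (-(C v * l))) ?_ ?_ ?_ ?_ ?_
    · exact fun h hh => key _ (hl v) h hh
    · exact fun h hh => key _ (by rw [degree_neg]; exact hl v) h hh
    · intros; ring
    · intros; ring
    · intros; rfl
  have hsum : ∑ v : F, ∑ h ∈ monics F n, polyChar s ψ (h + C v * l) = 0 := by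
    rw [Finset.sum_comm]
    refine Finset.sum_eq_zero fun h _ => ?_
    have : ∀ v : F, polyChar s ψ (h + C v * l) =
        (∏ ρ ∈ s.erase ρ₀, ψ ρ (h.eval ρ)) * ψ ρ₀ (h.eval ρ₀ + v * l.eval ρ₀) := fun v => by
      rw [polyChar_apply, ← Finset.prod_erase_mul _ _ hρ]
      congr 1
      · refine Finset.prod_congr rfl fun ρ hρ' => ?_
        simp [hl1 ρ hρ']
      · simp
    simp only [this]
    rw [← Finset.mul_sum]
    have h2 : ∑ v : F, ψ ρ₀ (h.eval ρ₀ + v * l.eval ρ₀) = ∑ v : F, ψ ρ₀ v :=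
      Fintype.sum_bijective (fun v => h.eval ρ₀ + v * l.eval ρ₀)
        ((Equiv.mulRight₀ _ hl0).trans (Equiv.addLeft (h.eval ρ₀))).bijective _ _ (fun _ => rfl)
    rw [h2, MulChar.sum_eq_zero_of_ne_one hψ, mul_zero]
  simp only [hshift, Finset.sum_const, nsmul_eq_mul, mul_eq_zero] at hsum
  rcases hsum with h | h
  · simp at h
  · exact h

theorem hasSum_coeff_eval (P : ℂ[X]) (z : ℂ) : HasSum (fun n => P.coeff n * z ^ n) (P.eval z) := by
  rw [eval_eq_sum_range]
  refine hasSum_sum_of_ne_finset_zero fun n hn => ?_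
  rw [coeff_eq_zero_of_natDegree_lt (by simpa using hn), zero_mul]

/-- A polynomial solution `G` of `z G' = H G` on a disc, with `H` locally bounded, has no zeros
there
except possibly at the origin. -/
theorem eval_ne_zero_of_mul_derivative_eq (G : ℂ[X]) (hG : G ≠ 0) (H : ℂ → ℂ) (B : ℝ) (z₀ : ℂ)
    (hz : z₀ ≠ 0) (U : Set ℂ) (hU : U ∈ nhds z₀) (hB : ∀ z ∈ U, ‖H z‖ ≤ B)
    (h : ∀ z ∈ U, z * (derivative G).eval z = H z * G.eval z) : G.eval z₀ ≠ 0 := by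
  intro hroot
  obtain ⟨g, hg, hnd⟩ := exists_eq_pow_rootMultiplicity_mul_and_not_dvd G hG z₀
  have hm : 0 < G.rootMultiplicity z₀ := (rootMultiplicity_pos hG).2 hroot
  obtain ⟨m, hm'⟩ : ∃ m, G.rootMultiplicity z₀ = m + 1 := ⟨_, (Nat.succ_pred_eq_of_pos hm).symm⟩
  rw [hm'] at hg
  have hg0 : g.eval z₀ ≠ 0 := fun h0 => hnd (dvd_iff_isRoot.2 h0)
  have key : ∀ z ∈ U, z ≠ z₀ → ‖z * ((m + 1 : ℕ) * g.eval z)‖ ≤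
      ‖z - z₀‖ * (B * ‖g.eval z‖ + ‖z * (derivative g).eval z‖) := by
    intro z hzU hne
    have h1 := h z hzU
    rw [hg] at h1
    simp only [derivative_mul, derivative_X_sub_C_pow, eval_add, eval_mul, eval_pow, eval_sub,
      eval_X, eval_C, Nat.add_sub_cancel] at h1
    have h2 : z - z₀ ≠ 0 := sub_ne_zero.2 hne
    have h3 : z * ((m + 1 : ℕ) * g.eval z) =
        (z - z₀) * (H z * g.eval z - z * (derivative g).eval z) := by
      apply mul_left_cancel₀ (pow_ne_zero m h2)
      linear_combination h1
    rw [h3, norm_mul]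
    refine mul_le_mul_of_nonneg_left ((norm_sub_le _ _).trans ?_) (norm_nonneg _)
    rw [norm_mul]
    gcongr
    exact hB z hzU
  have t1 : Filter.Tendsto (fun z : ℂ => ‖z * ((m + 1 : ℕ) * g.eval z)‖) (nhdsWithin z₀ {z₀}ᶜ)
      (nhds ‖z₀ * ((m + 1 : ℕ) * g.eval z₀)‖) :=
    (Continuous.tendsto (by fun_prop) z₀).mono_left nhdsWithin_le_nhds
  have t2 : Filter.Tendsto (fun z : ℂ => ‖z - z₀‖ * (B * ‖g.eval z‖ + ‖z * (derivative g).eval z‖))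
      (nhdsWithin z₀ {z₀}ᶜ)
      (nhds (‖z₀ - z₀‖ * (B * ‖g.eval z₀‖ + ‖z₀ * (derivative g).eval z₀‖))) :=
    (Continuous.tendsto (by fun_prop) z₀).mono_left nhdsWithin_le_nhds
  have h5 := le_of_tendsto_of_tendsto t1 t2 (by
    filter_upwards [nhdsWithin_le_nhds hU, self_mem_nhdsWithin] with z h1 h2
    exact key z h1 h2)
  rw [sub_self, norm_zero, zero_mul, norm_le_zero_iff] at h5
  have : ((m + 1 : ℕ) : ℂ) ≠ 0 := Nat.cast_ne_zero.2 (Nat.succ_ne_zero m)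
  exact mul_ne_zero hz (mul_ne_zero this hg0) h5

theorem X_mul_derivative_eq_of_newton (a S : ℕ → ℂ) (A : ℂ[X]) (hA : ∀ n, A.coeff n = a n)
    (hN : ∀ n : ℕ, (n : ℂ) * a n = ∑ j ∈ Icc 1 n, S j * a (n - j)) :
    (PowerSeries.X : PowerSeries ℂ) * (derivative A : ℂ[X]) =
      (PowerSeries.mk fun n => if n = 0 then 0 else S n) * (A : PowerSeries ℂ) := by
  ext n
  rw [PowerSeries.coeff_mul _ (PowerSeries.mk _), Nat.sum_antidiagonal_eq_sum_range_succ_mk]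
  simp only [PowerSeries.coeff_mk, coeff_coe, hA]
  rw [sum_range_succ']
  cases n with
  | zero => simp
  | succ n =>
    rw [mul_comm PowerSeries.X, PowerSeries.coeff_succ_mul_X, coeff_coe, coeff_derivative, hA,
      mul_comm]
    have := hN (n + 1)
    push_cast at this
    rw [this, ← Finset.Ico_add_one_right_eq_Icc, sum_Ico_eq_sum_range]
    simp [add_comm]

theorem norm_coeff_one_le_of_newton (a S : ℕ → ℂ) (k : ℕ) (hk : 0 < k) (ha0 : a 0 = 1)
    (hak : ∀ n, k ≤ n → a n = 0)
    (hN : ∀ n : ℕ, (n : ℂ) * a n = ∑ j ∈ Icc 1 n, S j * a (n - j)) (R C : ℝ) (hR : 0 < R)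
    (hS : ∀ μ : ℕ, 1 ≤ μ → ‖S (2 * μ)‖ ≤ C * R ^ (2 * μ)) : ‖a 1‖ ≤ ((k : ℝ) - 1) * R := by
  have hC : 0 ≤ C := by
    have h1 := (norm_nonneg _).trans (hS 1 le_rfl)
    have h2 : 0 < R ^ (2 * 1) := by positivity
    exact nonneg_of_mul_nonneg_left h1 h2
  let A : ℂ[X] := ∑ n ∈ range k, Polynomial.C (a n) * X ^ n
  have hA : ∀ n, A.coeff n = a n := by
    intro n
    simp only [A, finsetSum_coeff, coeff_C_mul_X_pow]
    rw [Finset.sum_ite_eq]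
    split_ifs with h
    · rfl
    · exact (hak n (by simpa using h)).symm
  have hA0 : A ≠ 0 := fun h => by
    have := hA 0
    rw [h, ha0] at this
    simp at this
  have hAd : A.natDegree ≤ k - 1 := by
    rw [natDegree_le_iff_coeff_eq_zero]
    intro n hn
    rw [hA, hak n (by omega)]
  let G : ℂ[X] := A * A.comp (-X)
  have hAn : ∀ n, (A.comp (-X)).coeff n = (-1) ^ n * a n := by
    intro n
    rw [show (-X : ℂ[X]) = Polynomial.C (-1) * X by simp, comp_C_mul_X_coeff, hA, mul_comm]
  let h : ℕ → ℂ := fun n => if n = 0 then 0 else S n * (1 + (-1) ^ n)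
  have e1 := X_mul_derivative_eq_of_newton a S A hA hN
  have e2 := X_mul_derivative_eq_of_newton (fun n => (-1) ^ n * a n) (fun n => (-1) ^ n * S n)
    (A.comp (-X)) hAn fun n => by
      rw [mul_left_comm, hN, mul_sum]
      refine sum_congr rfl fun j hj => ?_
      rw [mem_Icc] at hj
      nth_rw 1 [show n = j + (n - j) by omega]
      rw [pow_add]
      ring
  have e3 : (PowerSeries.X : PowerSeries ℂ) * (derivative G : ℂ[X]) =
      PowerSeries.mk h * (G : ℂ[X]) := by
    have : PowerSeries.mk h = (PowerSeries.mk fun n => if n = 0 then 0 else S n) +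
        PowerSeries.mk fun n => if n = 0 then 0 else (-1) ^ n * S n := by
      ext n
      simp only [h, map_add, PowerSeries.coeff_mk]
      split_ifs
      · simp
      · ring
    rw [this, derivative_mul, Polynomial.coe_add, Polynomial.coe_mul,
      Polynomial.coe_mul, Polynomial.coe_mul]
    linear_combination (A.comp (-X) : PowerSeries ℂ) * e1 + (A : PowerSeries ℂ) * e2
  have hG0 : G ≠ 0 := by
    refine mul_ne_zero hA0 fun h => ?_
    have := hAn 0
    rw [h, ha0] at this
    simp at this
  have hrec : ∀ n : ℕ, (n : ℂ) * G.coeff n = ∑ p ∈ antidiagonal n, h p.1 * G.coeff p.2 := by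
    intro n
    have := congrArg (PowerSeries.coeff n) e3
    rw [PowerSeries.coeff_mul _ (PowerSeries.mk _)] at this
    simp only [PowerSeries.coeff_mk, coeff_coe] at this
    rw [← this]
    cases n with
    | zero => simp
    | succ n =>
      rw [mul_comm PowerSeries.X, PowerSeries.coeff_succ_mul_X, coeff_coe, coeff_derivative]
      push_cast; ring
  have hnorm : ∀ n, ‖h n‖ ≤ 2 * C * R ^ n := by
    intro n
    simp only [h]
    split_ifs with h0
    · simp; positivity
    · rcases Nat.even_or_odd n with he | ho
      · obtain ⟨μ, rfl⟩ := he.two_dvd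
        rw [Even.neg_one_pow (by simp), norm_mul]
        have := hS μ (by omega)
        norm_num
        linarith
      · rw [ho.neg_one_pow]; simp; positivity
  have hroot : ∀ z ∈ A.roots, 1 / R ≤ ‖z‖ := by
    intro z₀ hz₀
    by_contra! hlt
    obtain ⟨t, ht1, ht2⟩ := exists_between hlt
    have hz0 : z₀ ≠ 0 := by
      rintro rfl
      have := (mem_roots'.1 hz₀).2
      rw [IsRoot.def, ← coeff_zero_eq_eval_zero, hA, ha0] at this
      exact one_ne_zero this
    have ht0 : 0 < t := lt_of_le_of_lt (norm_nonneg _) ht1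
    have hRt : R * t < 1 := by rwa [lt_div_iff₀ hR, mul_comm] at ht2
    have hb : ∀ z ∈ Metric.ball (0 : ℂ) t, ∀ n, ‖h n * z ^ n‖ ≤ 2 * C * (R * t) ^ n := by
      intro z hz n
      rw [mem_ball_zero_iff] at hz
      rw [norm_mul, norm_pow, mul_pow, ← mul_assoc]
      exact mul_le_mul (hnorm n) (pow_le_pow_left₀ (norm_nonneg _) hz.le n) (by positivity)
        (by positivity)
    have hsum : Summable fun n => 2 * C * (R * t) ^ n :=
      (summable_geometric_of_lt_one (by positivity) hRt).mul_left _
    refine eval_ne_zero_of_mul_derivative_eq G hG0 (fun z => ∑' n, h n * z ^ n)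
      (∑' n, 2 * C * (R * t) ^ n) z₀ hz0 (Metric.ball 0 t)
      (Metric.isOpen_ball.mem_nhds (by simpa using ht1)) ?_ ?_ ?_
    · intro z hz
      exact tsum_of_norm_bounded hsum.hasSum (hb z hz)
    · intro z hz
      have hGs := hasSum_coeff_eval G z
      have hGn : Summable fun n => ‖G.coeff n * z ^ n‖ := 
        summable_of_ne_finset_zero (s := range (G.natDegree + 1)) fun n hn => by
          rw [coeff_eq_zero_of_natDegree_lt (by simpa using hn), zero_mul, norm_zero]
      have hhn : Summable fun n => ‖h n * z ^ n‖ :=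
        Summable.of_nonneg_of_le (fun _ => norm_nonneg _) (hb z hz) hsum
      rw [← hGs.tsum_eq, tsum_mul_tsum_eq_tsum_sum_antidiagonal_of_summable_norm hhn hGn]
      have := (hasSum_coeff_eval (X * derivative G) z).tsum_eq
      rw [eval_mul, eval_X] at this
      rw [← this]
      refine tsum_congr fun n => ?_
      have e2 : (X * derivative G).coeff n = n * G.coeff n := by
        cases n with
        | zero => simp
        | succ n => rw [coeff_X_mul, coeff_derivative]; push_cast; ring
      rw [e2, hrec, sum_mul]
      refine sum_congr rfl fun p hp => ?_
      rw [← mem_antidiagonal.1 hp, pow_add]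
      ring
    · rw [eval_mul, (mem_roots'.1 hz₀).2, zero_mul]
  have hev0 : A.eval 0 = 1 := by rw [← coeff_zero_eq_eval_zero, hA, ha0]
  have h1 := (IsAlgClosed.splits A).eval_derivative_div_eval_of_ne_zero (x := 0)
    (by rw [hev0]; exact one_ne_zero)
  rw [hev0, div_one, ← coeff_zero_eq_eval_zero, coeff_derivative, hA] at h1
  norm_num at h1
  rw [h1]
  calc _ ≤ (A.roots.map fun z => ‖-z⁻¹‖).sum := by
        have := norm_multiset_sum_le (A.roots.map fun z => -z⁻¹)
        rwa [Multiset.map_map, Multiset.sum_map_neg] at this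
    _ ≤ (A.roots.map fun _ => R).sum := by
        refine Multiset.sum_map_le_sum_map _ _ fun z hz => ?_
        have := hroot z hz
        rw [norm_neg, norm_inv]
        exact inv_le_of_inv_le₀ hR (by rwa [← one_div])
    _ = A.roots.card * R := by simp
    _ ≤ _ := by
        gcongr
        have : A.roots.card ≤ k - 1 := (card_roots' A).trans hAd
        have h3 : ((A.roots.card : ℕ) : ℝ) ≤ ((k - 1 : ℕ) : ℝ) := by exact_mod_cast this
        rwa [Nat.cast_sub hk, Nat.cast_one] at h3

section GaloisField

variable {p : ℕ} [Fact p.Prime]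

theorem eval_conjPoly {j : ℕ} (hj : j ≠ 0) (α : GaloisField p j) (ρ : ZMod p) :
    (conjPoly j α).eval ρ = (-1) ^ j * Algebra.norm (ZMod p) (α - algebraMap (ZMod p) _ ρ) := by
  have hfr := GaloisField.finrank p hj
  have : FiniteDimensional (ZMod p) (GaloisField p j) :=
    Module.finite_of_finrank_pos (by omega)
  set β := α - algebraMap (ZMod p) _ ρ with hβ
  have hint : IsIntegral (ZMod p) β := Algebra.IsIntegral.isIntegral β
  have hmin : minpoly (ZMod p) β = (minpoly (ZMod p) α).comp (X + C ρ) :=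
    minpoly.sub_algebraMap α ρ
  have hdeg : (minpoly (ZMod p) β).natDegree = (minpoly (ZMod p) α).natDegree := by
    rw [hmin, natDegree_comp, natDegree_X_add_C, mul_one]
  have hdvd := natDegree_minpoly_dvd hj β
  have h1 : Module.finrank (IntermediateField.adjoin (ZMod p) {β}) (GaloisField p j) =
      j / (minpoly (ZMod p) β).natDegree := by
    have := Module.finrank_mul_finrank (ZMod p) (IntermediateField.adjoin (ZMod p) {β})
      (GaloisField p j)
    rw [IntermediateField.adjoin.finrank hint, hfr] at this
    exact (Nat.div_eq_of_eq_mul_right (minpoly.natDegree_pos hint) this.symm).symm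
  have h2 : Algebra.norm (ZMod p) (IntermediateField.AdjoinSimple.gen (ZMod p) β) =
      (-1) ^ (minpoly (ZMod p) β).natDegree * (minpoly (ZMod p) β).coeff 0 := by
    have := Algebra.PowerBasis.norm_gen_eq_coeff_zero_minpoly
      (IntermediateField.adjoin.powerBasis hint)
    rwa [IntermediateField.adjoin.powerBasis_gen, IntermediateField.adjoin.powerBasis_dim,
      IntermediateField.minpoly_gen] at this
  rw [Algebra.norm_eq_norm_adjoin, h1, h2, mul_pow, ← pow_mul, Nat.mul_div_cancel' hdvd,
    ← mul_assoc, ← mul_pow, neg_one_mul, neg_neg, one_pow, one_mul, coeff_zero_eq_eval_zero, hdeg,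
    hmin, eval_comp, conjPoly, eval_pow]
  simp

theorem norm_sum_mulChar_le {K : Type*} [Fintype K] (χ : MulChar (ZMod p) ℂ)
    (hχ : χ ≠ 1) (n : K → ZMod p) (T Z : ℝ)
    (hT : ∀ ζ : ZMod p, ζ ≠ 0 → ((Fintype.card (ZMod p) : ℝ) - 1) * #{α | n α = ζ} ≤
      Fintype.card K + T)
    (hZ : (#{α | n α = 0} : ℝ) ≤ Z) : ‖∑ α, χ (n α)‖ ≤ T + Z := by
  have hd : 0 < (Fintype.card (ZMod p) : ℝ) - 1 := by
    have := Fintype.one_lt_card (α := ZMod p)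
    have : (1 : ℝ) < Fintype.card (ZMod p) := by exact_mod_cast this
    linarith
  set d := (Fintype.card (ZMod p) : ℝ) - 1
  set w : ZMod p → ℝ := fun ζ => (Fintype.card K + T) / d - #{α | n α = ζ}
  have hw : ∀ ζ ≠ 0, 0 ≤ w ζ := fun ζ hζ => by
    simp only [w, sub_nonneg]
    rw [le_div_iff₀ hd, mul_comm]
    exact hT ζ hζ
  have h0 : χ 0 = 0 := χ.map_nonunit (by simp)
  have h1 : ∑ α, χ (n α) = ∑ ζ, χ ζ * #{α | n α = ζ} := by
    rw [← Finset.sum_fiberwise (s := univ) (g := n)]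
    refine sum_congr rfl fun ζ _ => ?_
    rw [sum_congr rfl (g := fun _ => χ ζ) fun α hα => by rw [(mem_filter.1 hα).2], sum_const,
      nsmul_eq_mul, mul_comm]
  have h2 : ∑ α, χ (n α) = -∑ ζ ∈ univ.erase 0, χ ζ * w ζ := by
    have : ∑ ζ, χ ζ * w ζ = -∑ ζ, χ ζ * #{α | n α = ζ} := by
      simp only [w]
      push_cast
      simp_rw [mul_sub]
      rw [sum_sub_distrib, ← sum_mul, MulChar.sum_eq_zero_of_ne_one hχ, zero_mul, zero_sub]
    rw [h1, ← neg_eq_iff_eq_neg.2 this, ← add_sum_erase univ _ (mem_univ (0 : ZMod p)), h0,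
      zero_mul, zero_add]
  have h3 : ∑ ζ : ZMod p, (#{α | n α = ζ} : ℝ) = Fintype.card K := by
    have := card_eq_sum_card_fiberwise (f := n) (s := univ) (t := univ) (fun _ _ => by simp)
    rw [← card_univ, this]
    push_cast
    rfl
  have h4 : #((univ : Finset (ZMod p)).erase 0) = d := by
    rw [card_erase_of_mem (mem_univ _), card_univ, Nat.cast_sub Fintype.card_pos, Nat.cast_one]
  rw [h2, norm_neg]
  calc _ ≤ ∑ ζ ∈ univ.erase (0 : ZMod p), w ζ := by
        refine (norm_sum_le _ _).trans (sum_le_sum fun ζ hζ => ?_)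
        have := hw ζ (ne_of_mem_erase hζ)
        rw [norm_mul, Complex.norm_real, Real.norm_of_nonneg this]
        exact mul_le_of_le_one_left this (DirichletCharacter.norm_le_one χ ζ)
    _ = Fintype.card K + T - (Fintype.card K - #{α | n α = 0}) := by
        simp only [w]
        rw [sum_sub_distrib, sum_const, nsmul_eq_mul, h4, mul_div_cancel₀ _ hd.ne', ← h3,
          ← add_sum_erase univ _ (mem_univ (0 : ZMod p))]
        ring
    _ ≤ _ := by linarith

theorem norm_sum_conjPoly_le [∀ j, Fintype (GaloisField p j)] (χ : MulChar (ZMod p) ℂ) (hχ : χ ≠ 1)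
    (s : Finset (ZMod p)) (m : ZMod p → ℕ) (hm0 : ∀ ρ ∈ s, m ρ ≠ 0)
    (hs : s.Nonempty) (hm : Nat.Coprime (p - 1) (∑ ρ ∈ s, m ρ)) (μ : ℕ) (hμ : 1 ≤ μ) :
    ‖∑ α : GaloisField p (2 * μ), polyChar s (fun ρ => χ ^ m ρ) (conjPoly (2 * μ) α)‖ ≤
      (16 * ((p - 1 : ℕ) * (∑ ρ ∈ s, m ρ : ℕ))) * (p : ℝ) ^ μ := by
  classical
  have hp := (Fact.out : p.Prime)
  have hj : 2 * μ ≠ 0 := by omega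
  set K := GaloisField p (2 * μ)
  set D := ∑ ρ ∈ s, m ρ
  set d := p - 1
  have hd : 0 < d := Nat.sub_pos_of_lt hp.one_lt
  have hD : 0 < D := by
    obtain ⟨ρ, hρ⟩ := hs
    exact (Nat.pos_of_ne_zero (hm0 ρ hρ)).trans_le (single_le_sum (fun _ _ => Nat.zero_le _) hρ)
  set Q := p ^ μ with hQ
  have hcard : Fintype.card K = Q ^ 2 := by
    rw [← Nat.card_eq_fintype_card, GaloisField.card p _ hj, hQ, ← pow_mul, mul_comm]
  let g : K[X] := ∏ ρ ∈ s, (X - C (algebraMap (ZMod p) K ρ)) ^ m ρ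
  let n : K → ZMod p := fun α => ∏ ρ ∈ s, ((conjPoly (2 * μ) α).eval ρ) ^ m ρ
  have hgm : g.Monic := monic_prod_of_monic _ _ fun ρ _ => (monic_X_sub_C _).pow _
  have hgD : g.natDegree = D := by
    rw [natDegree_prod_of_monic _ _ fun ρ _ => (monic_X_sub_C _).pow _]
    simp [D]
  have hn : ∀ α, algebraMap (ZMod p) K (n α) = g.eval α ^ ((Q ^ 2 - 1) / d) := by
    intro α
    simp only [n, g, map_prod, map_pow, eval_prod, eval_pow, eval_sub, eval_X, eval_C]
    rw [← prod_pow]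
    refine prod_congr rfl fun ρ _ => ?_
    rw [eval_conjPoly hj, Even.neg_one_pow (by simp), one_mul, FiniteField.algebraMap_norm_eq_pow,
      Nat.card_eq_fintype_card, Nat.card_eq_fintype_card, hcard, ZMod.card,
      ← pow_mul, pow_right_comm, ← pow_mul]
    ring
  have hdvd : d ∣ Q ^ 2 - 1 := by
    rw [hQ, ← pow_mul]
    simpa using Nat.sub_dvd_pow_sub_pow p 1 (μ * 2)
  have hexp : (Q ^ 2 - 1) / d ≠ 0 := by
    have : 1 < Q ^ 2 := Nat.one_lt_pow two_ne_zero (Nat.one_lt_pow (by omega) hp.one_lt)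
    exact (Nat.div_pos (Nat.le_of_dvd (by omega) hdvd) hd).ne'
  have hsum : ∀ α : K, polyChar s (fun ρ => χ ^ m ρ) (conjPoly (2 * μ) α) = χ (n α) := by
    intro α
    rw [polyChar_apply, map_prod]
    refine prod_congr rfl fun ρ hρ => ?_
    rw [MulChar.pow_apply' _ (hm0 ρ hρ), map_pow]
  rw [sum_congr rfl fun α _ => hsum α, ← Nat.cast_pow, ← hQ]
  rcases le_or_gt (16 * (d * D)) Q with hle | hlt
  · have := norm_sum_mulChar_le χ hχ n (12 * (d * D) * Q) D ?_ ?_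
    · refine this.trans ?_
      have h1 : (1 : ℝ) ≤ d := by exact_mod_cast hd
      have h2 : (1 : ℝ) ≤ Q := by exact_mod_cast Nat.one_le_pow _ _ hp.pos
      have h3 : (D : ℝ) ≤ d * D * Q := by
        calc (D : ℝ) = 1 * D * 1 := by ring
          _ ≤ _ := by gcongr
      have h4 : (0 : ℝ) ≤ d * D * Q := by positivity
      linarith
    · intro ζ _
      have hst := stepanov_bound (K := K) p μ Q d D hQ hcard hd hD hdvd g hgD hm hle
        (algebraMap (ZMod p) K ζ)
      have he : (univ.filter fun α => n α = ζ) = univ.filter fun α =>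
          g.eval α ^ ((Q ^ 2 - 1) / d) = algebraMap (ZMod p) K ζ := by
        ext α
        simp only [mem_filter, mem_univ, true_and, ← hn]
        exact (algebraMap (ZMod p) K).injective.eq_iff.symm
      rw [he, hcard, ZMod.card, ← Nat.cast_one, ← Nat.cast_sub hp.one_lt.le]
      exact_mod_cast hst
    · have : (univ.filter fun α => n α = 0) ⊆ g.roots.toFinset := by
        intro α hα
        have h1 := hn α
        rw [(mem_filter.1 hα).2, map_zero] at h1
        rw [Multiset.mem_toFinset, mem_roots hgm.ne_zero]
        exact pow_eq_zero_iff hexp |>.1 h1.symm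
      have h2 := (card_le_card this).trans ((Multiset.toFinset_card_le _).trans (card_roots' g))
      rw [hgD] at h2
      exact_mod_cast h2
  · have : ‖∑ α : K, χ (n α)‖ ≤ (Fintype.card K : ℝ) := by
      refine (norm_sum_le _ _).trans ?_
      refine (sum_le_sum fun α _ => DirichletCharacter.norm_le_one χ (n α)).trans ?_
      simp
    refine this.trans ?_
    rw [hcard]
    have h2 : (Q : ℝ) ≤ 16 * (d * D) := by exact_mod_cast hlt.le
    push_cast
    rw [sq]
    gcongr

/-- Weil's bound for complete character sums of completely split polynomials. -/
theorem norm_sum_prod_mulChar_le (χ : MulChar (ZMod p) ℂ) (hχ : χ ≠ 1)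
    (s : Finset (ZMod p)) (m : ZMod p → ℕ) (hm0 : ∀ ρ ∈ s, m ρ ≠ 0)
    (hm : Nat.Coprime (p - 1) (∑ ρ ∈ s, m ρ)) :
    ‖∑ x : ZMod p, ∏ ρ ∈ s, χ (x + ρ) ^ m ρ‖ ≤ ((#s : ℝ) - 1) * √p := by
  classical
  have hp := (Fact.out : p.Prime)
  have : ∀ j, Fintype (GaloisField p j) := fun j => Fintype.ofFinite _
  obtain ⟨ρ₀, hρ₀, hψ⟩ : ∃ ρ₀ ∈ s, χ ^ m ρ₀ ≠ 1 := by
    by_contra! h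
    apply hχ
    have h1 : χ ^ (∑ ρ ∈ s, m ρ) = 1 := by
      rw [← prod_pow_eq_pow_sum]
      exact prod_eq_one h
    have h2 : χ ^ (p - 1) = 1 := by
      have := MulChar.pow_card_eq_one χ
      rwa [ZMod.card_units] at this
    have := pow_gcd_eq_one.2 ⟨h2, h1⟩
    rwa [Nat.Coprime.gcd_eq_one hm, pow_one] at this
  have hs : s.Nonempty := ⟨_, hρ₀⟩
  set ψ : ZMod p → MulChar (ZMod p) ℂ := fun ρ => χ ^ m ρ
  have key := norm_coeff_one_le_of_newton (fun n => ∑ h ∈ monics (ZMod p) n, polyChar s ψ h)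
    (fun j => ∑ α : GaloisField p j, polyChar s ψ (conjPoly j α)) #s (card_pos.2 hs)
    ?_ (fun n hn => sum_monics_polyChar_eq_zero s ψ ρ₀ hρ₀ hψ n hn) (fun n => newton_monics _ n)
    (√p) (16 * ((p - 1 : ℕ) * (∑ ρ ∈ s, m ρ : ℕ))) (by have := hp.pos; positivity) ?_
  · convert key using 2
    symm
    refine Finset.sum_bij' (fun h _ => h.coeff 0) (fun x _ => X + C x) ?_ ?_ ?_ ?_ ?_
    · simp
    · intro x _
      rw [mem_monics]
      exact ⟨monic_X_add_C x, natDegree_X_add_C x⟩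
    · intro h hh
      rw [mem_monics] at hh
      conv_rhs => rw [eq_X_add_C_of_natDegree_le_one hh.2.le]
      rw [show h.coeff 1 = 1 by rw [← hh.2]; exact hh.1]
      simp
    · simp
    · intro h hh
      rw [mem_monics] at hh
      have : h = X + C (h.coeff 0) := by
        conv_lhs => rw [eq_X_add_C_of_natDegree_le_one hh.2.le]
        rw [show h.coeff 1 = 1 by rw [← hh.2]; exact hh.1]
        simp
      rw [polyChar_apply]
      refine prod_congr rfl fun ρ hρ => ?_
      rw [MulChar.pow_apply' _ (hm0 ρ hρ), this]
      simp [add_comm]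
  · have : monics (ZMod p) 0 = {1} := by
      ext h
      rw [mem_monics, mem_singleton]
      constructor
      · rintro ⟨h1, h2⟩
        exact h1.natDegree_eq_zero.1 h2
      · rintro rfl
        simp
    simp [this]
  · intro μ hμ
    have := norm_sum_conjPoly_le χ hχ s m hm0 hs hm μ hμ
    rwa [pow_mul, Real.sq_sqrt (by positivity)]

end GaloisField

theorem prod_zpow_eq_zpow_sum {ι : Type*} (t : Finset ι) (n : ι → ℤ) {z : ℂ} (hz : z ≠ 0) :
    ∏ i ∈ t, z ^ n i = z ^ ∑ i ∈ t, n i := by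
  classical
  induction t using Finset.induction_on with
  | empty => simp
  | insert i t hi ih => rw [prod_insert hi, sum_insert hi, zpow_add₀ hz, ih]

theorem mulChar_ne_zero {R : Type*} [CommMonoid R] (χ : MulChar R ℂ) {u : R} (hu : IsUnit u) :
    χ u ≠ 0 := (hu.map χ).ne_zero

theorem norm_prod_zpow_le {ι : Type*} [Fintype ι] {k : ℕ} (χ : MulChar (ZMod k) ℂ) (σ : ι → ℤˣ)
    (y : ι → ZMod k) : ‖∏ i, χ (y i) ^ (σ i : ℤ)‖ ≤ 1 := by
  rw [norm_prod]
  refine prod_le_one (fun _ _ => norm_nonneg _) fun i _ => ?_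
  rw [norm_zpow]
  by_cases hu : IsUnit (y i)
  · obtain ⟨u, hu⟩ := hu
    rw [← hu, DirichletCharacter.unit_norm_eq_one χ u, one_zpow]
  · rw [χ.map_nonunit hu, norm_zero, zero_zpow _ (σ i).ne_zero]
    exact zero_le_one

theorem norm_correlation_prime_le {p : ℕ} [Fact p.Prime] {ι : Type*} [Fintype ι] [DecidableEq ι]
    (χ : MulChar (ZMod p) ℂ) (hχ : χ ≠ 1)
    (σ : ι → ℤˣ) (hσ : ∑ i, (σ i : ℤ) = 0) (b : ι → ZMod p) (i₀ : ι)
    (hb : ∀ i, i ≠ i₀ → b i ≠ b i₀) :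
    ‖∑ x : ZMod p, ∏ i, χ (x + b i) ^ (σ i : ℤ)‖ ≤ Fintype.card ι * √p := by
  classical
  have hp := (Fact.out : p.Prime)
  have h2p : 2 < p := by
    rcases hp.two_le.lt_or_eq with h | h
    · exact h
    · exfalso
      subst h
      apply hχ
      ext a
      rw [show a = 1 from Subsingleton.elim _ _]
      simp
  let c : ι → ZMod p := fun i => b i - b i₀
  have hc : ∀ i, i ≠ i₀ → c i ≠ 0 := fun i hi => sub_ne_zero.2 (hb i hi)
  let n : ι → ℕ := fun i => if σ i = 1 then 1 else p - 2
  have hn : ∀ i, n i ≠ 0 := fun i => by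
    simp only [n]; split_ifs <;> omega
  have hnσ : ∀ i, ((n i : ℕ) : ZMod (p - 1)) = ((σ i : ℤ) : ZMod (p - 1)) := by
    intro i
    rcases Int.units_eq_one_or (σ i) with h | h
    · simp [n, h]
    · have h1 : n i + 1 = p - 1 := by simp [n, h]; omega
      have h2 : ((n i + 1 : ℕ) : ZMod (p - 1)) = 0 := by rw [h1, ZMod.natCast_self]
      rw [h]
      push_cast at h2 ⊢
      linear_combination h2
  have hpow : ∀ i a, χ a ^ (σ i : ℤ) = χ a ^ n i := by
    intro i a
    rcases Int.units_eq_one_or (σ i) with h | h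
    · simp [n, h]
    · simp only [n, h, Units.val_neg, Units.val_one, zpow_neg, zpow_one]
      rw [if_neg (by decide)]
      by_cases ha : a = 0
      · rw [ha, χ.map_nonunit (by simp), inv_zero, zero_pow (by omega)]
      · have h1 : χ a ^ (p - 1) = 1 := by
          rw [← map_pow, ZMod.pow_card_sub_one_eq_one ha, map_one]
        have h2 : χ a * χ a ^ (p - 2) = 1 := by
          rw [← pow_succ', ← h1]; congr 1; omega
        exact inv_eq_of_mul_eq_one_right h2
  set t := (univ : Finset ι).erase i₀
  have ht : #t = Fintype.card ι - 1 := by rw [card_erase_of_mem (mem_univ _), card_univ]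
  have hcardι : 0 < Fintype.card ι := Fintype.card_pos_iff.2 ⟨i₀⟩
  let s : Finset (ZMod p) := t.image fun i => (c i)⁻¹
  let m : ZMod p → ℕ := fun ρ => ∑ i ∈ t with (c i)⁻¹ = ρ, n i
  have hm0 : ∀ ρ ∈ s, m ρ ≠ 0 := by
    intro ρ hρ
    obtain ⟨i, hi, rfl⟩ := mem_image.1 hρ
    have : n i ≤ m (c i)⁻¹ := single_le_sum (f := n) (s := {j ∈ t | (c j)⁻¹ = (c i)⁻¹})
      (fun _ _ => Nat.zero_le _) (mem_filter.2 ⟨hi, rfl⟩)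
    have := hn i
    omega
  have hmsum : ∑ ρ ∈ s, m ρ = ∑ i ∈ t, n i :=
    sum_fiberwise_of_maps_to (fun i hi => mem_image_of_mem _ hi) _
  have hcop : Nat.Coprime (p - 1) (∑ ρ ∈ s, m ρ) := by
    rw [hmsum, Nat.coprime_comm, ← ZMod.isUnit_iff_coprime]
    push_cast
    simp_rw [hnσ]
    rw [← Int.cast_sum]
    have : ∑ i ∈ t, (σ i : ℤ) = ((-σ i₀ : ℤˣ) : ℤ) := by
      rw [← add_sum_erase univ _ (mem_univ i₀)] at hσ
      push_cast
      linarith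
    rw [this]
    exact (Units.isUnit _).map (Int.castRingHom _)
  have hweil := norm_sum_prod_mulChar_le χ hχ s m hm0 hcop
  have hprod : ∀ y, ∏ ρ ∈ s, χ (y + ρ) ^ m ρ = ∏ i ∈ t, χ (y + (c i)⁻¹) ^ n i := by
    intro y
    rw [← prod_fiberwise_of_maps_to (s := t) (t := s) (g := fun i => (c i)⁻¹)
      (fun i hi => mem_image_of_mem _ hi)]
    refine prod_congr rfl fun ρ _ => ?_
    rw [← prod_pow_eq_pow_sum]
    refine prod_congr rfl fun i hi => ?_
    rw [(mem_filter.1 hi).2]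
  simp_rw [hprod] at hweil
  have h0 : χ 0 = 0 := χ.map_nonunit (by simp)
  let w : ℂ := ∏ i ∈ t, χ (c i) ^ n i
  have hw : ‖w‖ ≤ 1 := by
    rw [norm_prod]
    refine prod_le_one (fun _ _ => norm_nonneg _) fun i _ => ?_
    rw [norm_pow]
    exact pow_le_one₀ (norm_nonneg _) (DirichletCharacter.norm_le_one χ _)
  have hS : ∑ x : ZMod p, ∏ i, χ (x + b i) ^ (σ i : ℤ) =
      w * (∑ y, ∏ i ∈ t, χ (y + (c i)⁻¹) ^ n i) - w * ∏ i ∈ t, χ (0 + (c i)⁻¹) ^ n i := by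
    rw [← Equiv.sum_comp (Equiv.subRight (b i₀)), ← Equiv.sum_comp (Equiv.inv (ZMod p)),
      ← add_sum_erase univ _ (mem_univ (0 : ZMod p)),
      ← add_sum_erase univ (fun y => ∏ i ∈ t, χ (y + (c i)⁻¹) ^ n i) (mem_univ (0 : ZMod p))]
    have e0 : ∏ i, χ (Equiv.subRight (b i₀) (Equiv.inv (ZMod p) 0) + b i) ^ (σ i : ℤ) = 0 := by
      refine prod_eq_zero (mem_univ i₀) ?_
      simp [h0, zero_zpow _ (σ i₀).ne_zero]
    rw [e0, zero_add, mul_add, add_sub_cancel_left, mul_sum]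
    refine sum_congr rfl fun y hy => ?_
    have hy0 : y ≠ 0 := ne_of_mem_erase hy
    have e1 : ∀ i, χ (Equiv.subRight (b i₀) (Equiv.inv (ZMod p) y) + b i) ^ (σ i : ℤ) =
        χ y⁻¹ ^ (σ i : ℤ) * χ (1 + c i * y) ^ (σ i : ℤ) := by
      intro i
      rw [← mul_zpow, ← map_mul]
      congr 2
      simp only [Equiv.subRight_apply, Equiv.inv_apply, c]
      field_simp
      ring
    simp_rw [e1]
    rw [prod_mul_distrib, prod_zpow_eq_zpow_sum _ _ (mulChar_ne_zero χ (by simp [hy0])), hσ,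
      zpow_zero,
      one_mul, ← mul_prod_erase univ _ (mem_univ i₀)]
    simp only [c, sub_self, zero_mul, add_zero, map_one, one_zpow, one_mul, w]
    rw [← prod_mul_distrib]
    refine prod_congr rfl fun i hi => ?_
    have := hc i (ne_of_mem_erase hi)
    rw [hpow, ← mul_pow, ← map_mul]
    congr 2
    simp only [c] at this
    field_simp
    ring
  rw [hS]
  have hsc : ((#s : ℕ) : ℝ) ≤ Fintype.card ι - 1 := by
    have : #s ≤ Fintype.card ι - 1 := card_image_le.trans ht.le
    rw [← Nat.cast_one, ← Nat.cast_sub hcardι]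
    exact_mod_cast this
  have hsq : 1 ≤ √(p : ℝ) := Real.one_le_sqrt.2 (by exact_mod_cast hp.one_lt.le)
  have hterm : ‖∏ i ∈ t, χ (0 + (c i)⁻¹) ^ n i‖ ≤ 1 := by
    rw [norm_prod]
    refine prod_le_one (fun _ _ => norm_nonneg _) fun i _ => ?_
    rw [norm_pow]
    exact pow_le_one₀ (norm_nonneg _) (DirichletCharacter.norm_le_one χ _)
  calc _ ≤ 1 * (((#s : ℝ) - 1) * √p) + 1 * 1 := by
        refine (norm_sub_le _ _).trans (add_le_add ?_ ?_)
        · rw [norm_mul]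
          exact mul_le_mul hw hweil (norm_nonneg _) zero_le_one
        · rw [norm_mul]
          exact mul_le_mul hw hterm (norm_nonneg _) zero_le_one
    _ ≤ _ := by nlinarith

theorem ZMod.isUnit_prime_sq_iff {p : ℕ} [Fact p.Prime] (x : ZMod (p ^ 2)) :
    IsUnit x ↔ ZMod.castHom (dvd_pow_self p two_ne_zero) (ZMod p) x ≠ 0 := by
  have hp := (Fact.out : p.Prime)
  have : NeZero (p ^ 2) := ⟨pow_ne_zero _ hp.ne_zero⟩
  obtain ⟨n, rfl⟩ := ZMod.natCast_zmod_surjective x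
  rw [ZMod.isUnit_iff_coprime, map_natCast, Ne, ZMod.natCast_eq_zero_iff,
    Nat.coprime_pow_right_iff two_pos,
    Nat.coprime_comm, hp.coprime_iff_not_dvd]

theorem card_filter_castHom_prime_sq_le {p : ℕ} [Fact p.Prime] (s : Finset (ZMod p)) :
    #{x : ZMod (p ^ 2) | ZMod.castHom (dvd_pow_self p two_ne_zero) (ZMod p) x ∈ s} ≤ p * #s := by
  have hp := (Fact.out : p.Prime)
  have : NeZero (p ^ 2) := ⟨pow_ne_zero _ hp.ne_zero⟩
  have h : p * #s = #(range p ×ˢ s) := by rw [card_product, card_range]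
  rw [h]
  refine card_le_card_of_injOn
    (fun x => (x.val / p, ZMod.castHom (dvd_pow_self p two_ne_zero) (ZMod p) x)) ?_ ?_
  · intro x hx
    have hx' := (mem_filter.1 hx).2
    rw [mem_coe, mem_product, mem_range]
    refine ⟨Nat.div_lt_of_lt_mul ?_, hx'⟩
    rw [← sq]
    exact ZMod.val_lt x
  · intro x _ y _ hxy
    simp only [Prod.mk.injEq] at hxy
    obtain ⟨h1, h2⟩ := hxy
    rw [← ZMod.natCast_zmod_val x, ← ZMod.natCast_zmod_val y, map_natCast, map_natCast,
      ZMod.natCast_eq_natCast_iff'] at h2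
    apply ZMod.val_injective
    rw [← Nat.div_add_mod x.val p, ← Nat.div_add_mod y.val p, h1, h2]

theorem norm_correlation_prime_sq_le {p : ℕ} [Fact p.Prime] {ι : Type*} [Fintype ι] [DecidableEq ι]
    (χ : MulChar (ZMod (p ^ 2)) ℂ) (v : ZMod (p ^ 2)) (hv : χ (1 + (p : ZMod (p ^ 2)) * v) ≠ 1)
    (σ : ι → ℤˣ) (b : ι → ZMod (p ^ 2)) (i₀ : ι)
    (hb : ∀ i, i ≠ i₀ → IsUnit (b i - b i₀)) :
    ‖∑ x, ∏ i, χ (x + b i) ^ (σ i : ℤ)‖ ≤ Fintype.card ι * p := by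
  classical
  have hp := (Fact.out : p.Prime)
  set π : ZMod (p ^ 2) := (p : ZMod (p ^ 2)) with hπ
  have hpp : π * π = 0 := by
    rw [hπ, ← sq, ← Nat.cast_pow, ZMod.natCast_self]
  have hunit : ∀ x y : ZMod (p ^ 2), IsUnit x → IsUnit (x + π * y) := by
    intro x y hx
    rw [ZMod.isUnit_prime_sq_iff] at hx ⊢
    simpa [hπ] using hx
  let φ := ZMod.castHom (dvd_pow_self p two_ne_zero) (ZMod p)
  let f : ZMod (p ^ 2) → ℂ := fun x => ∏ i, χ (x + b i) ^ (σ i : ℤ)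
  let w : ZMod (p ^ 2) → ZMod (p ^ 2) := fun x => ∑ i, (σ i : ℤ) * Ring.inverse (x + b i)
  let W : Finset (ZMod (p ^ 2)) := {x | (∀ i, IsUnit (x + b i)) ∧ ¬ IsUnit (w x)}
  have hadd : ∀ y z : ZMod (p ^ 2), χ (1 + π * y) * χ (1 + π * z) = χ (1 + π * (y + z)) := by
    intro y z
    rw [← map_mul]
    congr 1
    linear_combination y * z * hpp
  have hsgn : ∀ (i : ι) y, χ (1 + π * y) ^ (σ i : ℤ) = χ (1 + π * ((σ i : ℤ) * y)) := by
    intro i y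
    rcases Int.units_eq_one_or (σ i) with h | h
    · simp [h]
    · rw [h, Units.val_neg, Units.val_one, zpow_neg, zpow_one]
      refine inv_eq_of_mul_eq_one_right ?_
      rw [hadd]
      simp
  have hprod : ∀ (t : Finset ι) (y : ι → ZMod (p ^ 2)),
      ∏ i ∈ t, χ (1 + π * y i) = χ (1 + π * ∑ i ∈ t, y i) := by
    intro t y
    induction t using Finset.induction_on with
    | empty => simp
    | insert i t hi ih => rw [prod_insert hi, sum_insert hi, ih, hadd]
  have hshift : ∀ x, (∀ i, IsUnit (x + b i)) → ∀ t, f (x + π * t) =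
      f x * χ (1 + π * (t * w x)) := by
    intro x hx t
    simp only [f, w]
    rw [mul_sum, ← hprod, ← prod_mul_distrib]
    refine prod_congr rfl fun i _ => ?_
    rw [show t * ((σ i : ℤ) * Ring.inverse (x + b i)) =
        (σ i : ℤ) * (t * Ring.inverse (x + b i)) by ring,
      ← hsgn, ← mul_zpow, ← map_mul]
    congr 2
    linear_combination (-π * t) * Ring.mul_inverse_cancel _ (hx i)
  have hT : ∑ t, χ (1 + π * t) = 0 := by
    have h1 : (∑ t, χ (1 + π * t)) * χ (1 + π * v) = ∑ t, χ (1 + π * t) := by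
      rw [sum_mul, ← Equiv.sum_comp (Equiv.addRight v) fun t => χ (1 + π * t)]
      exact sum_congr rfl fun t _ => hadd t v
    have h2 : (∑ t, χ (1 + π * t)) * (χ (1 + π * v) - 1) = 0 := by
      rw [mul_sub, h1, mul_one, sub_self]
    exact (mul_eq_zero.1 h2).resolve_right (sub_ne_zero.2 hv)
  have hin : ∀ x, x ∉ W → ∑ t, f (x + π * t) = 0 := by
    intro x hx
    by_cases hxu : ∀ i, IsUnit (x + b i)
    · have hw : IsUnit (w x) := by
        by_contra h
        exact hx (mem_filter.2 ⟨mem_univ _, hxu, h⟩)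
      obtain ⟨u, hu⟩ := hw
      simp_rw [hshift x hxu]
      rw [← mul_sum, ← hu]
      exact mul_eq_zero_of_right _
        ((Equiv.sum_comp (Units.mulRight u) fun t => χ (1 + π * t)).trans hT)
    · push Not at hxu
      obtain ⟨i, hi⟩ := hxu
      refine sum_eq_zero fun t _ => prod_eq_zero (mem_univ i) ?_
      rw [χ.map_nonunit, zero_zpow _ (σ i).ne_zero]
      intro h
      apply hi
      have := hunit _ (-t) h
      convert this using 1
      ring
  have hWcard : #W ≤ p * Fintype.card ι := by
    let q : (ZMod p)[X] := ∑ i, C ((σ i : ℤ) : ZMod p) * ∏ j ∈ univ.erase i, (X + C (φ (b j)))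
    have hq0 : q.eval (-φ (b i₀)) ≠ 0 := by
      simp only [q, eval_finsetSum, eval_mul, eval_C, eval_prod, eval_add, eval_X]
      rw [sum_eq_single i₀ ?_ (by simp)]
      · refine mul_ne_zero ((Units.isUnit (σ i₀)).map (Int.castRingHom (ZMod p))).ne_zero
          (prod_ne_zero_iff.2 fun j hj => ?_)
        have := (ZMod.isUnit_prime_sq_iff _).1 (hb j (ne_of_mem_erase hj))
        rw [map_sub] at this
        rwa [neg_add_eq_sub]
      · intro i _ hi
        rw [prod_eq_zero (mem_erase.2 ⟨hi.symm, mem_univ i₀⟩) (by simp), mul_zero]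
    have hqne : q ≠ 0 := by
      rintro h
      rw [h, eval_zero] at hq0
      exact hq0 rfl
    have hqdeg : q.natDegree ≤ Fintype.card ι := by
      refine natDegree_sum_le_of_forall_le _ _ fun i _ => ?_
      refine (natDegree_C_mul_le _ _).trans ((natDegree_prod_le _ _).trans ?_)
      simp only [natDegree_X_add_C, sum_const, smul_eq_mul, mul_one]
      exact card_le_univ _
    have hsub : W ⊆ ({x | φ x ∈ q.roots.toFinset} : Finset (ZMod (p ^ 2))) := by
      intro x hx
      obtain ⟨-, hxu, hxw⟩ := mem_filter.1 hx
      rw [mem_filter, Multiset.mem_toFinset, mem_roots hqne]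
      refine ⟨mem_univ _, ?_⟩
      rw [ZMod.isUnit_prime_sq_iff, not_not] at hxw
      have h1 : q.eval (φ x) = φ (w x) * ∏ j, φ (x + b j) := by
        simp only [q, w, eval_finsetSum, eval_mul, eval_C, eval_prod, eval_add, eval_X, map_sum,
          map_mul, map_intCast, sum_mul]
        refine sum_congr rfl fun i _ => ?_
        rw [← mul_prod_erase univ _ (mem_univ i), mul_assoc, ← mul_assoc (φ (Ring.inverse _)),
          ← map_mul, Ring.inverse_mul_cancel _ (hxu i), map_one, one_mul]
        simp
      rw [IsRoot.def, h1]
      exact mul_eq_zero_of_left hxw _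
    refine (card_le_card hsub).trans ((card_filter_castHom_prime_sq_le _).trans ?_)
    gcongr
    exact (Multiset.toFinset_card_le _).trans ((card_roots' q).trans hqdeg)
  have hsq : ((p ^ 2 : ℕ) : ℂ) * ∑ x, f x = ∑ x ∈ W, ∑ t, f (x + π * t) := by
    have h1 : ∑ x ∈ W, ∑ t, f (x + π * t) = ∑ x, ∑ t, f (x + π * t) :=
      sum_subset (subset_univ _) fun x _ hx => hin x hx
    rw [h1, sum_comm]
    have h2 : ∀ t : ZMod (p ^ 2), ∑ x, f (x + π * t) = ∑ x, f x := fun t =>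
      Equiv.sum_comp (Equiv.addRight (π * t)) f
    simp_rw [h2]
    rw [sum_const, card_univ, ZMod.card, nsmul_eq_mul]
  have hpos : (0 : ℝ) < (p ^ 2 : ℕ) := by exact_mod_cast pow_pos hp.pos 2
  refine le_of_mul_le_mul_left ?_ hpos
  calc ((p ^ 2 : ℕ) : ℝ) * ‖∑ x, f x‖ = ‖∑ x ∈ W, ∑ t, f (x + π * t)‖ := by
        rw [← hsq, norm_mul, Complex.norm_natCast]
    _ ≤ ∑ x ∈ W, ∑ t : ZMod (p ^ 2), 1 :=
        (norm_sum_le _ _).trans (sum_le_sum fun x _ => (norm_sum_le _ _).trans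
          (sum_le_sum fun t _ => norm_prod_zpow_le χ σ _))
    _ = #W * (p ^ 2 : ℕ) := by simp
    _ ≤ _ := by
        have : (#W : ℝ) ≤ p * Fintype.card ι := by exact_mod_cast hWcard
        nlinarith

end CharacterSums

open Finset

/-- `χ` does not factor through `k / p` for any prime `p ∣ k`. -/
def NontrivialAtPrimes (k : ℕ) (χ : MulChar (ZMod k) ℂ) : Prop :=
  ∀ p : ℕ, p.Prime → p ∣ k → ∃ u : ℤ, u ≡ 1 [ZMOD (k / p : ℕ)] ∧ IsUnit (u : ZMod k) ∧ χ u ≠ 1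

theorem nontrivialAtPrimes_of_isPrimitive {k : ℕ} (hk : k ≠ 0) (χ : DirichletCharacter ℂ k)
    (hχ : χ.IsPrimitive) : NontrivialAtPrimes k χ := by
  intro p hp hpk
  have : NeZero k := ⟨hk⟩
  have hdvd : k / p ∣ k := Nat.div_dvd_of_dvd hpk
  have h1 : ¬ χ.FactorsThrough (k / p) := by
    intro h
    have h2 : χ.conductor ≤ k / p := Nat.sInf_le h
    rw [hχ] at h2
    exact absurd h2 (not_le.2 (Nat.div_lt_self (Nat.pos_of_ne_zero hk) hp.one_lt))
  rw [DirichletCharacter.factorsThrough_iff_ker_unitsMap hdvd, SetLike.not_le_iff_exists] at h1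
  obtain ⟨u, hu1, hu2⟩ := h1
  refine ⟨((u : ZMod k).val : ℤ), ?_, ?_, ?_⟩
  · rw [← ZMod.intCast_eq_intCast_iff]
    rw [MonoidHom.mem_ker] at hu1
    have h3 := congrArg Units.val hu1
    rw [ZMod.unitsMap_val, Units.val_one] at h3
    push_cast
    rw [← h3, ← ZMod.cast_eq_val]
  · push_cast
    rw [ZMod.natCast_zmod_val]
    exact u.isUnit
  · push_cast
    rw [ZMod.natCast_zmod_val]
    intro h
    apply hu2
    rw [MonoidHom.mem_ker]
    ext
    rw [MulChar.coe_toUnitHom]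
    simpa using h

/-- The restriction of a multiplicative character of a product ring to the first factor. -/
noncomputable def MulChar.restrictFst {R A C : Type*} [CommRing R] [CommRing A] [CommRing C]
    (e : R ≃+* A × C)
    (χ : MulChar R ℂ) : MulChar A ℂ where
  toFun x := χ (e.symm (x, 1))
  map_one' := by rw [← Prod.one_eq_mk, map_one, map_one]
  map_mul' x y := by rw [← map_mul, ← map_mul, Prod.mk_mul_mk, one_mul]
  map_nonunit' x hx := χ.map_nonunit fun h => hx (by
    have := (h.map e)
    rw [RingEquiv.apply_symm_apply, Prod.isUnit_iff] at this
    exact this.1)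

theorem MulChar.restrictFst_apply {R A C : Type*} [CommRing R] [CommRing A] [CommRing C]
    (e : R ≃+* A × C) (χ : MulChar R ℂ) (x : A) : χ.restrictFst e x = χ (e.symm (x, 1)) := rfl

theorem NontrivialAtPrimes.restrictFst {k a c : ℕ} (hk : k = a * c) (e : ZMod k ≃+* ZMod a × ZMod c)
    {χ : MulChar (ZMod k) ℂ} (hχ : NontrivialAtPrimes k χ) :
    NontrivialAtPrimes a (χ.restrictFst e) := by
  intro p hp hpa
  obtain ⟨u, hu1, hu2, hu3⟩ := hχ p hp (hk ▸ hpa.mul_right c)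
  have hkp : k / p = a / p * c := by rw [hk, Nat.div_mul_right_comm hpa]
  rw [hkp] at hu1
  have huc : (u : ZMod c) = 1 := by
    have := (ZMod.intCast_eq_intCast_iff u 1 c).2
      (hu1.of_dvd (by push_cast; exact dvd_mul_left _ _))
    simpa using this
  have he : e u = ((u : ZMod a), 1) := by
    rw [map_intCast, ← huc]
    rfl
  refine ⟨u, hu1.of_dvd (by push_cast; exact dvd_mul_right _ _), ?_, ?_⟩
  · have := hu2.map e
    rw [he, Prod.isUnit_iff] at this
    exact this.1
  · rwa [MulChar.restrictFst_apply, ← he, RingEquiv.symm_apply_apply]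

section ChineseRemainder

variable {ι : Type*} [Fintype ι]

theorem norm_correlation_le_card {k : ℕ} [NeZero k] (σ : ι → ℤˣ) (b : ι → ℤ)
    (χ : MulChar (ZMod k) ℂ) :
    ‖∑ x : ZMod k, ∏ i, χ (x + b i) ^ (σ i : ℤ)‖ ≤ k := by
  refine (norm_sum_le _ _).trans ((sum_le_sum fun x _ => norm_prod_zpow_le χ σ _).trans ?_)
  simp

theorem norm_correlation_le [DecidableEq ι] (σ : ι → ℤˣ) (hσ : ∑ i, (σ i : ℤ) = 0)
    (b : ι → ℤ) (i₀ : ι) (k : ℕ)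
    (hk : k ≠ 0) (hcf : ∀ p : ℕ, p.Prime → ¬ p ^ 3 ∣ k) (hNZ : NeZero k) (χ : MulChar (ZMod k) ℂ)
    (hχ : NontrivialAtPrimes k χ) :
    ‖∑ x : ZMod k, ∏ i, χ (x + b i) ^ (σ i : ℤ)‖ ≤ (Fintype.card ι : ℝ) ^ #k.primeFactors * √k *
      Nat.gcd k (∏ i ∈ univ.erase i₀, (b i - b i₀).natAbs) := by
  have hι : (1 : ℝ) ≤ Fintype.card ι := by
    exact_mod_cast Fintype.card_pos_iff.2 ⟨i₀⟩
  set A := ∏ i ∈ univ.erase i₀, (b i - b i₀).natAbs with hA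
  have hpA : ∀ p : ℕ, p.Prime → ¬ p ∣ A → ∀ i, i ≠ i₀ → ¬ (p : ℤ) ∣ b i - b i₀ := by
    intro p hp hpA i hi h
    apply hpA
    exact (Int.natCast_dvd.1 h).trans (dvd_prod_of_mem _ (mem_erase.2 ⟨hi, mem_univ i⟩))
  induction k using Nat.recOnPosPrimePosCoprime with
  | zero => exact absurd rfl hk
  | one =>
    refine (norm_correlation_le_card σ b χ).trans ?_
    simp
  | prime_pow p n hp hn =>
    have : Fact p.Prime := ⟨hp⟩
    have hn2 : n ≤ 2 := by
      by_contra! h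
      exact hcf p hp (pow_dvd_pow p h)
    rw [Nat.primeFactors_prime_pow hn.ne' hp, card_singleton, pow_one]
    obtain ⟨u, hu1, hu2, hu3⟩ := hχ p hp (dvd_pow_self p hn.ne')
    by_cases hdvd : p ∣ A
    · have h1 : p ≤ Nat.gcd (p ^ n) A :=
        Nat.le_of_dvd (Nat.gcd_pos_of_pos_left _ (pow_pos hp.pos n))
          (Nat.dvd_gcd (dvd_pow_self p hn.ne') hdvd)
      have h1' : (p : ℝ) ≤ Nat.gcd (p ^ n) A := by exact_mod_cast h1
      have h2 : ((p ^ n : ℕ) : ℝ) ≤ √(p ^ n : ℕ) * p := by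
        have h3 : √((p ^ n : ℕ) : ℝ) ≤ p := by
          rw [Real.sqrt_le_left (Nat.cast_nonneg p)]
          exact_mod_cast Nat.pow_le_pow_right hp.pos hn2
        calc ((p ^ n : ℕ) : ℝ) = √(p ^ n : ℕ) * √(p ^ n : ℕ) :=
              (Real.mul_self_sqrt (Nat.cast_nonneg _)).symm
          _ ≤ _ := by gcongr
      calc _ ≤ ((p ^ n : ℕ) : ℝ) := norm_correlation_le_card σ b χ
        _ ≤ 1 * √(p ^ n : ℕ) * p := by rwa [one_mul]
        _ ≤ _ := by gcongr
    · have hb := hpA p hp hdvd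
      have h1 : (1 : ℝ) ≤ Nat.gcd (p ^ n) A := by
        exact_mod_cast Nat.gcd_pos_of_pos_left _ (pow_pos hp.pos n)
      refine le_trans ?_ (le_mul_of_one_le_right (by positivity) h1)
      obtain rfl | rfl : n = 1 ∨ n = 2 := by omega
      · have hχ1 : χ ≠ 1 := by
          rintro rfl
          exact hu3 (MulChar.one_apply hu2)
        have : Fact (p ^ 1).Prime := ⟨by rwa [pow_one]⟩
        refine norm_correlation_prime_le χ hχ1 σ hσ (fun i => (b i : ZMod (p ^ 1))) i₀ ?_
        intro i hi h
        rw [eq_comm, ZMod.intCast_eq_intCast_iff_dvd_sub, pow_one] at h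
        exact hb i hi h
      · have he : √((p ^ 2 : ℕ) : ℝ) = p := by
          rw [Nat.cast_pow, Real.sqrt_sq (Nat.cast_nonneg p)]
        rw [he]
        obtain ⟨v, hv⟩ := hu1.symm.dvd
        have huv : (u : ZMod (p ^ 2)) = 1 + (p : ZMod (p ^ 2)) * (v : ZMod (p ^ 2)) := by
          rw [sq, Nat.mul_div_cancel _ hp.pos] at hv
          have : u = 1 + p * v := by linarith
          rw [this]; push_cast; ring
        rw [huv] at hu3
        refine norm_correlation_prime_sq_le χ v hu3 σ (fun i => (b i : ZMod (p ^ 2))) i₀ ?_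
        intro i hi
        rw [ZMod.isUnit_prime_sq_iff, ← Int.cast_sub, map_intCast, Ne,
          ZMod.intCast_zmod_eq_zero_iff_dvd]
        exact hb i hi
  | coprime a c ha hc hac iha ihc =>
    have ha0 : NeZero a := ⟨by omega⟩
    have hc0 : NeZero c := ⟨by omega⟩
    let e := ZMod.chineseRemainder hac
    let e' := e.trans RingEquiv.prodComm
    let χa := χ.restrictFst e
    let χc := χ.restrictFst e'
    have hcfa : ∀ p : ℕ, p.Prime → ¬ p ^ 3 ∣ a := fun p hp h => hcf p hp (h.mul_right c)
    have hcfc : ∀ p : ℕ, p.Prime → ¬ p ^ 3 ∣ c := fun p hp h => hcf p hp (h.mul_left a)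
    have h1 := iha (by omega) hcfa ha0 χa (hχ.restrictFst rfl e)
    have h2 := ihc (by omega) hcfc hc0 χc (hχ.restrictFst (mul_comm a c) e')
    have hmul : ∀ y z, χ (e.symm (y, z)) = χa y * χc z := by
      intro y z
      have h3 : χc z = χ (e.symm (1, z)) := rfl
      rw [h3, MulChar.restrictFst_apply, ← map_mul, ← map_mul, Prod.mk_mul_mk, one_mul, mul_one]
    have hsum : ∑ x : ZMod (a * c), ∏ i, χ (x + b i) ^ (σ i : ℤ) =
        (∑ y : ZMod a, ∏ i, χa (y + b i) ^ (σ i : ℤ)) *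
          ∑ z : ZMod c, ∏ i, χc (z + b i) ^ (σ i : ℤ) := by
      rw [sum_mul_sum, ← sum_product', ← Equiv.sum_comp e.symm.toEquiv]
      refine sum_congr rfl fun yz _ => ?_
      rw [← prod_mul_distrib]
      refine prod_congr rfl fun i _ => ?_
      rw [← mul_zpow, ← hmul]
      congr 2
      have : ((b i : ℤ) : ZMod (a * c)) = e.symm ((b i : ZMod a), (b i : ZMod c)) := by
        rw [RingEquiv.eq_symm_apply, map_intCast]
        rfl
      rw [this, RingEquiv.toEquiv_eq_coe, RingEquiv.coe_toEquiv, ← map_add, ← Prod.mk_add_mk]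
    rw [hsum, norm_mul, hac.primeFactors_mul, card_union_of_disjoint hac.disjoint_primeFactors,
      Nat.gcd_comm (a * c), hac.gcd_mul, Nat.gcd_comm A, Nat.gcd_comm A]
    refine (mul_le_mul h1 h2 (norm_nonneg _) (by positivity)).trans_eq ?_
    push_cast
    rw [Real.sqrt_mul (Nat.cast_nonneg a), pow_add]
    ring

end ChineseRemainder

/-- The divisor bound. -/
theorem exists_card_divisors_le (ε : ℝ) (hε : 0 < ε) :
    ∃ C : ℝ, 1 ≤ C ∧ ∀ n : ℕ, n ≠ 0 → (#n.divisors : ℝ) ≤ C * (n : ℝ) ^ ε := by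
  have hl : 0 < Real.log 2 := Real.log_pos one_lt_two
  set K : ℝ := 1 + 1 / (ε * Real.log 2)
  have hK : 1 ≤ K := le_add_of_nonneg_right (by positivity)
  obtain ⟨P, hP⟩ := exists_nat_ge ((2 : ℝ) ^ (1 / ε))
  refine ⟨K ^ P, one_le_pow₀ hK, fun n hn => ?_⟩
  have hloc : ∀ p ∈ n.primeFactors, ((n.factorization p + 1 : ℕ) : ℝ) ≤
      (if p < P then K else 1) * ((p : ℝ) ^ n.factorization p) ^ ε := by
    intro p hp
    have hp' := Nat.prime_of_mem_primeFactors hp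
    set a := n.factorization p
    have h2p : (2 : ℝ) ≤ p := by exact_mod_cast hp'.two_le
    rw [← Real.rpow_natCast, ← Real.rpow_mul (by positivity)]
    split_ifs with h
    · have h1 : 1 + a * ε * Real.log 2 ≤ (p : ℝ) ^ ((a : ℝ) * ε) := by
        calc 1 + a * ε * Real.log 2 ≤ Real.exp (Real.log 2 * (a * ε)) := by
              have := Real.add_one_le_exp (Real.log 2 * (a * ε))
              linarith
          _ = (2 : ℝ) ^ ((a : ℝ) * ε) := by rw [Real.rpow_def_of_pos two_pos]
          _ ≤ _ := by gcongr
      calc ((a + 1 : ℕ) : ℝ) ≤ K * (1 + a * ε * Real.log 2) := by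
            have : K * (1 + a * ε * Real.log 2) =
                1 + a + a * ε * Real.log 2 + 1 / (ε * Real.log 2) := by
              simp only [K]; field_simp; ring
            rw [this]; push_cast
            have : 0 ≤ a * ε * Real.log 2 + 1 / (ε * Real.log 2) := by positivity
            linarith
        _ ≤ _ := by gcongr
    · rw [one_mul]
      have h1 : (2 : ℝ) ≤ (p : ℝ) ^ ε := by
        have h3 : (2 : ℝ) ^ (1 / ε) ≤ p := hP.trans (by exact_mod_cast not_lt.1 h)
        calc (2 : ℝ) = ((2 : ℝ) ^ (1 / ε)) ^ ε := by
              rw [← Real.rpow_mul two_pos.le, one_div_mul_cancel hε.ne', Real.rpow_one]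
          _ ≤ _ := by gcongr
      calc ((a + 1 : ℕ) : ℝ) ≤ (2 : ℝ) ^ a := by exact_mod_cast Nat.lt_two_pow_self
        _ ≤ ((p : ℝ) ^ ε) ^ a := by gcongr
        _ = _ := by rw [mul_comm, Real.rpow_mul (by positivity), Real.rpow_natCast]
  rw [Nat.card_divisors hn]
  push_cast at hloc ⊢
  have hprod : ∏ p ∈ n.primeFactors, ((p : ℝ) ^ n.factorization p) ^ ε = (n : ℝ) ^ ε := by
    rw [Real.finsetProd_rpow _ _ fun _ _ => by positivity]
    congr 1
    have := Nat.prod_factorization_pow_eq_self hn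
    rw [Finsupp.prod, Nat.support_factorization] at this
    exact_mod_cast this
  refine (prod_le_prod (fun _ _ => by positivity) hloc).trans ?_
  rw [prod_mul_distrib, hprod]
  gcongr
  rw [prod_ite, prod_const, prod_const_one, mul_one]
  refine pow_le_pow_right₀ hK ?_
  calc _ ≤ #(range P) := card_le_card fun p hp => mem_range.2 (mem_filter.1 hp).2
    _ = P := card_range P

theorem two_pow_card_primeFactors_le {n : ℕ} (hn : n ≠ 0) : 2 ^ #n.primeFactors ≤ #n.divisors := by
  rw [Nat.card_divisors hn, ← prod_const]
  refine prod_le_prod' fun p hp => ?_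
  have := (Nat.prime_of_mem_primeFactors hp).factorization_pos_of_dvd hn
    (Nat.dvd_of_mem_primeFactors hp)
  omega

theorem exists_pow_card_primeFactors_le (c : ℝ) (ε : ℝ) (hε : 0 < ε) :
    ∃ C : ℝ, 1 ≤ C ∧ ∀ n : ℕ, n ≠ 0 → |c| ^ #n.primeFactors ≤ C * (n : ℝ) ^ ε := by
  obtain ⟨L, hL⟩ := pow_unbounded_of_one_lt |c| one_lt_two
  obtain ⟨C, hC, h⟩ := exists_card_divisors_le (ε / (L + 1)) (by positivity)
  refine ⟨C ^ (L + 1), one_le_pow₀ hC, fun n hn => ?_⟩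
  calc |c| ^ #n.primeFactors ≤ (2 ^ (L + 1)) ^ #n.primeFactors := by
        gcongr
        exact hL.le.trans (pow_le_pow_right₀ one_le_two (Nat.le_succ L))
    _ = (2 ^ #n.primeFactors) ^ (L + 1) := by rw [← pow_mul, ← pow_mul, mul_comm]
    _ ≤ (C * (n : ℝ) ^ (ε / (L + 1))) ^ (L + 1) := by
        gcongr
        refine le_trans ?_ (h n hn)
        exact_mod_cast two_pow_card_primeFactors_le hn
    _ = _ := by
        rw [mul_pow, ← Real.rpow_natCast ((n : ℝ) ^ _), ← Real.rpow_mul (by positivity)]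
        congr 2
        push_cast
        field_simp

theorem sum_gcd_le (k B : ℕ) (hk : k ≠ 0) : ∑ h ∈ Icc 1 B, Nat.gcd k h ≤ B * #k.divisors := by
  calc ∑ h ∈ Icc 1 B, Nat.gcd k h ≤ ∑ h ∈ Icc 1 B, ∑ d ∈ k.divisors, if d ∣ h then d else 0 := by
        refine sum_le_sum fun h hh => ?_
        have : Nat.gcd k h = if Nat.gcd k h ∣ h then Nat.gcd k h else 0 := by
          rw [if_pos (Nat.gcd_dvd_right _ _)]
        rw [this]
        exact single_le_sum (f := fun d => if d ∣ h then d else 0) (fun _ _ => Nat.zero_le _)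
          (Nat.mem_divisors.2 ⟨Nat.gcd_dvd_left _ _, hk⟩)
    _ = ∑ d ∈ k.divisors, B / d * d := by
        rw [sum_comm]
        refine sum_congr rfl fun d _ => ?_
        have : #{a ∈ Icc 1 B | d ∣ a} = B / d := by
          rw [← Nat.Ioc_filter_dvd_card_eq_div]
          rfl
        rw [← sum_filter, sum_const, smul_eq_mul, this]
    _ ≤ ∑ d ∈ k.divisors, B := sum_le_sum fun d _ => Nat.div_mul_le_self B d
    _ = _ := by rw [sum_const, smul_eq_mul, mul_comm]

theorem sum_coprime_eq_sum_moebius {M : Type*} [AddCommGroup M] (m N : ℕ) (hm : m ≠ 0) (f : ℕ → M) :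
    ∑ n ∈ Icc 1 N with n.Coprime m, f n =
      ∑ d ∈ m.divisors, ArithmeticFunction.moebius d • ∑ n ∈ Icc 1 (N / d), f (d * n) := by
  have hind : ∀ n, ∑ d ∈ (Nat.gcd n m).divisors, ArithmeticFunction.moebius d =
      if n.Coprime m then 1 else 0 := by
    intro n
    have := DFunLike.congr_fun ArithmeticFunction.moebius_mul_coe_zeta (Nat.gcd n m)
    rwa [ArithmeticFunction.coe_mul_zeta_apply, ArithmeticFunction.one_apply] at this
  have hdiv : ∀ n, (Nat.gcd n m).divisors = {d ∈ m.divisors | d ∣ n} := by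
    intro n
    ext d
    simp only [Nat.mem_divisors, mem_filter, Nat.dvd_gcd_iff]
    have : Nat.gcd n m ≠ 0 := Nat.gcd_ne_zero_right hm
    tauto
  calc _ = ∑ n ∈ Icc 1 N, ∑ d ∈ m.divisors,
        if d ∣ n then ArithmeticFunction.moebius d • f n else 0 := by
        rw [sum_filter]
        refine sum_congr rfl fun n _ => ?_
        rw [← sum_filter, ← sum_smul, ← hdiv, hind]
        split_ifs <;> simp
    _ = _ := by
        rw [sum_comm]
        refine sum_congr rfl fun d hd => ?_
        have hd0 : 0 < d := Nat.pos_of_mem_divisors hd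
        rw [← sum_filter, smul_sum]
        symm
        refine sum_bij (fun n _ => d * n) ?_ ?_ ?_ ?_
        · intro n hn
          rw [mem_Icc, Nat.le_div_iff_mul_le hd0] at hn
          rw [mem_filter, mem_Icc]
          exact ⟨⟨Nat.mul_pos hd0 hn.1, by rw [mul_comm]; exact hn.2⟩, dvd_mul_right _ _⟩
        · intro a _ b _ h
          exact Nat.eq_of_mul_eq_mul_left hd0 h
        · intro n hn
          rw [mem_filter, mem_Icc] at hn
          obtain ⟨c, rfl⟩ := hn.2
          refine ⟨c, ?_, rfl⟩
          rw [mem_Icc, Nat.le_div_iff_mul_le hd0, mul_comm]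
          exact ⟨Nat.pos_of_mul_pos_left hn.1.1, hn.1.2⟩
        · intro n _
          rfl

/-- Integers coprime to `m` have positive density at least `2 ^ (-ω(m))`. -/
theorem le_totient_mul_two_pow (m : ℕ) : m ≤ m.totient * 2 ^ #m.primeFactors := by
  refine Nat.le_of_mul_le_mul_left (c := ∏ p ∈ m.primeFactors, (p - 1)) ?_ ?_
  · rw [mul_comm, ← Nat.totient_mul_prod_primeFactors, mul_left_comm]
    gcongr
    rw [← prod_const, ← prod_mul_distrib]
    refine prod_le_prod' fun p hp => ?_
    have := (Nat.prime_of_mem_primeFactors hp).two_le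
    omega
  · exact prod_pos fun p hp => by
      have := (Nat.prime_of_mem_primeFactors hp).two_le
      omega

theorem card_coprime_ge (m N : ℕ) (hm : m ≠ 0) :
    (N : ℝ) * (m.totient / m) - #m.divisors ≤ #{n ∈ Icc 1 N | n.Coprime m} := by
  have hm' : (m : ℝ) ≠ 0 := by exact_mod_cast hm
  have key : ∀ N : ℕ, (#{n ∈ Icc 1 N | n.Coprime m} : ℝ) =
      ∑ d ∈ m.divisors, (ArithmeticFunction.moebius d : ℝ) * (N / d : ℕ) := by
    intro N
    have := sum_coprime_eq_sum_moebius m N hm fun _ => (1 : ℝ)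
    simpa [zsmul_eq_mul] using this
  have htot : ∑ d ∈ m.divisors, (ArithmeticFunction.moebius d : ℝ) / d = m.totient / m := by
    have h1 : (#{n ∈ Icc 1 m | n.Coprime m} : ℝ) = m.totient := by
      rw [← Nat.filter_coprime_Ico_eq_totient m 1]
      congr 2
      ext n
      simp only [mem_filter, mem_Icc, mem_Ico, Nat.coprime_comm (n := n) (m := m)]
      omega
    rw [← h1, key, sum_div]
    refine sum_congr rfl fun d hd => ?_
    rw [Nat.cast_div (Nat.dvd_of_mem_divisors hd)
      (by exact_mod_cast (Nat.pos_of_mem_divisors hd).ne')]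
    field_simp
  rw [key, ← htot, mul_sum, sub_le_iff_le_add, card_eq_sum_ones, Nat.cast_sum, ← sum_add_distrib]
  refine sum_le_sum fun d hd => ?_
  have hd0 : (0 : ℝ) < d := by exact_mod_cast Nat.pos_of_mem_divisors hd
  have h1 : ((N / d : ℕ) : ℝ) ≤ N / d := Nat.cast_div_le
  have h2 : (N : ℝ) / d < (N / d : ℕ) + 1 := by
    rw [div_lt_iff₀ hd0, mul_comm]
    exact_mod_cast Nat.lt_mul_div_succ N (Nat.pos_of_mem_divisors hd)
  rcases ArithmeticFunction.moebius_eq_or d with h | h | h <;> rw [h] <;> push_cast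
  all_goals ring_nf at *
  all_goals linarith

theorem exists_le_card_coprime (ε : ℝ) (hε : 0 < ε) : ∃ C : ℝ, 1 ≤ C ∧ ∀ m : ℕ, m ≠ 0 →
    ∀ N : ℕ, N ≠ 0 → (N : ℝ) ≤ C * (m : ℝ) ^ ε * #{n ∈ Icc 1 N | n.Coprime m} := by
  obtain ⟨C, hC, h⟩ := exists_card_divisors_le (ε / 2) (by positivity)
  refine ⟨2 * C ^ 2, by nlinarith, fun m hm N hN => ?_⟩
  have hm' : (0 : ℝ) < m := by exact_mod_cast Nat.pos_of_ne_zero hm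
  set T : ℝ := (#m.divisors : ℝ)
  set D : ℝ := C * (m : ℝ) ^ (ε / 2)
  have hTD : T ≤ D := h m hm
  have hD : 0 < D := by positivity
  set c : ℝ := (#{n ∈ Icc 1 N | n.Coprime m} : ℝ)
  have hc : 1 ≤ c := by
    have : 0 < #{n ∈ Icc 1 N | n.Coprime m} :=
      card_pos.2 ⟨1, mem_filter.2 ⟨mem_Icc.2 ⟨le_rfl, Nat.pos_of_ne_zero hN⟩,
        Nat.coprime_one_left m⟩⟩
    simp only [c]
    exact_mod_cast this
  have h1 : (1 : ℝ) ≤ m.totient / m * T := by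
    rw [div_mul_eq_mul_div, le_div_iff₀ hm', one_mul]
    refine le_trans (b := ((m.totient * 2 ^ #m.primeFactors : ℕ) : ℝ)) ?_ ?_
    · exact_mod_cast le_totient_mul_two_pow m
    · rw [Nat.cast_mul]
      gcongr
      simp only [T]
      exact_mod_cast two_pow_card_primeFactors_le hm
  have h2 : (N : ℝ) * (m.totient / m) - T ≤ c := card_coprime_ge m N hm
  have h3 : (2 * C ^ 2) * (m : ℝ) ^ ε = 2 * D ^ 2 := by
    rw [mul_pow, ← Real.rpow_natCast ((m : ℝ) ^ _), ← Real.rpow_mul hm'.le, mul_assoc]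
    congr 3
    push_cast
    ring
  rw [h3]
  have hT : 1 ≤ T := by
    have : 0 < #m.divisors := card_pos.2 ⟨1, Nat.one_mem_divisors.2 hm⟩
    simp only [T]
    exact_mod_cast this
  have h4 : (N : ℝ) ≤ D * (c + D) := by
    calc (N : ℝ) ≤ N * (m.totient / m * T) := le_mul_of_one_le_right (by positivity) h1
      _ = T * (N * (m.totient / m)) := by ring
      _ ≤ D * (c + D) := by gcongr; linarith
  have hD1 : 1 ≤ D := hT.trans hTD
  have h5 : D * c ≤ D ^ 2 * c := by gcongr; nlinarith
  have h6 : D ^ 2 ≤ D ^ 2 * c := le_mul_of_one_le_right (by positivity) hc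
  linarith

/-- A tuple all of whose values are attained at least twice takes few values. -/
theorem card_repeated_le (r B : ℕ) (hr : r ≠ 0) :
    #{b ∈ Fintype.piFinset fun _ : Fin r ⊕ Fin r => Icc 1 B | ∀ i, ∃ j, j ≠ i ∧ b j = b i} ≤
      B ^ r * r ^ (2 * r) := by
  classical
  have hcard : #((Fintype.piFinset fun _ : Fin r => Icc 1 B) ×ˢ
      (univ : Finset (Fin r ⊕ Fin r → Fin r))) = B ^ r * r ^ (2 * r) := by
    simp [two_mul]
  rw [← hcard]
  refine card_le_card_of_surjOn (fun q i => q.1 (q.2 i)) ?_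
  intro b hb
  rw [mem_coe, mem_filter, Fintype.mem_piFinset] at hb
  obtain ⟨hb, h⟩ := hb
  have himg : 2 * #(univ.image b) ≤ 2 * r := by
    calc 2 * #(univ.image b) = ∑ y ∈ univ.image b, 2 := by rw [sum_const, smul_eq_mul, mul_comm]
      _ ≤ ∑ y ∈ univ.image b, #{i | b i = y} := by
          refine sum_le_sum fun y hy => ?_
          obtain ⟨i, _, rfl⟩ := mem_image.1 hy
          obtain ⟨j, hj, hji⟩ := h i
          exact one_lt_card.2 ⟨j, by simpa using hji, i, by simp, hj⟩
      _ = #(univ : Finset (Fin r ⊕ Fin r)) := (card_eq_sum_card_image b univ).symm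
      _ = 2 * r := by simp [two_mul]
  have himg' : #(univ.image b) ≤ r := by omega
  set e := (univ.image b).equivFin
  have hr' : 0 < r := Nat.pos_of_ne_zero hr
  let a : Fin r → ℕ := fun j =>
    if hj : (j : ℕ) < #(univ.image b) then (e.symm ⟨j, hj⟩ : ℕ) else b (Sum.inl ⟨0, hr'⟩)
  refine ⟨(a, fun i => Fin.castLE himg' (e ⟨b i, mem_image_of_mem b (mem_univ i)⟩)), ?_, ?_⟩
  · rw [mem_coe, mem_product, Fintype.mem_piFinset]
    refine ⟨fun j => ?_, mem_univ _⟩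
    by_cases hj : (j : ℕ) < #(univ.image b)
    · obtain ⟨i, _, hi⟩ := mem_image.1 (e.symm ⟨j, hj⟩).2
      simp only [a, dif_pos hj]
      rw [← hi]
      exact hb i
    · simp only [a, dif_neg hj]
      exact hb _
  · funext i
    simp [a]

theorem sum_gcd_sub_le (k B y : ℕ) (hk : k ≠ 0) :
    ∑ x ∈ Icc 1 B with x ≠ y, Nat.gcd k ((x : ℤ) - y).natAbs ≤ 2 * (B + y) * #k.divisors := by
  calc ∑ x ∈ Icc 1 B with x ≠ y, Nat.gcd k ((x : ℤ) - y).natAbs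
      = ∑ x ∈ Icc 1 B with x ≠ y, ∑ h ∈ Icc 1 (B + y),
          if ((x : ℤ) - y).natAbs = h then Nat.gcd k h else 0 := by
        refine sum_congr rfl fun x hx => ?_
        rw [mem_filter, mem_Icc] at hx
        rw [sum_ite_eq, if_pos]
        rw [mem_Icc]
        omega
    _ ≤ ∑ h ∈ Icc 1 (B + y), 2 * Nat.gcd k h := by
        rw [sum_comm]
        refine sum_le_sum fun h hh => ?_
        rw [← sum_filter, sum_const, smul_eq_mul]
        gcongr
        calc _ ≤ #({y + h, y - h} : Finset ℕ) := by
              refine card_le_card fun x hx => ?_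
              simp only [mem_filter, mem_Icc, mem_insert, mem_singleton] at hx ⊢
              omega
          _ ≤ 2 := card_le_two
    _ ≤ _ := by
        rw [← mul_sum, mul_assoc]
        exact Nat.mul_le_mul_left 2 (sum_gcd_le k (B + y) hk)

theorem sum_prod_gcd_le {ι : Type*} [Fintype ι] [DecidableEq ι] (i₀ : ι) (k B : ℕ) (hk : k ≠ 0) :
    ∑ b ∈ Fintype.piFinset fun _ : ι => Icc 1 B,
      ∏ i ∈ univ.erase i₀, (if b i ≠ b i₀ then Nat.gcd k ((b i : ℤ) - b i₀).natAbs else 0) ≤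
      (4 * B * #k.divisors) ^ Fintype.card ι := by
  set D := 4 * B * #k.divisors
  let g : ℕ → ℕ → ℕ := fun x y => if x ≠ y then Nat.gcd k ((x : ℤ) - y).natAbs else 0
  let f : ℕ → ι → ℕ → ℕ := fun y i x => if i = i₀ then (if y = x then 1 else 0) else g x y
  have hprod : ∀ (y : ℕ) (b : ι → ℕ), ∏ i, f y i (b i) =
      if y = b i₀ then ∏ i ∈ univ.erase i₀, g (b i) (b i₀) else 0 := by
    intro y b
    rw [← mul_prod_erase univ _ (mem_univ i₀)]
    simp only [f, if_true]
    split_ifs with h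
    · rw [one_mul]
      refine prod_congr rfl fun i hi => ?_
      rw [if_neg (ne_of_mem_erase hi), h]
    · rw [zero_mul]
  calc _ = ∑ b ∈ Fintype.piFinset fun _ : ι => Icc 1 B, ∑ y ∈ Icc 1 B, ∏ i, f y i (b i) := by
        refine sum_congr rfl fun b hb => ?_
        simp_rw [hprod]
        rw [sum_ite_eq', if_pos (Fintype.mem_piFinset.1 hb i₀)]
    _ = ∑ y ∈ Icc 1 B, ∏ i, ∑ x ∈ Icc 1 B, f y i x := by
        rw [sum_comm]
        refine sum_congr rfl fun y _ => ?_
        rw [prod_univ_sum]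
    _ ≤ ∑ y ∈ Icc 1 B, D ^ (Fintype.card ι - 1) := by
        refine sum_le_sum fun y hy => ?_
        rw [← mul_prod_erase univ _ (mem_univ i₀)]
        simp only [f, if_true]
        rw [sum_ite_eq, if_pos hy, one_mul, ← card_univ, ← card_erase_of_mem (mem_univ i₀),
          ← prod_const]
        refine prod_le_prod' fun i hi => ?_
        simp only [if_neg (ne_of_mem_erase hi), g]
        rw [← sum_filter]
        refine (sum_gcd_sub_le k B y hk).trans ?_
        have : y ≤ B := (mem_Icc.1 hy).2
        refine Nat.mul_le_mul_right _ ?_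
        omega
    _ ≤ D * D ^ (Fintype.card ι - 1) := by
        rw [sum_const, smul_eq_mul, Nat.card_Icc, Nat.add_sub_cancel]
        gcongr
        have : 0 < #k.divisors := card_pos.2 ⟨1, Nat.one_mem_divisors.2 hk⟩
        simp only [D]
        nlinarith
    _ = _ := by
        rw [← pow_succ', Nat.sub_add_cancel (Fintype.card_pos_iff.2 ⟨i₀⟩)]

theorem gcd_prod_le {ι : Type*} (s : Finset ι) (k : ℕ) (f : ι → ℕ) :
    Nat.gcd k (∏ i ∈ s, f i) ∣ ∏ i ∈ s, Nat.gcd k (f i) := by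
  classical
  induction s using Finset.induction_on with
  | empty => simp
  | insert a s ha ih =>
    rw [prod_insert ha, prod_insert ha]
    exact (Nat.gcd_mul_right_dvd_mul_gcd _ _ _).trans (mul_dvd_mul_left _ ih)

theorem norm_sum_pow_two_mul_eq {k : ℕ} [NeZero k] (χ : MulChar (ZMod k) ℂ) (B r : ℕ) (x : ZMod k) :
    ((‖∑ b ∈ Icc 1 B, χ (x + (b : ℕ))‖ ^ (2 * r) : ℝ) : ℂ) =
      ∑ b ∈ Fintype.piFinset fun _ : Fin r ⊕ Fin r => Icc 1 B,
        ∏ i, χ (x + ((b i : ℕ) : ℤ)) ^ ((Sum.elim 1 (-1) : Fin r ⊕ Fin r → ℤˣ) i : ℤ) := by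
  rw [← prod_univ_sum (t := fun _ => Icc 1 B)
    (f := fun i b => χ (x + ((b : ℕ) : ℤ)) ^ ((Sum.elim 1 (-1) : Fin r ⊕ Fin r → ℤˣ) i : ℤ))]
  rw [Fintype.prod_sum_type]
  simp only [Sum.elim_inl, Sum.elim_inr, Pi.one_apply, Pi.neg_apply, Units.val_one, zpow_one,
    prod_const, Int.cast_natCast, Units.val_neg, card_univ, Fintype.card_fin, zpow_neg]
  rw [pow_mul, ← mul_pow]
  push_cast
  rw [← Complex.mul_conj']
  congr 2
  rw [map_sum]
  refine sum_congr rfl fun b _ => ?_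
  rw [← MulChar.inv_apply_eq_inv', ← MulChar.star_apply']
  rfl

theorem sum_norm_sum_pow_le (k : ℕ) (hk : k ≠ 0) (hcf : ∀ p : ℕ, p.Prime → ¬ p ^ 3 ∣ k)
    [hNZ : NeZero k] (χ : MulChar (ZMod k) ℂ) (hχ : NontrivialAtPrimes k χ) (B r : ℕ) (hr : r ≠ 0) :
    ∑ x : ZMod k, ‖∑ b ∈ Icc 1 B, χ (x + (b : ℕ))‖ ^ (2 * r) ≤
      (2 * r * ((2 * r : ℝ) ^ #k.primeFactors * √k)) * (4 * B * #k.divisors) ^ (2 * r) +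
        k * (B ^ r * r ^ (2 * r)) := by
  set P := Fintype.piFinset fun _ : Fin r ⊕ Fin r => Icc 1 B
  set σ : Fin r ⊕ Fin r → ℤˣ := Sum.elim 1 (-1)
  set c : ℝ := (2 * r : ℝ) ^ #k.primeFactors * √k
  have hc : 0 ≤ c := by positivity
  let W : (Fin r ⊕ Fin r → ℕ) → Fin r ⊕ Fin r → ℕ := fun b i₀ => ∏ i ∈ univ.erase i₀,
    (if b i ≠ b i₀ then Nat.gcd k ((b i : ℤ) - b i₀).natAbs else 0)
  have hterm : ∀ b ∈ P, ‖∑ x : ZMod k, ∏ i, χ (x + ((b i : ℕ) : ℤ)) ^ (σ i : ℤ)‖ ≤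
      c * ∑ i₀, (W b i₀ : ℝ) + if ∀ i, ∃ j, j ≠ i ∧ b j = b i then (k : ℝ) else 0 := by
    intro b _
    by_cases h : ∀ i, ∃ j, j ≠ i ∧ b j = b i
    · rw [if_pos h]
      refine le_add_of_nonneg_of_le (by positivity) ?_
      exact norm_correlation_le_card σ (fun i => (b i : ℤ)) χ
    · rw [if_neg h, add_zero]
      push Not at h
      obtain ⟨i₀, hi₀⟩ := h
      refine (norm_correlation_le σ (by simp [σ]) (fun i => (b i : ℤ)) i₀ k hk hcf hNZ χ hχ).trans
        ?_
      have hcard : (Fintype.card (Fin r ⊕ Fin r) : ℝ) = 2 * r := by simp [two_mul]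
      rw [hcard]
      refine mul_le_mul_of_nonneg_left ?_ hc
      refine le_trans (b := (W b i₀ : ℝ)) ?_ (single_le_sum (f := fun i => (W b i : ℝ))
        (fun _ _ => by positivity) (mem_univ i₀))
      have hW : W b i₀ = ∏ i ∈ univ.erase i₀, Nat.gcd k ((b i : ℤ) - b i₀).natAbs :=
        prod_congr rfl fun i hi => if_pos (hi₀ i (ne_of_mem_erase hi))
      rw [hW]
      exact_mod_cast Nat.le_of_dvd (prod_pos fun i _ => Nat.gcd_pos_of_pos_left _
        (Nat.pos_of_ne_zero hk)) (gcd_prod_le _ _ _)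
  have hsum : ((∑ x : ZMod k, ‖∑ b ∈ Icc 1 B, χ (x + (b : ℕ))‖ ^ (2 * r) : ℝ) : ℂ) =
      ∑ b ∈ P, ∑ x : ZMod k, ∏ i, χ (x + ((b i : ℕ) : ℤ)) ^ (σ i : ℤ) := by
    rw [sum_comm, Complex.ofReal_sum]
    exact sum_congr rfl fun x _ => norm_sum_pow_two_mul_eq χ B r x
  calc _ = ‖((∑ x : ZMod k, ‖∑ b ∈ Icc 1 B, χ (x + (b : ℕ))‖ ^ (2 * r) : ℝ) : ℂ)‖ := by
        rw [Complex.norm_real, Real.norm_of_nonneg (by positivity)]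
    _ ≤ ∑ b ∈ P, (c * ∑ i₀, (W b i₀ : ℝ) +
          if ∀ i, ∃ j, j ≠ i ∧ b j = b i then (k : ℝ) else 0) := by
        rw [hsum]
        exact norm_sum_le_of_le _ hterm
    _ = c * ∑ i₀, ((∑ b ∈ P, W b i₀ : ℕ) : ℝ) +
          k * (#{b ∈ P | ∀ i, ∃ j, j ≠ i ∧ b j = b i} : ℕ) := by
        rw [sum_add_distrib, ← mul_sum, sum_comm, ← sum_filter, sum_const, nsmul_eq_mul,
          mul_comm (k : ℝ)]
        push_cast
        rfl
    _ ≤ c * ∑ i₀ : Fin r ⊕ Fin r, ((4 * B * #k.divisors) ^ (2 * r) : ℕ) +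
          k * ((B ^ r * r ^ (2 * r) : ℕ) : ℝ) := by
        gcongr
        · push_cast
          refine sum_le_sum fun i₀ _ => ?_
          have : ∑ b ∈ P, W b i₀ ≤ (4 * B * #k.divisors) ^ (2 * r) := by
            have h := sum_prod_gcd_le i₀ k B hk
            rwa [Fintype.card_sum, Fintype.card_fin, ← two_mul] at h
          exact_mod_cast this
        · exact card_repeated_le r B hr
    _ = _ := by
        simp only [sum_const, card_univ, Fintype.card_sum, Fintype.card_fin, nsmul_eq_mul]
        push_cast
        ring

theorem sum_Icc_shift_sub_le (f : ℕ → ℂ) (hf : ∀ n, ‖f n‖ ≤ 1) (N h : ℕ) :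
    ‖∑ n ∈ Icc 1 N, f (n + h) - ∑ n ∈ Icc 1 N, f n‖ ≤ 2 * h := by
  induction h with
  | zero => simp
  | succ h ih =>
    have h1 : ∀ g : ℕ → ℂ, ∑ n ∈ Icc 1 N, g (n + 1) - ∑ n ∈ Icc 1 N, g n = g (N + 1) - g 1 := by
      intro g
      clear ih
      induction N with
      | zero => simp
      | succ N ihN =>
        rw [sum_Icc_succ_top (by omega), sum_Icc_succ_top (by omega)]
        linear_combination ihN
    have h2 := h1 fun n => f (n + h)
    have h3 : ∑ n ∈ Icc 1 N, f (n + (h + 1)) - ∑ n ∈ Icc 1 N, f n =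
        (f (N + 1 + h) - f (1 + h)) + (∑ n ∈ Icc 1 N, f (n + h) - ∑ n ∈ Icc 1 N, f n) := by
      rw [← h2, sub_add_sub_cancel]
      congr 1
      exact sum_congr rfl fun n _ => by congr 1; ring
    rw [h3]
    have h4 := norm_add_le (f (N + 1 + h) - f (1 + h))
      (∑ n ∈ Icc 1 N, f (n + h) - ∑ n ∈ Icc 1 N, f n)
    have h5 := norm_sub_le (f (N + 1 + h)) (f (1 + h))
    push_cast
    linarith [hf (N + 1 + h), hf (1 + h)]

theorem card_filter_cast_eq_le (k M : ℕ) (v : ZMod k) :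
    #{w ∈ Icc 1 M | ((w : ℕ) : ZMod k) = v} ≤ M / k + 1 := by
  rw [← card_range (M / k + 1)]
  refine card_le_card_of_injOn (· / k) ?_ ?_
  · intro w hw
    rw [mem_coe, mem_filter, mem_Icc] at hw
    rw [mem_coe, mem_range, Nat.lt_succ_iff]
    exact Nat.div_le_div_right hw.1.2
  · intro w hw w' hw' h
    rw [mem_coe, mem_filter] at hw hw'
    have h1 := (ZMod.natCast_eq_natCast_iff' w w' k).1 (hw.2.trans hw'.2.symm)
    have h2 : w / k = w' / k := h
    rw [← Nat.div_add_mod w k, ← Nat.div_add_mod w' k, h1, h2]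

theorem card_filter_cast_mul_eq_le (k A N T : ℕ)
    (hT : ∀ w, w ≠ 0 → w ≤ A * N → #w.divisors ≤ T) (v : ZMod k) :
    #{p ∈ Icc 1 A ×ˢ Icc 1 N | ((p.1 * p.2 : ℕ) : ZMod k) = v} ≤ (A * N / k + 1) * T := by
  classical
  calc _ ≤ T * #{w ∈ Icc 1 (A * N) | ((w : ℕ) : ZMod k) = v} := by
        refine card_le_mul_card_image_of_maps_to (f := fun p : ℕ × ℕ => p.1 * p.2) ?_ T ?_
        · intro p hp
          rw [mem_filter, mem_product, mem_Icc, mem_Icc] at hp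
          rw [mem_filter, mem_Icc]
          exact ⟨⟨Nat.mul_pos hp.1.1.1 hp.1.2.1, Nat.mul_le_mul hp.1.1.2 hp.1.2.2⟩, hp.2⟩
        · intro w hw
          rw [mem_filter, mem_Icc] at hw
          refine le_trans ?_ (hT w (by omega) hw.1.2)
          refine card_le_card_of_injOn Prod.fst ?_ ?_
          · intro p hp
            rw [mem_coe, mem_filter] at hp
            exact Nat.mem_divisors.2 ⟨⟨p.2, hp.2.symm⟩, by omega⟩
          · intro p hp q hq h
            rw [mem_coe, mem_filter, mem_filter, mem_product, mem_Icc] at hp hq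
            have h3 : p.1 * p.2 = p.1 * q.2 := by
              rw [hp.2, h, hq.2]
            exact Prod.ext h (Nat.eq_of_mul_eq_mul_left hp.1.1.1.1 h3)
    _ ≤ T * (A * N / k + 1) := Nat.mul_le_mul_left T (card_filter_cast_eq_le k _ v)
    _ = _ := mul_comm _ _

/-- Hölder's inequality in the form used in Burgess's argument. -/
theorem sum_mul_pow_le {α : Type*} (s : Finset α) (ν F : α → ℝ) (hν : ∀ x, 0 ≤ ν x)
    (hF : ∀ x, 0 ≤ F x) (r : ℕ) (hr : r ≠ 0) :
    (∑ x ∈ s, ν x * F x) ^ (2 * r) ≤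
      (∑ x ∈ s, ν x) ^ (2 * (r - 1)) * ((∑ x ∈ s, ν x ^ 2) * ∑ x ∈ s, F x ^ (2 * r)) := by
  have h1 : (∑ x ∈ s, ν x * F x) ^ r ≤ (∑ x ∈ s, ν x) ^ (r - 1) * ∑ x ∈ s, ν x * F x ^ r := by
    rcases (sum_nonneg fun x _ => hν x : 0 ≤ ∑ x ∈ s, ν x).eq_or_lt with h0 | h0
    · have h0' := (sum_eq_zero_iff_of_nonneg fun x _ => hν x).1 h0.symm
      rw [sum_eq_zero fun x hx => by rw [h0' x hx, zero_mul], zero_pow hr]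
      have := fun x => mul_nonneg (hν x) (pow_nonneg (hF x) r)
      exact mul_nonneg (by positivity) (sum_nonneg fun x _ => this x)
    · set V := ∑ x ∈ s, ν x
      have h := Real.pow_arith_mean_le_arith_mean_pow s (fun x => ν x / V) F
        (fun x _ => div_nonneg (hν x) h0.le) (by rw [← sum_div, div_self h0.ne'])
        (fun x _ => hF x) r
      simp_rw [div_mul_eq_mul_div, ← sum_div] at h
      rw [div_pow, div_le_iff₀ (by positivity)] at h
      refine h.trans_eq ?_
      obtain ⟨r, rfl⟩ := Nat.exists_eq_succ_of_ne_zero hr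
      simp only [Nat.succ_eq_add_one, Nat.add_sub_cancel]
      field_simp
      ring
  have h2 := sum_mul_sq_le_sq_mul_sq s ν fun x => F x ^ r
  calc (∑ x ∈ s, ν x * F x) ^ (2 * r) = ((∑ x ∈ s, ν x * F x) ^ r) ^ 2 := by
        rw [← pow_mul, mul_comm]
    _ ≤ ((∑ x ∈ s, ν x) ^ (r - 1) * ∑ x ∈ s, ν x * F x ^ r) ^ 2 := by
        gcongr
        exact pow_nonneg (sum_nonneg fun x _ => mul_nonneg (hν x) (hF x)) _
    _ = (∑ x ∈ s, ν x) ^ (2 * (r - 1)) * (∑ x ∈ s, ν x * F x ^ r) ^ 2 := by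
        rw [mul_pow, ← pow_mul, mul_comm (r - 1)]
    _ ≤ _ := by
        refine mul_le_mul_of_nonneg_left (h2.trans_eq ?_)
          (pow_nonneg (sum_nonneg fun x _ => hν x) _)
        congr 1
        exact sum_congr rfl fun x _ => by rw [← pow_mul, mul_comm]

set_option maxHeartbeats 800000 in
theorem exists_norm_sum_le_moment (k : ℕ) [NeZero k] (χ : MulChar (ZMod k) ℂ) (N A B r T : ℕ)
    (hr : r ≠ 0) (hT : ∀ w, w ≠ 0 → w ≤ A * N → #w.divisors ≤ T) :
    ∃ X : ℝ, 0 ≤ X ∧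
      (#{a ∈ Icc 1 A | a.Coprime k} : ℝ) * B * ‖∑ n ∈ Icc 1 N, χ (n : ℕ)‖ ≤
        X + #{a ∈ Icc 1 A | a.Coprime k} * B * (2 * A * B) ∧
      X ^ (2 * r) ≤ (#{a ∈ Icc 1 A | a.Coprime k} * N : ℝ) ^ (2 * (r - 1)) *
        ((#{a ∈ Icc 1 A | a.Coprime k} * N * ((A * N / k + 1 : ℕ) * T) : ℝ) *
          ∑ x : ZMod k, ‖∑ b ∈ Icc 1 B, χ (x + (b : ℕ))‖ ^ (2 * r)) := by
  classical
  set 𝒜 := {a ∈ Icc 1 A | a.Coprime k}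
  set S := ∑ n ∈ Icc 1 N, χ (n : ℕ)
  let F : ZMod k → ℝ := fun x => ‖∑ b ∈ Icc 1 B, χ (x + (b : ℕ))‖
  let φ : ℕ × ℕ → ZMod k := fun p => ((p.1 : ℕ) : ZMod k)⁻¹ * (p.2 : ℕ)
  let R := 𝒜 ×ˢ Icc 1 N
  let ν : ZMod k → ℕ := fun x => #{p ∈ R | φ p = x}
  have hcop : ∀ a ∈ 𝒜, ((a : ℕ) : ZMod k) * ((a : ℕ) : ZMod k)⁻¹ = 1 := fun a ha =>
    ZMod.coe_mul_inv_eq_one a (mem_filter.1 ha).2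
  have hχ1 : ∀ x, ‖χ x‖ ≤ 1 := DirichletCharacter.norm_le_one χ
  have hν : ∑ x, (ν x : ℝ) = #𝒜 * N := by
    have : ∑ x, ν x = #R := (card_eq_sum_card_fiberwise fun p _ => mem_univ (φ p)).symm
    rw [card_product, Nat.card_Icc, Nat.add_sub_cancel] at this
    exact_mod_cast this
  have hν2 : ∑ x, (ν x : ℝ) ^ 2 ≤ #𝒜 * N * ((A * N / k + 1 : ℕ) * T) := by
    have h1 : ∑ x, ν x ^ 2 = #{q ∈ R ×ˢ R | φ q.1 = φ q.2} := by
      rw [card_eq_sum_card_fiberwise (f := fun q => φ q.1) (t := univ) fun q _ => mem_univ _]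
      refine sum_congr rfl fun x _ => ?_
      rw [sq, ← card_product]
      congr 1
      ext q
      simp only [mem_product, mem_filter]
      constructor
      · rintro ⟨⟨h1, h2⟩, h3, h4⟩
        exact ⟨⟨⟨h1, h3⟩, h2.trans h4.symm⟩, h2⟩
      · rintro ⟨⟨⟨h1, h3⟩, h2⟩, h4⟩
        exact ⟨⟨h1, h4⟩, h3, h2.symm.trans h4⟩
    have h2 : #{q ∈ R ×ˢ R | φ q.1 = φ q.2} ≤ (A * N / k + 1) * T * #R := by
      refine card_le_mul_card_image_of_maps_to (f := fun q => (q.1.1, q.2.2)) ?_ _ ?_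
      · intro q hq
        simp only [R, mem_filter, mem_product] at hq ⊢
        exact ⟨hq.1.1.1, hq.1.2.2⟩
      · rintro ⟨a, n⟩ _
        refine le_trans ?_ (card_filter_cast_mul_eq_le k A N T hT (((a * n : ℕ)) : ZMod k))
        refine card_le_card_of_injOn (fun q => (q.2.1, q.1.2)) ?_ ?_
        · intro q hq
          simp only [R, coe_filter, Set.mem_ofPred_eq, mem_product, Prod.mk.injEq, 𝒜, mem_filter,
            mem_Icc, φ] at hq ⊢
          obtain ⟨⟨⟨⟨⟨h1, h2⟩, h3⟩, ⟨h4, h5⟩, h6⟩, h7⟩, rfl, rfl⟩ := hq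
          refine ⟨⟨h4, h3⟩, ?_⟩
          have e1 := ZMod.coe_mul_inv_eq_one q.1.1 h2
          have e2 := ZMod.coe_mul_inv_eq_one q.2.1 h5
          push_cast
          linear_combination ((q.1.1 : ZMod k) * q.2.1) * h7 - (q.1.2 * q.2.1 : ZMod k) * e1 +
            (q.2.2 * q.1.1 : ZMod k) * e2
        · intro q hq q' hq' h
          simp only [coe_filter, Set.mem_ofPred_eq, Prod.mk.injEq] at hq hq' h
          refine Prod.ext (Prod.ext ?_ h.2) (Prod.ext h.1 ?_)
          · exact hq.2.1.trans hq'.2.1.symm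
          · exact hq.2.2.trans hq'.2.2.symm
    rw [card_product, Nat.card_Icc, Nat.add_sub_cancel, mul_comm] at h2
    exact_mod_cast h1.trans_le h2
  refine ⟨∑ x, ν x * F x,
    sum_nonneg fun x _ => mul_nonneg (Nat.cast_nonneg _) (norm_nonneg _), ?_, ?_⟩
  · have hshift : ∀ a b : ℕ, a ∈ 𝒜 → b ∈ Icc 1 B →
        ‖S - ∑ n ∈ Icc 1 N, χ ((n + a * b : ℕ) : ZMod k)‖ ≤ 2 * A * B := by
      intro a b ha hb
      rw [norm_sub_rev]
      refine (sum_Icc_shift_sub_le (fun n => χ (n : ℕ)) (fun n => hχ1 _) N (a * b)).trans ?_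
      rw [Nat.cast_mul, ← mul_assoc]
      have h1 : (a : ℝ) ≤ A := by exact_mod_cast (mem_Icc.1 (mem_filter.1 ha).1).2
      have h2 : (b : ℝ) ≤ B := by exact_mod_cast (mem_Icc.1 hb).2
      gcongr
    have hsum : ‖∑ a ∈ 𝒜, ∑ b ∈ Icc 1 B, ∑ n ∈ Icc 1 N, χ ((n + a * b : ℕ) : ZMod k)‖ ≤
        ∑ x, ν x * F x := by
      calc _ = ‖∑ p ∈ R, ∑ b ∈ Icc 1 B, χ ((p.2 + p.1 * b : ℕ) : ZMod k)‖ := by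
            rw [sum_product]
            congr 1
            exact sum_congr rfl fun a _ => sum_comm
        _ ≤ ∑ p ∈ R, F (φ p) := by
            refine norm_sum_le_of_le _ fun p hp => ?_
            have hp := hcop p.1 (mem_product.1 hp).1
            have h1 : ∀ b : ℕ, χ ((p.2 + p.1 * b : ℕ) : ZMod k) =
                χ ((p.1 : ℕ) : ZMod k) * χ (φ p + (b : ℕ)) := by
              intro b
              rw [← map_mul]
              congr 1
              simp only [φ]
              push_cast
              linear_combination -(p.2 : ZMod k) * hp
            simp_rw [h1, ← mul_sum]
            rw [norm_mul]
            exact mul_le_of_le_one_left (norm_nonneg _) (hχ1 _)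
        _ = ∑ x, ν x * F x := by
            rw [← sum_fiberwise_of_maps_to (fun p _ => mem_univ (φ p))]
            refine sum_congr rfl fun x _ => ?_
            rw [sum_congr rfl fun p hp => by rw [(mem_filter.1 hp).2], sum_const, nsmul_eq_mul]
    have hdiff : ‖(#𝒜 * B : ℂ) * S -
        ∑ a ∈ 𝒜, ∑ b ∈ Icc 1 B, ∑ n ∈ Icc 1 N, χ ((n + a * b : ℕ) : ZMod k)‖ ≤
        #𝒜 * B * (2 * A * B) := by
      have h1 : (#𝒜 * B : ℂ) * S = ∑ a ∈ 𝒜, ∑ b ∈ Icc 1 B, S := by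
        simp [mul_assoc]
      rw [h1, ← sum_sub_distrib]
      simp_rw [← sum_sub_distrib (s := Icc 1 B)]
      refine (norm_sum_le_of_le _ fun a ha => norm_sum_le_of_le _ fun b hb =>
        hshift a b ha hb).trans_eq ?_
      simp [mul_assoc]
    have h3 : (#𝒜 : ℝ) * B * ‖S‖ = ‖(#𝒜 * B : ℂ) * S‖ := by simp
    rw [h3]
    refine (norm_le_norm_add_norm_sub' _ _).trans (add_le_add hsum hdiff)
  · refine (sum_mul_pow_le univ (fun x => (ν x : ℝ)) F (fun _ => Nat.cast_nonneg _)
      (fun _ => norm_nonneg _) r hr).trans ?_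
    rw [hν]
    gcongr

theorem exists_moment_le (r : ℕ) (hr : r ≠ 0) (ε : ℝ) (hε : 0 < ε) : ∃ C : ℝ, 1 ≤ C ∧
    ∀ (k : ℕ) [NeZero k], (∀ p : ℕ, p.Prime → ¬ p ^ 3 ∣ k) →
    ∀ χ : MulChar (ZMod k) ℂ, NontrivialAtPrimes k χ → ∀ B : ℕ, √k ≤ (B : ℝ) ^ r →
    ∑ x : ZMod k, ‖∑ b ∈ Icc 1 B, χ (x + (b : ℕ))‖ ^ (2 * r) ≤
      C * (k : ℝ) ^ (1 / 2 + ε) * (B : ℝ) ^ (2 * r) := by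
  obtain ⟨C₁, hC₁, h₁⟩ := exists_pow_card_primeFactors_le (2 * r) (ε / 2) (by positivity)
  obtain ⟨C₂, hC₂, h₂⟩ := exists_card_divisors_le (ε / 2 / (2 * r)) (by positivity)
  refine ⟨2 * r * C₁ * (4 * C₂) ^ (2 * r) + r ^ (2 * r), ?_, ?_⟩
  · have : (1 : ℝ) ≤ r ^ (2 * r) := one_le_pow₀ (by exact_mod_cast Nat.pos_of_ne_zero hr)
    have : 0 ≤ 2 * r * C₁ * (4 * C₂) ^ (2 * r) := by positivity
    linarith
  intro k hNZ hcf χ hχ B hB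
  have hk : k ≠ 0 := hNZ.out
  have hk1 : (1 : ℝ) ≤ k := by exact_mod_cast Nat.pos_of_ne_zero hk
  refine (sum_norm_sum_pow_le k hk hcf χ hχ B r hr).trans ?_
  have e1 : (k : ℝ) ^ (1 / 2 + ε) = √k * ((k : ℝ) ^ (ε / 2) * (k : ℝ) ^ (ε / 2)) := by
    rw [Real.sqrt_eq_rpow, ← Real.rpow_add (by positivity), ← Real.rpow_add (by positivity)]
    congr 1
    ring
  have h3 : (2 * r : ℝ) ^ #k.primeFactors ≤ C₁ * (k : ℝ) ^ (ε / 2) := by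
    have := h₁ k hk
    rwa [abs_of_nonneg (by positivity)] at this
  have h4 : (#k.divisors : ℝ) ^ (2 * r) ≤ C₂ ^ (2 * r) * (k : ℝ) ^ (ε / 2) := by
    calc (#k.divisors : ℝ) ^ (2 * r) ≤ (C₂ * (k : ℝ) ^ (ε / 2 / (2 * r))) ^ (2 * r) := by
          gcongr
          exact h₂ k hk
      _ = _ := by
          rw [mul_pow, ← Real.rpow_natCast ((k : ℝ) ^ _), ← Real.rpow_mul (by positivity)]
          congr 2
          push_cast
          field_simp
  have h5 : (k : ℝ) * (B : ℝ) ^ r ≤ √k * (B : ℝ) ^ (2 * r) := by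
    calc (k : ℝ) * (B : ℝ) ^ r = √k * (√k * (B : ℝ) ^ r) := by
          rw [← mul_assoc, Real.mul_self_sqrt (by positivity)]
      _ ≤ √k * ((B : ℝ) ^ r * (B : ℝ) ^ r) := by gcongr
      _ = _ := by rw [← pow_add, two_mul]
  have h6 : √(k : ℝ) ≤ (k : ℝ) ^ (1 / 2 + ε) := by
    rw [Real.sqrt_eq_rpow]
    exact Real.rpow_le_rpow_of_exponent_le hk1 (by linarith)
  have h7 : (2 * r * ((2 * r : ℝ) ^ #k.primeFactors * √k)) * (4 * B * #k.divisors) ^ (2 * r) ≤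
      2 * r * C₁ * (4 * C₂) ^ (2 * r) * (k : ℝ) ^ (1 / 2 + ε) * (B : ℝ) ^ (2 * r) := by
    rw [mul_pow (4 * B : ℝ), mul_pow (4 : ℝ) B, e1, mul_pow (4 : ℝ) C₂]
    calc _ ≤ (2 * r * ((C₁ * (k : ℝ) ^ (ε / 2)) * √k)) *
          (4 ^ (2 * r) * B ^ (2 * r) * (C₂ ^ (2 * r) * (k : ℝ) ^ (ε / 2))) :=
          mul_le_mul (by gcongr 2 * r * (?_ * √k)) (by gcongr) (by positivity) (by positivity)
      _ = _ := by ring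
  have h8 : (k : ℝ) * (B ^ r * r ^ (2 * r)) ≤
      r ^ (2 * r) * (k : ℝ) ^ (1 / 2 + ε) * (B : ℝ) ^ (2 * r) := by
    calc (k : ℝ) * (B ^ r * r ^ (2 * r)) = r ^ (2 * r) * (k * (B : ℝ) ^ r) := by ring
      _ ≤ r ^ (2 * r) * ((k : ℝ) ^ (1 / 2 + ε) * (B : ℝ) ^ (2 * r)) := by
          exact mul_le_mul_of_nonneg_left (h5.trans (by gcongr)) (by positivity)
      _ = _ := by ring
  calc _ ≤ _ := add_le_add h7 h8
    _ = _ := by ring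

theorem exists_natCast_between (x : ℝ) (hx : 1 ≤ x) : ∃ n : ℕ, x ≤ n ∧ (n : ℝ) ≤ 2 * x :=
  ⟨⌈x⌉₊, Nat.le_ceil x, (Nat.ceil_lt_add_one (by linarith)).le.trans (by linarith)⟩

/-- Burgess's theorem for cubefree moduli, in qualitative form. -/
theorem burgess_of_le_half (ε : ℝ) (hε : 0 < ε) (hε' : ε ≤ 1 / 2) (L : ℕ) :
    ∃ δ : ℝ, 0 < δ ∧ ∃ C : ℝ, 1 ≤ C ∧
    ∀ (k : ℕ) [NeZero k], (∀ p : ℕ, p.Prime → ¬ p ^ 3 ∣ k) →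
    ∀ χ : MulChar (ZMod k) ℂ, NontrivialAtPrimes k χ → ∀ N : ℕ, (k : ℝ) ^ (1 / 4 + ε) ≤ N →
    N ≤ k ^ L → ‖∑ n ∈ Icc 1 N, χ (n : ℕ)‖ ≤ C * N * (k : ℝ) ^ (-δ) := by
  obtain ⟨r, hr⟩ := exists_nat_ge (1 / ε)
  have hr0 : r ≠ 0 := by
    rintro rfl
    have : 0 < 1 / ε := by positivity
    norm_num at hr
    linarith
  have hr1 : (1 : ℝ) ≤ r := by exact_mod_cast Nat.pos_of_ne_zero hr0
  obtain ⟨Cm, hCm, hm⟩ := exists_moment_le r hr0 (ε / 6) (by positivity)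
  obtain ⟨Ct, hCt, ht⟩ := exists_card_divisors_le (ε / 6 / (L + 2)) (by positivity)
  obtain ⟨Ca, hCa, ha⟩ := exists_le_card_coprime (ε / 6) (by positivity)
  set D : ℝ := 2 * Ca * (2 * Ct) * Cm
  have hD : 1 ≤ D := by
    simp only [D]
    have h1 : 1 ≤ 2 * Ca := by linarith
    have h2 : 1 ≤ 2 * Ct := by linarith
    exact one_le_mul_of_one_le_of_one_le (one_le_mul_of_one_le_of_one_le h1 h2) hCm
  refine ⟨ε / (4 * r), by positivity, D + 8, by linarith, ?_⟩
  intro k hNZ hcf χ hχ N hN hNL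
  have hk : k ≠ 0 := hNZ.out
  have hk1 : (1 : ℝ) ≤ k := by exact_mod_cast Nat.pos_of_ne_zero hk
  have hk0 : (0 : ℝ) < k := by linarith
  obtain ⟨A, hA, hA2⟩ := exists_natCast_between ((k : ℝ) ^ (1 / 4 : ℝ))
    (Real.one_le_rpow hk1 (by norm_num))
  obtain ⟨B, hB, hB2⟩ := exists_natCast_between ((k : ℝ) ^ (ε / 2))
    (Real.one_le_rpow hk1 (by positivity))
  have hA0 : 0 < A := by
    have : (0 : ℝ) < A := lt_of_lt_of_le (by positivity) hA
    exact_mod_cast this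
  have hB0 : (0 : ℝ) < B := lt_of_lt_of_le (by positivity) hB
  have hN0 : (0 : ℝ) < N := lt_of_lt_of_le (by positivity) hN
  have hBr : √k ≤ (B : ℝ) ^ r := by
    calc √(k : ℝ) ≤ ((k : ℝ) ^ (ε / 2)) ^ r := by
          rw [Real.sqrt_eq_rpow, ← Real.rpow_natCast, ← Real.rpow_mul hk0.le]
          refine Real.rpow_le_rpow_of_exponent_le hk1 ?_
          rw [div_le_iff₀ hε] at hr
          linarith
      _ ≤ _ := by gcongr
  have hM := hm k hcf χ hχ B hBr
  set T : ℕ := ⌊2 * Ct * (k : ℝ) ^ (ε / 6)⌋₊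
  have hTle : (T : ℝ) ≤ 2 * Ct * (k : ℝ) ^ (ε / 6) := Nat.floor_le (by positivity)
  have hT : ∀ w, w ≠ 0 → w ≤ A * N → #w.divisors ≤ T := by
    intro w hw hwA
    rw [Nat.le_floor_iff (by positivity)]
    refine (ht w hw).trans ?_
    have h1 : (w : ℝ) ≤ 2 * (k : ℝ) ^ (L + 2 : ℝ) := by
      calc (w : ℝ) ≤ A * N := by exact_mod_cast hwA
        _ ≤ (2 * (k : ℝ) ^ (1 / 4 : ℝ)) * (k : ℝ) ^ L := by
            gcongr
            exact_mod_cast hNL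
        _ = 2 * (k : ℝ) ^ (1 / 4 + L : ℝ) := by
            rw [Real.rpow_add hk0, Real.rpow_natCast]
            ring
        _ ≤ _ := by
            exact mul_le_mul_of_nonneg_left
              (Real.rpow_le_rpow_of_exponent_le hk1 (by linarith)) (by norm_num)
    have h2 : (2 : ℝ) ^ (ε / 6 / (L + 2)) ≤ 2 := by
      refine (Real.rpow_le_rpow_of_exponent_le one_le_two (y := ε / 6 / (L + 2)) (z := 1) ?_).trans
        (by simp)
      rw [div_le_one (by positivity)]
      have : (0 : ℝ) ≤ L := Nat.cast_nonneg L
      linarith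
    calc Ct * (w : ℝ) ^ (ε / 6 / (L + 2)) ≤
          Ct * (2 * (k : ℝ) ^ (L + 2 : ℝ)) ^ (ε / 6 / (L + 2)) := by gcongr
      _ = Ct * (2 ^ (ε / 6 / (L + 2)) * (k : ℝ) ^ (ε / 6)) := by
          rw [Real.mul_rpow (by positivity) (by positivity), ← Real.rpow_mul hk0.le]
          congr 3
          field_simp
      _ ≤ Ct * (2 * (k : ℝ) ^ (ε / 6)) := by gcongr
      _ = _ := by ring
  obtain ⟨X, hX0, hX1, hX2⟩ := exists_norm_sum_le_moment k χ N A B r T hr0 hT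
  have hQ := ha k hk A hA0.ne'
  set Q : ℝ := (#{a ∈ Icc 1 A | a.Coprime k} : ℝ)
  have hQ0 : 0 < Q := by
    have hA' : (0 : ℝ) < A := by exact_mod_cast hA0
    have := hA'.trans_le hQ
    exact pos_of_mul_pos_right this (by positivity)
  have hcount : ((A * N / k + 1 : ℕ) : ℝ) ≤
      2 * Ca * (Q * N) * (k : ℝ) ^ (ε / 6 - 1 / 2 - ε) := by
    have h1 : ((A * N / k : ℕ) : ℝ) ≤ A * N / k := by
      refine Nat.cast_div_le.trans_eq ?_
      push_cast
      rfl
    have h2 : (A * N : ℝ) / k ≤ A * N * (k : ℝ) ^ (- (1 / 2) - ε) := by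
      rw [div_eq_mul_inv, ← Real.rpow_neg_one]
      gcongr
      linarith
    have h3 : (1 : ℝ) ≤ A * N * (k : ℝ) ^ (- (1 / 2) - ε) := by
      calc (1 : ℝ) = (k : ℝ) ^ (1 / 4 : ℝ) * (k : ℝ) ^ (1 / 4 + ε) *
            (k : ℝ) ^ (- (1 / 2) - ε) := by
            rw [← Real.rpow_add hk0, ← Real.rpow_add hk0]
            ring_nf
            simp
        _ ≤ _ := by gcongr
    calc ((A * N / k + 1 : ℕ) : ℝ) ≤ 2 * (A * N * (k : ℝ) ^ (- (1 / 2) - ε)) := by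
          push_cast at h1 ⊢
          linarith
      _ ≤ 2 * ((Ca * (k : ℝ) ^ (ε / 6) * Q) * N * (k : ℝ) ^ (- (1 / 2) - ε)) := by gcongr
      _ = 2 * Ca * (Q * N) * ((k : ℝ) ^ (ε / 6) * (k : ℝ) ^ (- (1 / 2) - ε)) := by ring
      _ = _ := by
          rw [← Real.rpow_add hk0]
          congr 2
          ring
  have hXle : X ≤ Q * N * B * (D * (k : ℝ) ^ (-(ε / (4 * r)))) := by
    refine le_of_pow_le_pow_left₀ (n := 2 * r) (by positivity) (by positivity) (hX2.trans ?_)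
    have e1 : ((k : ℝ) ^ (-(ε / (4 * r)))) ^ (2 * r) = (k : ℝ) ^ (- (ε / 2)) := by
      rw [← Real.rpow_natCast, ← Real.rpow_mul hk0.le]
      congr 1
      push_cast
      field_simp
      ring
    have e2 : (k : ℝ) ^ (ε / 6 - 1 / 2 - ε) * ((k : ℝ) ^ (ε / 6) * (k : ℝ) ^ (1 / 2 + ε / 6)) =
        (k : ℝ) ^ (- (ε / 2)) := by
      rw [← Real.rpow_add hk0, ← Real.rpow_add hk0]
      congr 1
      ring
    calc _ ≤ (Q * N) ^ (2 * (r - 1)) * ((Q * N * ((2 * Ca * (Q * N) *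
            (k : ℝ) ^ (ε / 6 - 1 / 2 - ε)) * (2 * Ct * (k : ℝ) ^ (ε / 6)))) *
            (Cm * (k : ℝ) ^ (1 / 2 + ε / 6) * (B : ℝ) ^ (2 * r))) := by gcongr
      _ = ((Q * N) ^ (2 * (r - 1)) * (Q * N) ^ 2) * (B : ℝ) ^ (2 * r) * D *
          ((k : ℝ) ^ (ε / 6 - 1 / 2 - ε) * ((k : ℝ) ^ (ε / 6) * (k : ℝ) ^ (1 / 2 + ε / 6))) := by
          simp only [D]
          ring
      _ = (Q * N) ^ (2 * r) * (B : ℝ) ^ (2 * r) * D * (k : ℝ) ^ (- (ε / 2)) := by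
          rw [e2, ← pow_add]
          congr 4
          omega
      _ ≤ (Q * N) ^ (2 * r) * (B : ℝ) ^ (2 * r) * D ^ (2 * r) * (k : ℝ) ^ (- (ε / 2)) := by
          gcongr
          exact le_self_pow₀ hD (by omega)
      _ = _ := by
          rw [← e1]
          ring
  have hAB : (A * B : ℝ) ≤ 4 * (N * (k : ℝ) ^ (-(ε / (4 * r)))) := by
    calc (A * B : ℝ) ≤ (2 * (k : ℝ) ^ (1 / 4 : ℝ)) * (2 * (k : ℝ) ^ (ε / 2)) := by gcongr
      _ = 4 * ((k : ℝ) ^ (1 / 4 + ε) * (k : ℝ) ^ (-(ε / 2))) := by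
          rw [← Real.rpow_add hk0, show (1 / 4 + ε + -(ε / 2) : ℝ) = 1 / 4 + ε / 2 by ring,
            Real.rpow_add hk0]
          ring
      _ ≤ _ := by
          gcongr
          linarith
  have hQB : 0 < Q * B := by positivity
  refine le_of_mul_le_mul_left (hX1.trans ?_) hQB
  calc _ ≤ Q * N * B * (D * (k : ℝ) ^ (-(ε / (4 * r)))) +
        Q * B * (2 * (4 * (N * (k : ℝ) ^ (-(ε / (4 * r)))))) := by
        refine add_le_add hXle (mul_le_mul_of_nonneg_left ?_ hQB.le)
        linarith
    _ = _ := by ring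

theorem burgess (ε : ℝ) (hε : 0 < ε) (L : ℕ) : ∃ δ : ℝ, 0 < δ ∧ ∃ C : ℝ, 1 ≤ C ∧
    ∀ (k : ℕ) [NeZero k], (∀ p : ℕ, p.Prime → ¬ p ^ 3 ∣ k) →
    ∀ χ : MulChar (ZMod k) ℂ, NontrivialAtPrimes k χ → ∀ N : ℕ, (k : ℝ) ^ (1 / 4 + ε) ≤ N →
    N ≤ k ^ L → ‖∑ n ∈ Icc 1 N, χ (n : ℕ)‖ ≤ C * N * (k : ℝ) ^ (-δ) := by
  obtain ⟨δ, hδ, C, hC, h⟩ := burgess_of_le_half (min ε (1 / 2)) (by positivity)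
    (min_le_right _ _) L
  refine ⟨δ, hδ, C, hC, fun k hNZ hcf χ hχ N hN hNL => h k hcf χ hχ N (le_trans ?_ hN) hNL⟩
  refine Real.rpow_le_rpow_of_exponent_le ?_ (by gcongr; exact min_le_left _ _)
  exact_mod_cast Nat.pos_of_ne_zero hNZ.out

theorem sum_range_eq_zero_of_ne_one {k : ℕ} [NeZero k] {χ : DirichletCharacter ℂ k} (hχ : χ ≠ 1)
    (W : ℕ) : ∑ n ∈ range k, χ ((W + n : ℕ) : ZMod k) = 0 := by
  have h1 : ∑ n ∈ range k, χ ((W + n : ℕ) : ZMod k) = ∑ x : ZMod k, χ (W + x) := by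
    refine sum_bij' (fun n _ => (n : ZMod k)) (fun x _ => x.val) ?_ ?_ ?_ ?_ ?_
    · simp
    · intro x _
      exact mem_range.2 (ZMod.val_lt x)
    · intro n hn
      exact ZMod.val_cast_of_lt (mem_range.1 hn)
    · intro x _
      exact ZMod.natCast_zmod_val x
    · intro n _
      push_cast
      rfl
  rw [h1]
  exact (Equiv.sum_comp (Equiv.addLeft (W : ZMod k)) (fun x => χ x)).trans
    (MulChar.sum_eq_zero_of_ne_one hχ)

theorem norm_sum_Icc_le_level {k : ℕ} [NeZero k] {χ : DirichletCharacter ℂ k} (hχ : χ ≠ 1)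
    (W : ℕ) : ‖∑ n ∈ Icc 1 W, χ (n : ℕ)‖ ≤ k := by
  induction W using Nat.strong_induction_on with
  | _ W ih =>
    rcases lt_or_ge W k with h | h
    · refine (norm_sum_le_of_le _ fun n _ => DirichletCharacter.norm_le_one χ _).trans ?_
      simpa using h.le
    · obtain ⟨V, rfl⟩ := Nat.exists_eq_add_of_le' h
      have h1 : ∑ n ∈ Icc 1 (V + k), χ (n : ℕ) = ∑ n ∈ Icc 1 V, χ (n : ℕ) := by
        have h2 := sum_range_eq_zero_of_ne_one hχ (V + 1)
        have h3 : ∑ n ∈ range k, χ ((V + 1 + n : ℕ) : ZMod k) =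
            ∑ n ∈ Ioc V (V + k), χ (n : ℕ) := by
          rw [range_eq_Ico, sum_Ico_add (fun n => χ ((n : ℕ) : ZMod k))]
          refine sum_congr ?_ fun _ _ => rfl
          ext n
          simp only [mem_Ico, mem_Ioc]
          omega
        have h4 := sum_Ioc_consecutive (fun n => χ ((n : ℕ) : ZMod k)) (Nat.zero_le V)
          (Nat.le_add_right V k)
        rw [← h3, h2, add_zero] at h4
        exact h4.symm
      rw [h1]
      exact ih V (by have := NeZero.pos k; omega)

theorem norm_sum_le_sum_primitive {m : ℕ} [NeZero m] (χ : DirichletCharacter ℂ m) (V : ℕ) :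
    ‖∑ n ∈ Icc 1 V, χ (n : ℕ)‖ ≤
      ∑ d ∈ m.divisors, ‖∑ n ∈ Icc 1 (V / d), χ.primitiveCharacter (n : ℕ)‖ := by
  set ψ := χ.primitiveCharacter
  have h1 : ∑ n ∈ Icc 1 V, χ (n : ℕ) = ∑ n ∈ Icc 1 V with n.Coprime m, ψ (n : ℕ) := by
    rw [sum_filter]
    refine sum_congr rfl fun n _ => ?_
    split_ifs with h
    · have := χ.primitiveCharacter_apply_of_isCoprime (a := n) (Nat.isCoprime_iff_coprime.2 h)
      simpa using this.symm
    · refine χ.map_nonunit fun hu => h ?_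
      rwa [ZMod.isUnit_iff_coprime] at hu
  rw [h1, sum_coprime_eq_sum_moebius m V (NeZero.ne m)]
  refine norm_sum_le_of_le _ fun d _ => ?_
  have h2 : ∀ n : ℕ, ψ ((d * n : ℕ) : ZMod χ.conductor) = ψ (d : ℕ) * ψ (n : ℕ) := by
    intro n
    rw [← map_mul, Nat.cast_mul]
  simp_rw [h2, ← mul_sum]
  rw [zsmul_eq_mul, ← mul_assoc, norm_mul, norm_mul]
  refine mul_le_of_le_one_left (norm_nonneg _) (mul_le_one₀ ?_ (norm_nonneg _)
    (DirichletCharacter.norm_le_one _ _))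
  rw [Complex.norm_intCast]
  exact_mod_cast ArithmeticFunction.abs_moebius_le_one

theorem exists_norm_sum_Icc_le (ε : ℝ) (hε : 0 < ε) : ∃ δ : ℝ, 0 < δ ∧ ∃ C : ℝ, 1 ≤ C ∧
    ∀ (m : ℕ) [NeZero m], (∀ p : ℕ, p.Prime → ¬ p ^ 3 ∣ m) →
    ∀ χ : DirichletCharacter ℂ m, χ ≠ 1 → ∀ V : ℕ, (m : ℝ) ^ (1 / 4 + ε) ≤ V → V ≤ m →
    ‖∑ n ∈ Icc 1 V, χ (n : ℕ)‖ ≤ C * V * (m : ℝ) ^ (-δ) := by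
  obtain ⟨δ₀, hδ₀, C₀, hC₀, hB⟩ := burgess (ε / 2) (by positivity) 8
  set δ : ℝ := min (min (1 / 8) (ε / 2)) (δ₀ / 8)
  have hδ : 0 < δ := by positivity
  have hδ1 : δ ≤ 1 / 8 := (min_le_left _ _).trans (min_le_left _ _)
  have hδ2 : δ ≤ ε / 2 := (min_le_left _ _).trans (min_le_right _ _)
  have hδ3 : δ ≤ δ₀ / 8 := min_le_right _ _
  obtain ⟨Ct, hCt, ht⟩ := exists_card_divisors_le (δ / 2) (by positivity)
  refine ⟨δ / 2, by positivity, Ct * C₀, one_le_mul_of_one_le_of_one_le hCt hC₀, ?_⟩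
  intro m hNZ hcf χ hχ V hV hVm
  have hm1 : (1 : ℝ) ≤ m := by exact_mod_cast NeZero.pos m
  have hm0 : (0 : ℝ) < m := by linarith
  have hV0 : (0 : ℝ) < V := lt_of_lt_of_le (by positivity) hV
  set k := χ.conductor
  have hkm : k ∣ m := χ.conductor_dvd_level
  have hk0 : k ≠ 0 := χ.conductor_ne_zero
  have : NeZero k := ⟨hk0⟩
  set ψ := χ.primitiveCharacter
  have hψ : ψ ≠ 1 := by
    intro h
    refine hχ ?_
    rw [← χ.changeLevel_primitiveCharacter]
    exact (DirichletCharacter.changeLevel_eq_one_iff _).2 h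
  have hkm' : (k : ℝ) ≤ m := by exact_mod_cast Nat.le_of_dvd (NeZero.pos m) hkm
  have hk1 : (1 : ℝ) ≤ k := by exact_mod_cast Nat.pos_of_ne_zero hk0
  have hinner : ∀ W : ℕ, W ≤ V → ‖∑ n ∈ Icc 1 W, ψ (n : ℕ)‖ ≤ C₀ * V * (m : ℝ) ^ (-δ) := by
    intro W hW
    have hWV : (W : ℝ) ≤ V := by exact_mod_cast hW
    have hbase : ∀ y : ℝ, y + δ ≤ 1 / 4 + ε → (m : ℝ) ^ y ≤ C₀ * V * (m : ℝ) ^ (-δ) := by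
      intro y hy
      calc (m : ℝ) ^ y ≤ (m : ℝ) ^ (1 / 4 + ε) * (m : ℝ) ^ (-δ) := by
            rw [← Real.rpow_add hm0]
            exact Real.rpow_le_rpow_of_exponent_le hm1 (by linarith)
        _ ≤ (C₀ * V) * (m : ℝ) ^ (-δ) := by
            gcongr
            exact hV.trans (le_mul_of_one_le_left hV0.le hC₀)
    rcases lt_or_ge (k ^ 8) m with h | h
    · refine (norm_sum_Icc_le_level hψ W).trans ((?_ : (k : ℝ) ≤ (m : ℝ) ^ (1 / 8 : ℝ)).trans
        (hbase (1 / 8) (by linarith)))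
      calc (k : ℝ) = ((k : ℝ) ^ 8) ^ (1 / 8 : ℝ) := by
            rw [← Real.rpow_natCast, ← Real.rpow_mul (by positivity)]
            norm_num
        _ ≤ _ := by
            gcongr
            exact_mod_cast h.le
    · rcases lt_or_ge (W : ℝ) ((k : ℝ) ^ (1 / 4 + ε / 2)) with hWk | hWk
      · refine (norm_sum_le_of_le _ fun n _ => DirichletCharacter.norm_le_one ψ _).trans ?_
        simp only [sum_const, Nat.card_Icc, Nat.add_sub_cancel, nsmul_eq_mul, mul_one]
        refine (hWk.le.trans (by gcongr)).trans (hbase (1 / 4 + ε / 2) (by linarith))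
      · refine (hB k (fun p hp hpk => hcf p hp (hpk.trans hkm)) ψ
          (nontrivialAtPrimes_of_isPrimitive hk0 ψ χ.primitiveCharacter_isPrimitive) W hWk
          (hW.trans (hVm.trans h))).trans ?_
        have h1 : (k : ℝ) ^ (-δ₀) ≤ (m : ℝ) ^ (-δ) := by
          calc (k : ℝ) ^ (-δ₀) = ((k : ℝ) ^ 8) ^ (-(δ₀ / 8)) := by
                rw [← Real.rpow_natCast, ← Real.rpow_mul (by positivity)]
                congr 1
                push_cast
                ring
            _ ≤ (m : ℝ) ^ (-(δ₀ / 8)) := by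
                refine Real.rpow_le_rpow_of_nonpos hm0 (by exact_mod_cast h) ?_
                linarith
            _ ≤ (m : ℝ) ^ (-δ) := Real.rpow_le_rpow_of_exponent_le hm1 (by linarith)
        gcongr
  calc _ ≤ ∑ d ∈ m.divisors, C₀ * V * (m : ℝ) ^ (-δ) :=
        (norm_sum_le_sum_primitive χ V).trans
          (sum_le_sum fun d _ => hinner _ (Nat.div_le_self V d))
    _ = #m.divisors * (C₀ * V * (m : ℝ) ^ (-δ)) := by rw [sum_const, nsmul_eq_mul]
    _ ≤ (Ct * (m : ℝ) ^ (δ / 2)) * (C₀ * V * (m : ℝ) ^ (-δ)) := by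
        gcongr
        exact ht m (NeZero.ne m)
    _ = Ct * C₀ * V * ((m : ℝ) ^ (δ / 2) * (m : ℝ) ^ (-δ)) := by ring
    _ = _ := by
        rw [← Real.rpow_add hm0]
        congr 2
        ring

theorem sum_norm_sum_char_sq_le {m : ℕ} [NeZero m] {ι : Type*} (I : Finset ι) (w : ι → ZMod m)
    (K : ℕ) (hK : ∀ v, #{i ∈ I | w i = v} ≤ K) :
    ∑ χ : DirichletCharacter ℂ m, ‖∑ i ∈ I, χ (w i)‖ ^ 2 ≤ m.totient * (#I * K : ℝ) := by
  have hpair : ∀ i j, ‖∑ χ : DirichletCharacter ℂ m, χ (w i) * (starRingEnd ℂ) (χ (w j))‖ ≤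
      if w i = w j then (m.totient : ℝ) else 0 := by
    intro i j
    by_cases hj : IsUnit (w j)
    · have h1 : ∀ χ : DirichletCharacter ℂ m, χ (w i) * (starRingEnd ℂ) (χ (w j)) =
          χ (w j)⁻¹ * χ (w i) := by
        intro χ
        rw [mul_comm]
        congr 1
        have h2 : (starRingEnd ℂ) (χ (w j)) = χ⁻¹ (w j) := MulChar.star_apply' χ (w j)
        rw [h2, MulChar.inv_apply]
        congr 1
        obtain ⟨u, hu⟩ := hj
        rw [← hu, Ring.inverse_unit, ZMod.inv_coe_unit]
      simp_rw [h1]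
      rw [DirichletCharacter.sum_char_inv_mul_char_eq ℂ hj]
      simp only [eq_comm (a := w j)]
      split_ifs <;> simp
    · have h1 : ∀ χ : DirichletCharacter ℂ m, χ (w i) * (starRingEnd ℂ) (χ (w j)) = 0 := by
        intro χ
        rw [χ.map_nonunit hj, map_zero, mul_zero]
      simp_rw [h1]
      simp only [sum_const_zero, norm_zero]
      positivity
  have hsum : ((∑ χ : DirichletCharacter ℂ m, ‖∑ i ∈ I, χ (w i)‖ ^ 2 : ℝ) : ℂ) =
      ∑ j ∈ I, ∑ i ∈ I, ∑ χ : DirichletCharacter ℂ m, χ (w i) * (starRingEnd ℂ) (χ (w j)) := by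
    push_cast
    simp_rw [← Complex.mul_conj', map_sum, sum_mul_sum]
    rw [sum_comm]
    exact (sum_congr rfl fun _ _ => sum_comm).trans sum_comm
  calc _ = ‖((∑ χ : DirichletCharacter ℂ m, ‖∑ i ∈ I, χ (w i)‖ ^ 2 : ℝ) : ℂ)‖ := by
        rw [Complex.norm_real, Real.norm_of_nonneg (sum_nonneg fun _ _ => by positivity)]
    _ ≤ ∑ j ∈ I, ∑ i ∈ I, if w i = w j then (m.totient : ℝ) else 0 := by
        rw [hsum]
        exact norm_sum_le_of_le _ fun j _ => norm_sum_le_of_le _ fun i _ => hpair i j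
    _ ≤ ∑ j ∈ I, (K * m.totient : ℝ) := by
        refine sum_le_sum fun j _ => ?_
        rw [← sum_filter, sum_const, nsmul_eq_mul]
        gcongr
        exact hK (w j)
    _ = _ := by
        rw [sum_const, nsmul_eq_mul]
        ring

theorem card_filter_cast_prod_eq_le {ι : Type*} [Fintype ι] [DecidableEq ι] (m T : ℕ)
    (N : ι → ℕ) (hT : ∀ w, w ≠ 0 → w ≤ ∏ i, N i → #w.divisors ≤ T) (v : ZMod m) :
    #{x ∈ Fintype.piFinset fun i => Icc 1 (N i) | ((∏ i, x i : ℕ) : ZMod m) = v} ≤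
      T ^ Fintype.card ι * ((∏ i, N i) / m + 1) := by
  refine le_trans ?_ (Nat.mul_le_mul_left _ (card_filter_cast_eq_le m (∏ i, N i) v))
  refine card_le_mul_card_image_of_maps_to (f := fun x : ι → ℕ => ∏ i, x i) ?_ _ ?_
  · intro x hx
    rw [mem_filter, Fintype.mem_piFinset] at hx
    rw [mem_filter, mem_Icc]
    exact ⟨⟨Nat.succ_le_of_lt (prod_pos fun i _ => (mem_Icc.1 (hx.1 i)).1),
      prod_le_prod' fun i _ => (mem_Icc.1 (hx.1 i)).2⟩, hx.2⟩
  · intro w hw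
    rw [mem_filter, mem_Icc] at hw
    have hw0 : w ≠ 0 := by omega
    calc _ ≤ #(Fintype.piFinset fun _ : ι => w.divisors) := by
          refine card_le_card fun x hx => Fintype.mem_piFinset.2 fun i => ?_
          rw [Nat.mem_divisors, ← (mem_filter.1 hx).2]
          refine ⟨dvd_prod_of_mem _ (mem_univ i), ?_⟩
          rw [(mem_filter.1 hx).2]
          exact hw0
      _ = #w.divisors ^ Fintype.card ι := by simp
      _ ≤ _ := Nat.pow_le_pow_left (hT w hw0 hw.1.2) _

theorem prod_sum_char_eq {m : ℕ} {ι : Type*} [Fintype ι] [DecidableEq ι]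
    (χ : DirichletCharacter ℂ m) (N : ι → ℕ) :
    ∏ i, ∑ n ∈ Icc 1 (N i), χ (n : ℕ) =
      ∑ x ∈ Fintype.piFinset fun i => Icc 1 (N i), χ ((∏ i, x i : ℕ) : ZMod m) := by
  rw [prod_univ_sum]
  refine sum_congr rfl fun x _ => ?_
  push_cast
  rw [map_prod]

theorem sum_norm_prod_sum_char_sq_le {m : ℕ} [NeZero m] {ι : Type*} [Fintype ι] [DecidableEq ι]
    (T : ℕ) (N : ι → ℕ) (hT : ∀ w, w ≠ 0 → w ≤ ∏ i, N i → #w.divisors ≤ T) :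
    ∑ χ : DirichletCharacter ℂ m, ‖∏ i, ∑ n ∈ Icc 1 (N i), χ (n : ℕ)‖ ^ 2 ≤
      m.totient * ((∏ i, N i : ℕ) * (T ^ Fintype.card ι * ((∏ i, N i) / m + 1) : ℕ) : ℝ) := by
  simp_rw [prod_sum_char_eq]
  refine (sum_norm_sum_char_sq_le _ _ _ (card_filter_cast_prod_eq_le m T N hT)).trans_eq ?_
  simp

theorem sum_one_char_eq {m : ℕ} (N : ℕ) :
    ∑ n ∈ Icc 1 N, (1 : DirichletCharacter ℂ m) (n : ℕ) = #{n ∈ Icc 1 N | n.Coprime m} := by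
  rw [natCast_card_filter]
  refine sum_congr rfl fun n _ => ?_
  split_ifs with h
  · exact MulChar.one_apply ((ZMod.isUnit_iff_coprime _ _).2 h)
  · exact MulChar.map_nonunit _ (mt (ZMod.isUnit_iff_coprime _ _).1 h)

/-- A set of units avoided by all products `∏ xᵢ`, `xᵢ ≤ Nᵢ`, is controlled by the nontrivial
character sums. -/
theorem card_mul_sq_le_sum_ne_one {m : ℕ} [NeZero m] {ι : Type*} [Fintype ι] [DecidableEq ι]
    (N : ι → ℕ) (E : Finset (ZMod m)ˣ)
    (hE : ∀ u ∈ E, ∀ x ∈ Fintype.piFinset fun i => Icc 1 (N i), (u : ZMod m) ≠ (∏ i, x i : ℕ)) :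
    (#E : ℝ) * ((∏ i, #{n ∈ Icc 1 (N i) | n.Coprime m} : ℕ) : ℝ) ^ 2 ≤ m.totient *
      ∑ χ ∈ univ.erase (1 : DirichletCharacter ℂ m), ‖∏ i, ∑ n ∈ Icc 1 (N i), χ (n : ℕ)‖ ^ 2 := by
  let e : DirichletCharacter ℂ m → ℂ := fun χ => ∑ u ∈ E, χ (u : ZMod m)⁻¹
  let S : DirichletCharacter ℂ m → ℂ := fun χ => ∏ i, ∑ n ∈ Icc 1 (N i), χ (n : ℕ)
  obtain ⟨c, hc⟩ : ∃ c : ℕ, c = ∏ i, #{n ∈ Icc 1 (N i) | n.Coprime m} := ⟨_, rfl⟩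
  rw [← hc]
  have h0 : ∑ χ, e χ * S χ = 0 := by
    simp only [e, S, prod_sum_char_eq, sum_mul_sum]
    rw [sum_comm]
    refine sum_eq_zero fun u hu => ?_
    rw [sum_comm]
    refine sum_eq_zero fun x hx => ?_
    rw [DirichletCharacter.sum_char_inv_mul_char_eq ℂ u.isUnit, if_neg (hE u hu x hx)]
  have he1 : e 1 = #E := by
    have h : ∀ u ∈ E, (1 : DirichletCharacter ℂ m) (u : ZMod m)⁻¹ = 1 := fun u _ => by
      rw [ZMod.inv_coe_unit, MulChar.one_apply_coe]
    exact (sum_congr rfl h).trans (by simp)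
  have hS1 : S 1 = c := by
    simp only [S, hc, sum_one_char_eq]
    push_cast
    rfl
  have he2 : ∑ χ, ‖e χ‖ ^ 2 ≤ m.totient * (#E : ℝ) := by
    refine (sum_norm_sum_char_sq_le E (fun u => (u : ZMod m)⁻¹) 1 ?_).trans_eq (by simp)
    intro v
    refine card_le_one.2 fun a ha b hb => ?_
    have h := (mem_filter.1 ha).2.trans (mem_filter.1 hb).2.symm
    simpa [ZMod.inv_coe_unit, Units.val_inj] using h
  have h1 : (#E * c : ℝ) ≤ ∑ χ ∈ univ.erase 1, ‖e χ‖ * ‖S χ‖ := by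
    rw [← add_sum_erase _ _ (mem_univ 1), he1, hS1] at h0
    have h2 : (#E * c : ℝ) = ‖(#E * c : ℂ)‖ := by
      rw [norm_mul, Complex.norm_natCast, Complex.norm_natCast]
    rw [h2, eq_neg_of_add_eq_zero_left h0, norm_neg]
    exact norm_sum_le_of_le _ fun χ _ => (norm_mul _ _).le
  have h2 : (#E * c : ℝ) ^ 2 ≤ (m.totient * #E) * ∑ χ ∈ univ.erase 1, ‖S χ‖ ^ 2 := by
    calc (#E * c : ℝ) ^ 2 ≤ (∑ χ ∈ univ.erase 1, ‖e χ‖ * ‖S χ‖) ^ 2 := by gcongr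
      _ ≤ (∑ χ ∈ univ.erase 1, ‖e χ‖ ^ 2) * ∑ χ ∈ univ.erase 1, ‖S χ‖ ^ 2 :=
          sum_mul_sq_le_sq_mul_sq _ _ _
      _ ≤ _ := by
          gcongr
          refine le_trans ?_ he2
          exact sum_le_sum_of_subset_of_nonneg (erase_subset _ _) fun _ _ _ => by positivity
  rcases (Nat.cast_nonneg #E : (0 : ℝ) ≤ #E).eq_or_lt with hE0 | hE0
  · rw [← hE0, zero_mul]
    positivity
  · refine le_of_mul_le_mul_left ?_ hE0
    linear_combination h2

theorem card_filter_lt_norm_sum_char_mul_le {m k U T : ℕ} [NeZero m] (hU : 0 < U)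
    (hUm : U ^ k ≤ m) (hmU : m ≤ 2 ^ k * U ^ k)
    (hT : ∀ w, w ≠ 0 → w ≤ m → #w.divisors ≤ T) {η : ℝ} (hη : 0 < η) :
    (#{χ : DirichletCharacter ℂ m | U * η < ‖∑ n ∈ Icc 1 U, χ (n : ℕ)‖} : ℝ) * η ^ (2 * k) ≤
      2 ^ (k + 1) * T ^ k := by
  have h := sum_norm_prod_sum_char_sq_le (m := m) T (fun _ : Fin k => U) (by
    intro w hw0 hw
    exact hT w hw0 (hw.trans (by simpa using hUm)))
  have hlow : (#{χ : DirichletCharacter ℂ m | U * η < ‖∑ n ∈ Icc 1 U, χ (n : ℕ)‖} : ℝ) *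
      (U * η) ^ (2 * k) ≤
      ∑ χ : DirichletCharacter ℂ m, ‖∏ _i : Fin k, ∑ n ∈ Icc 1 U, χ (n : ℕ)‖ ^ 2 := by
    rw [← nsmul_eq_mul, ← sum_const]
    refine (sum_le_sum fun χ hχ => ?_).trans
      (sum_le_sum_of_subset_of_nonneg (filter_subset _ _) fun _ _ _ => by positivity)
    rw [prod_const, card_univ, Fintype.card_fin, norm_pow, ← pow_mul, mul_comm k 2]
    exact pow_le_pow_left₀ (by positivity) (mem_filter.1 hχ).2.le _
  simp only [prod_const, card_univ, Fintype.card_fin] at h hlow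
  have hdiv : U ^ k / m + 1 ≤ 2 := by
    have := Nat.div_le_of_le_mul (m := U ^ k) (k := m) (n := 1) (by simpa using hUm)
    omega
  have hup : (m.totient : ℝ) * ((U ^ k : ℕ) * (T ^ k * (U ^ k / m + 1) : ℕ) : ℝ) ≤
      (2 ^ k * U ^ k) * (U ^ k * (T ^ k * 2)) := by
    have h1 := Nat.mul_le_mul ((Nat.totient_le m).trans hmU)
      (Nat.mul_le_mul_left (U ^ k) (Nat.mul_le_mul_left (T ^ k) hdiv))
    exact_mod_cast h1
  have hUk : (0 : ℝ) < U ^ (2 * k) := by positivity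
  refine le_of_mul_le_mul_right ?_ hUk
  calc _ = (#{χ : DirichletCharacter ℂ m | U * η < ‖∑ n ∈ Icc 1 U, χ (n : ℕ)‖} : ℝ) *
      (U * η) ^ (2 * k) := by ring
    _ ≤ (2 ^ k * U ^ k) * (U ^ k * (T ^ k * 2)) := hlow.trans (h.trans hup)
    _ = _ := by ring

theorem card_mul_sq_le_of_cons {m k n U T : ℕ} [NeZero m] (N : Fin n → ℕ) (hU : 0 < U)
    (hUm : U ^ k ≤ m) (hmU : m ≤ 2 ^ k * U ^ k) (hm : m ≤ ∏ i, N i)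
    (hT : ∀ w, w ≠ 0 → w ≤ ∏ i, N i → #w.divisors ≤ T) {η B : ℝ} (hη : 0 < η)
    (hB : ∀ χ : DirichletCharacter ℂ m, χ ≠ 1 →
      ‖∏ i, ∑ n ∈ Icc 1 (N i), χ (n : ℕ)‖ ≤ (∏ i, N i : ℕ) * B)
    (E : Finset (ZMod m)ˣ)
    (hE : ∀ u ∈ E, ∀ y ∈ Icc 1 U, ∀ x ∈ Fintype.piFinset fun i => Icc 1 (N i),
      (u : ZMod m) ≠ (y * ∏ i, x i : ℕ)) :
    (#E : ℝ) * (#{n ∈ Icc 1 U | n.Coprime m} *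
      ∏ i, (#{n ∈ Icc 1 (N i) | n.Coprime m} : ℝ)) ^ 2 ≤
      m * (U * (∏ i, N i : ℕ)) ^ 2 *
        (2 * η ^ 2 * T ^ n + 2 ^ (k + 1) * T ^ k * (η ^ (2 * k))⁻¹ * B ^ 2) := by
  classical
  set P := ∏ i, N i
  have hcard := card_filter_lt_norm_sum_char_mul_le (m := m) hU hUm hmU
    (fun w hw0 hw => hT w hw0 (hw.trans hm)) hη
  set F : Finset (DirichletCharacter ℂ m) := {χ | U * η < ‖∑ n ∈ Icc 1 U, χ (n : ℕ)‖}
  have hmean := sum_norm_prod_sum_char_sq_le (m := m) T N hT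
  have hmain := card_mul_sq_le_sum_ne_one (m := m) (Fin.cons U N : Fin (n + 1) → ℕ) E (by
    intro u hu x hx
    rw [Fintype.mem_piFinset] at hx
    rw [Fin.prod_univ_succ]
    refine hE u hu (x 0) (by simpa using hx 0) (fun i => x i.succ) ?_
    exact Fintype.mem_piFinset.2 fun i => by simpa using hx i.succ)
  simp only [Fin.prod_univ_succ, Fin.cons_zero, Fin.cons_succ, Nat.cast_mul, Nat.cast_prod,
    norm_mul, mul_pow] at hmain
  have hm0 : (0 : ℝ) < m := by exact_mod_cast NeZero.pos m
  have hφ : (m.totient : ℝ) * ((P : ℕ) * (T ^ n * (P / m + 1) : ℕ) : ℝ) ≤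
      P * (T ^ n * (2 * P)) := by
    have h1 : m.totient * (P / m + 1) ≤ 2 * P :=
      calc _ ≤ m * (P / m + 1) := Nat.mul_le_mul_right _ (Nat.totient_le m)
        _ = m * (P / m) + m := by ring
        _ ≤ 2 * P := by linarith [Nat.mul_div_le P m]
    have h2 : m.totient * (P * (T ^ n * (P / m + 1))) ≤ P * (T ^ n * (2 * P)) := by
      calc _ = P * (T ^ n * (m.totient * (P / m + 1))) := by ring
        _ ≤ _ := by gcongr
    exact_mod_cast h2
  have hterm : ∀ χ ∈ univ.erase (1 : DirichletCharacter ℂ m),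
      ‖∑ n ∈ Icc 1 U, χ (n : ℕ)‖ ^ 2 * ‖∏ i, ∑ n ∈ Icc 1 (N i), χ (n : ℕ)‖ ^ 2 ≤
      (U * η) ^ 2 * ‖∏ i, ∑ n ∈ Icc 1 (N i), χ (n : ℕ)‖ ^ 2 +
        if χ ∈ F then (U : ℝ) ^ 2 * (P * B) ^ 2 else 0 := by
    intro χ hχ
    by_cases hF : χ ∈ F
    · rw [if_pos hF]
      refine le_add_of_nonneg_of_le (by positivity) ?_
      gcongr
      · refine (norm_sum_le_of_le _ fun i _ => χ.norm_le_one _).trans_eq ?_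
        simp
      · exact hB χ (ne_of_mem_erase hχ)
    · rw [if_neg hF, add_zero]
      gcongr
      simpa [F] using hF
  have hsum : ∑ χ ∈ univ.erase (1 : DirichletCharacter ℂ m),
      ‖∑ n ∈ Icc 1 U, χ (n : ℕ)‖ ^ 2 * ‖∏ i, ∑ n ∈ Icc 1 (N i), χ (n : ℕ)‖ ^ 2 ≤
      (U * η) ^ 2 * (P * (T ^ n * (2 * P))) + #F * ((U : ℝ) ^ 2 * (P * B) ^ 2) := by
    refine (sum_le_sum hterm).trans ?_
    refine (sum_le_sum_of_subset_of_nonneg (erase_subset _ _) fun _ _ _ => ?_).trans ?_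
    · split_ifs <;> positivity
    · rw [sum_add_distrib, ← mul_sum, sum_ite_mem, univ_inter, sum_const, nsmul_eq_mul]
      gcongr
      refine hmean.trans ?_
      rw [Fintype.card_fin]
      exact hφ
  have hF' : (#F : ℝ) ≤ 2 ^ (k + 1) * T ^ k * (η ^ (2 * k))⁻¹ := by
    rwa [← div_eq_mul_inv, le_div_iff₀ (by positivity)]
  rw [mul_pow]
  refine hmain.trans ?_
  calc _ ≤ (m : ℝ) * ((U * η) ^ 2 * (P * (T ^ n * (2 * P))) +
        (2 ^ (k + 1) * T ^ k * (η ^ (2 * k))⁻¹) * ((U : ℝ) ^ 2 * (P * B) ^ 2)) := by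
        gcongr
        · exact Nat.totient_le m
        · refine (le_of_eq ?_).trans (hsum.trans ?_)
          · simp only [norm_prod]
          · gcongr
    _ = _ := by ring

theorem card_le_of_cons {m k n U T : ℕ} [NeZero m] (N : Fin n → ℕ) (hU : 0 < U)
    (hUm : U ^ k ≤ m) (hmU : m ≤ 2 ^ k * U ^ k) (hm : m ≤ ∏ i, N i)
    (hT : ∀ w, w ≠ 0 → w ≤ ∏ i, N i → #w.divisors ≤ T) {η B : ℝ} (hη : 0 < η)
    (hB : ∀ χ : DirichletCharacter ℂ m, χ ≠ 1 →
      ‖∏ i, ∑ n ∈ Icc 1 (N i), χ (n : ℕ)‖ ≤ (∏ i, N i : ℕ) * B)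
    {A : ℝ} (hA : ∀ K : ℕ, K ≠ 0 → (K : ℝ) ≤ A * #{n ∈ Icc 1 K | n.Coprime m})
    (E : Finset (ZMod m)ˣ)
    (hE : ∀ u ∈ E, ∀ y ∈ Icc 1 U, ∀ x ∈ Fintype.piFinset fun i => Icc 1 (N i),
      (u : ZMod m) ≠ (y * ∏ i, x i : ℕ)) :
    (#E : ℝ) ≤ m * A ^ (2 * (n + 1)) *
        (2 * η ^ 2 * T ^ n + 2 ^ (k + 1) * T ^ k * (η ^ (2 * k))⁻¹ * B ^ 2) := by
  have hN : ∀ i, N i ≠ 0 := fun i h => (NeZero.pos m).ne'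
    (Nat.le_zero.1 (hm.trans_eq (prod_eq_zero (mem_univ i) h)))
  have h := card_mul_sq_le_of_cons N hU hUm hmU hm hT hη hB E hE
  obtain ⟨c, hc⟩ : ∃ c : ℝ, c = #{n ∈ Icc 1 U | n.Coprime m} *
    ∏ i, (#{n ∈ Icc 1 (N i) | n.Coprime m} : ℝ) := ⟨_, rfl⟩
  rw [← hc] at h
  have hprod : (U * (∏ i, N i : ℕ) : ℝ) ≤ A ^ (n + 1) * c := by
    have h1 : ((∏ i, N i : ℕ) : ℝ) ≤ ∏ i, (A * #{n ∈ Icc 1 (N i) | n.Coprime m}) := by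
      push_cast
      exact prod_le_prod (fun _ _ => by positivity) fun i _ => hA _ (hN i)
    calc _ ≤ (A * #{n ∈ Icc 1 U | n.Coprime m}) *
          ∏ i, (A * #{n ∈ Icc 1 (N i) | n.Coprime m}) :=
          mul_le_mul (hA U hU.ne') h1 (by positivity) ((Nat.cast_nonneg _).trans (hA U hU.ne'))
      _ = _ := by
          rw [hc, prod_mul_distrib, prod_const, card_univ, Fintype.card_fin]
          ring
  have hpos : (0 : ℝ) < U * (∏ i, N i : ℕ) := by
    have := prod_pos fun i (_ : i ∈ univ) => Nat.pos_of_ne_zero (hN i)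
    positivity
  have hc0 : c ≠ 0 := fun h0 => by
    rw [h0, mul_zero] at hprod
    exact absurd hprod (not_le.2 hpos)
  refine le_of_mul_le_mul_right (h.trans ?_) (pow_pos (hc0.symm.lt_of_le (hc ▸ by positivity)) 2)
  calc _ ≤ m * (A ^ (n + 1) * c) ^ 2 *
        (2 * η ^ 2 * T ^ n + 2 ^ (k + 1) * T ^ k * (η ^ (2 * k))⁻¹ * B ^ 2) := by gcongr
    _ = _ := by ring

theorem norm_prod_sum_char_le {m n : ℕ} (χ : DirichletCharacter ℂ m) (N : Fin (n + 1) → ℕ)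
    {B : ℝ} (h : ‖∑ n ∈ Icc 1 (N 0), χ (n : ℕ)‖ ≤ N 0 * B) :
    ‖∏ i, ∑ n ∈ Icc 1 (N i), χ (n : ℕ)‖ ≤ (∏ i, N i : ℕ) * B := by
  rw [Fin.prod_univ_succ, Fin.prod_univ_succ, norm_mul, norm_prod]
  have h1 : ∏ i : Fin n, ‖∑ n ∈ Icc 1 (N i.succ), χ (n : ℕ)‖ ≤ ∏ i : Fin n, (N i.succ : ℝ) :=
    prod_le_prod (fun _ _ => norm_nonneg _) fun i _ =>
      (norm_sum_le_of_le _ fun j _ => χ.norm_le_one _).trans_eq (by simp)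
  refine (mul_le_mul h h1 (prod_nonneg fun _ _ => norm_nonneg _)
    ((norm_nonneg _).trans h)).trans_eq ?_
  push_cast
  ring

theorem exists_card_le_of_cons (ε : ℝ) (hε : 0 < ε) (n k : ℕ) (hk : k ≠ 0) :
    ∃ θ : ℝ, 0 < θ ∧ ∃ C : ℝ, 0 < C ∧ ∀ (m : ℕ) [NeZero m], (∀ p : ℕ, p.Prime → ¬ p ^ 3 ∣ m) →
      ∀ (U : ℕ) (N : Fin (n + 1) → ℕ), 0 < U → U ^ k ≤ m → m ≤ 2 ^ k * U ^ k →
      m ≤ ∏ i, N i → ∏ i, N i ≤ m ^ (n + 1) → (m : ℝ) ^ (1 / 4 + ε) ≤ N 0 → N 0 ≤ m →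
      ∀ E : Finset (ZMod m)ˣ, (∀ u ∈ E, ∀ y ∈ Icc 1 U,
        ∀ x ∈ Fintype.piFinset fun i => Icc 1 (N i), (u : ZMod m) ≠ (y * ∏ i, x i : ℕ)) →
      (#E : ℝ) ≤ C * (m : ℝ) ^ (1 - θ) := by
  obtain ⟨δ, hδ, C₀, hC₀, hchar⟩ := exists_norm_sum_Icc_le ε hε
  have hk0 : (0 : ℝ) < k := by exact_mod_cast Nat.pos_of_ne_zero hk
  have hk1 : (1 : ℝ) ≤ k := by exact_mod_cast Nat.pos_of_ne_zero hk
  set θ : ℝ := δ / (2 * k) with hθdef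
  have hθ : 0 < θ := by positivity
  have hθδ : θ * (2 * k) = δ := by rw [hθdef]; field_simp
  set ρ : ℝ := θ / (3 * n + 5 + k) with hρdef
  have hρ : 0 < ρ := by positivity
  have hρθ : ρ * (3 * n + 5 + k) = θ := by rw [hρdef]; field_simp
  obtain ⟨Ct, hCt, htau⟩ := exists_card_divisors_le (ρ / (n + 1)) (by positivity)
  obtain ⟨Ca, hCa, hcop⟩ := exists_le_card_coprime ρ hρ
  refine ⟨θ, hθ, Ca ^ (2 * (n + 2)) * (2 * Ct ^ (n + 1) + 2 ^ (k + 1) * Ct ^ k * C₀ ^ 2),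
    by positivity, ?_⟩
  intro m _ hcube U N hU hUm hmU hmP hPm hN0 hN0m E hE
  have hm : m ≠ 0 := NeZero.ne m
  have hm0 : (0 : ℝ) < m := by exact_mod_cast NeZero.pos m
  have hm1 : (1 : ℝ) ≤ m := by exact_mod_cast NeZero.pos m
  set R : ℝ := (m : ℝ) ^ ρ with hR
  have hR1 : 1 ≤ R := Real.one_le_rpow hm1 hρ.le
  have hR0 : 0 < R := by positivity
  set T : ℕ := ⌊Ct * R⌋₊
  have hT : ∀ w, w ≠ 0 → w ≤ ∏ i, N i → #w.divisors ≤ T := by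
    intro w hw0 hw
    refine Nat.le_floor ((htau w hw0).trans ?_)
    gcongr
    have hw1 : (w : ℝ) ≤ (m : ℝ) ^ ((n : ℝ) + 1) := by exact_mod_cast hw.trans hPm
    calc (w : ℝ) ^ (ρ / (n + 1)) ≤ ((m : ℝ) ^ ((n : ℝ) + 1)) ^ (ρ / (n + 1)) := by gcongr
      _ = R := by
        rw [← Real.rpow_mul hm0.le, hR]
        congr 1
        field_simp
  have hTR : (T : ℝ) ≤ Ct * R := Nat.floor_le (by positivity)
  have h := card_le_of_cons (η := (m : ℝ) ^ (-θ)) (B := C₀ * (m : ℝ) ^ (-δ)) (A := Ca * R) N hU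
    hUm hmU hmP hT (by positivity)
    (fun χ hχ => norm_prod_sum_char_le χ N
      ((hchar m hcube χ hχ (N 0) hN0 hN0m).trans_eq (by ring)))
    (fun K hK => hcop m hm K hK) E hE
  have hη : ((m : ℝ) ^ (-θ)) ^ (2 * k) = (m : ℝ) ^ (-δ) := by
    rw [← Real.rpow_mul_natCast hm0.le, ← hθδ]
    push_cast
    ring_nf
  rw [hη] at h
  set d : ℝ := (m : ℝ) ^ (-δ)
  set t : ℝ := (m : ℝ) ^ (-θ)
  have hd : 0 < d := by positivity
  have ht : 0 < t := by positivity
  have hRt : R ^ (3 * n + 5 + k) * t = 1 := by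
    rw [hR, ← Real.rpow_mul_natCast hm0.le, ← Real.rpow_add hm0]
    push_cast
    rw [hρθ, add_neg_cancel, Real.rpow_zero]
  have hdt : d ≤ t ^ 2 := by
    rw [← Real.rpow_mul_natCast hm0.le]
    refine Real.rpow_le_rpow_of_exponent_le hm1 ?_
    push_cast
    nlinarith
  have hmt : (m : ℝ) ^ (1 - θ) = m * t := by rw [sub_eq_add_neg, Real.rpow_add hm0, Real.rpow_one]
  rw [hmt]
  have hpow : ∀ a, a ≤ 3 * n + 5 + k → R ^ a * t ≤ 1 := fun a ha =>
    hRt ▸ mul_le_mul_of_nonneg_right (pow_le_pow_right₀ hR1 ha) ht.le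
  have h1 : 2 * t ^ 2 * (T : ℝ) ^ (n + 1) ≤ 2 * Ct ^ (n + 1) * R ^ (n + 1) * t ^ 2 := by
    calc _ ≤ 2 * t ^ 2 * (Ct * R) ^ (n + 1) := by gcongr
      _ = _ := by ring
  have h2 : 2 ^ (k + 1) * (T : ℝ) ^ k * d⁻¹ * (C₀ * d) ^ 2 ≤
      2 ^ (k + 1) * Ct ^ k * C₀ ^ 2 * R ^ k * t ^ 2 := by
    calc _ = 2 ^ (k + 1) * (T : ℝ) ^ k * C₀ ^ 2 * d := by field_simp
      _ ≤ 2 ^ (k + 1) * (Ct * R) ^ k * C₀ ^ 2 * t ^ 2 := by gcongr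
      _ = _ := by ring
  calc (#E : ℝ) ≤ _ := h
    _ ≤ m * (Ca * R) ^ (2 * (n + 1 + 1)) * (2 * Ct ^ (n + 1) * R ^ (n + 1) * t ^ 2 +
        2 ^ (k + 1) * Ct ^ k * C₀ ^ 2 * R ^ k * t ^ 2) := by gcongr
    _ = Ca ^ (2 * (n + 2)) * m * t * (2 * Ct ^ (n + 1) * (R ^ (3 * n + 5) * t) +
        2 ^ (k + 1) * Ct ^ k * C₀ ^ 2 * (R ^ (2 * n + 4 + k) * t)) := by ring
    _ ≤ Ca ^ (2 * (n + 2)) * m * t * (2 * Ct ^ (n + 1) * 1 +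
        2 ^ (k + 1) * Ct ^ k * C₀ ^ 2 * 1) := by
        gcongr
        · exact hpow _ (by omega)
        · exact hpow _ (by omega)
    _ = _ := by ring

theorem exists_card_le_of_rpow_le (ε : ℝ) (hε : 0 < ε) :
    ∃ θ : ℝ, 0 < θ ∧ ∃ C : ℝ, 0 < C ∧ ∃ M : ℕ, 0 < M ∧ ∀ m : ℕ, M ≤ m →
      (∀ p : ℕ, p.Prime → ¬ p ^ 3 ∣ m) →
      ∀ N₁ N₂ N₃ N₄ : ℕ, N₁ ≤ m → N₂ ≤ m → N₃ ≤ m → N₄ ≤ m →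
      (m : ℝ) ^ ((1 : ℝ) + ε) < ((N₁ * N₂ * N₃ * N₄ : ℕ) : ℝ) →
      (m : ℝ) ^ (1 / 4 + ε / 4) ≤ N₁ →
      ∀ E : Finset (ZMod m)ˣ, (∀ u ∈ E, ∀ x₁ ∈ Icc 1 N₁, ∀ x₂ ∈ Icc 1 N₂, ∀ x₃ ∈ Icc 1 N₃,
        ∀ x₄ ∈ Icc 1 N₄, (u : ZMod m) ≠ (x₁ * x₂ * x₃ * x₄ : ℕ)) →
      (#E : ℝ) ≤ C * (m : ℝ) ^ (1 - θ) := by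
  set k := ⌈16 / ε⌉₊
  have hk : 0 < k := Nat.ceil_pos.2 (by positivity)
  have hk0 : (0 : ℝ) < k := by exact_mod_cast hk
  have hkε : 1 / (k : ℝ) ≤ ε / 16 := by
    rw [div_le_iff₀ hk0]
    have := Nat.le_ceil (16 / ε)
    rw [div_le_iff₀ hε] at this
    linarith
  have hk4 : 1 / (k : ℝ) ≤ 1 / 4 + ε / 8 := by linarith
  obtain ⟨θ, hθ, C, hC, hmain⟩ := exists_card_le_of_cons (ε / 8) (by positivity) 3 k hk.ne'
  refine ⟨θ, hθ, C, hC, ⌈(2 : ℝ) ^ (16 / ε)⌉₊, Nat.ceil_pos.2 (by positivity), ?_⟩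
  intro m hMm hcube N₁ N₂ N₃ N₄ h₁ h₂ h₃ h₄ hN hN₁ E hE
  have hm2 : (2 : ℝ) ^ (16 / ε) ≤ m := (Nat.le_ceil _).trans (by exact_mod_cast hMm)
  have hm1 : (1 : ℝ) ≤ m := le_trans (Real.one_le_rpow one_le_two (by positivity)) hm2
  have hm0 : (0 : ℝ) < m := by linarith
  have hmpos : 0 < m := by exact_mod_cast hm0
  have : NeZero m := ⟨hmpos.ne'⟩
  have htwo : 2 ≤ (m : ℝ) ^ (ε / 16) := by
    calc (2 : ℝ) = ((2 : ℝ) ^ (16 / ε)) ^ (ε / 16) := by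
          rw [← Real.rpow_mul zero_le_two, show 16 / ε * (ε / 16) = 1 by field_simp, Real.rpow_one]
      _ ≤ _ := by gcongr
  set z : ℝ := (m : ℝ) ^ (1 / (k : ℝ)) with hz
  have hz1 : 1 ≤ z := Real.one_le_rpow hm1 (by positivity)
  have hzk : z ^ k = m := by
    rw [hz, ← Real.rpow_mul_natCast hm0.le, one_div_mul_cancel hk0.ne', Real.rpow_one]
  have hz2 : z * 2 ≤ (m : ℝ) ^ (ε / 8) := by
    calc z * 2 ≤ (m : ℝ) ^ (ε / 16) * (m : ℝ) ^ (ε / 16) := by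
          gcongr
          exact Real.rpow_le_rpow_of_exponent_le hm1 hkε
      _ = _ := by rw [← Real.rpow_add hm0]; ring_nf
  set U : ℕ := ⌊z⌋₊
  have hU : 0 < U := Nat.floor_pos.2 hz1
  have hUz : (U : ℝ) ≤ z := Nat.floor_le (by linarith)
  have hzU : z ≤ 2 * U := by
    have h1 := Nat.lt_floor_add_one z
    have h2 : (1 : ℝ) ≤ U := by exact_mod_cast hU
    linarith
  have hUm : U ^ k ≤ m := by
    have h1 : (U : ℝ) ^ k ≤ m := hzk ▸ pow_le_pow_left₀ (by positivity) hUz k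
    exact_mod_cast h1
  have hmU : m ≤ 2 ^ k * U ^ k := by
    have h1 : (m : ℝ) ≤ (2 * U) ^ k := hzk ▸ pow_le_pow_left₀ (by positivity) hzU k
    rw [← mul_pow]
    exact_mod_cast h1
  have hV : (N₁ : ℝ) ≤ (m : ℝ) ^ (ε / 8) * (N₁ / U : ℕ) := by
    have hUN : U ≤ N₁ := by
      have h1 : (U : ℝ) ≤ N₁ := by
        refine hUz.trans (le_trans ?_ hN₁)
        exact Real.rpow_le_rpow_of_exponent_le hm1 (by linarith)
      exact_mod_cast h1
    have hV1 : 1 ≤ N₁ / U := Nat.div_pos hUN hU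
    have h1 : N₁ ≤ U * (2 * (N₁ / U)) := by
      have h2 := Nat.div_add_mod N₁ U
      have h3 := Nat.mod_lt N₁ hU
      have h4 := Nat.mul_le_mul_left U hV1
      nlinarith
    calc (N₁ : ℝ) ≤ U * (2 * (N₁ / U : ℕ)) := by exact_mod_cast h1
      _ = U * 2 * (N₁ / U : ℕ) := by ring
      _ ≤ z * 2 * (N₁ / U : ℕ) := by gcongr
      _ ≤ _ := by gcongr
  have hpos : (0 : ℝ) < (m : ℝ) ^ (ε / 8) := by positivity
  have hprod : ∏ i, (![N₁ / U, N₂, N₃, N₄] : Fin 4 → ℕ) i = N₁ / U * N₂ * N₃ * N₄ := by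
    simp [Fin.prod_univ_four]
  refine hmain m hcube U ![N₁ / U, N₂, N₃, N₄] hU hUm hmU ?_ ?_ ?_ ?_ E ?_
  · refine le_of_le_of_eq ?_ hprod.symm
    have h1 : (m : ℝ) ≤ (N₁ / U * N₂ * N₃ * N₄ : ℕ) := by
      refine le_of_mul_le_mul_left ?_ hpos
      calc (m : ℝ) ^ (ε / 8) * m = (m : ℝ) ^ (ε / 8 + 1) := by
            rw [Real.rpow_add hm0, Real.rpow_one]
        _ ≤ (m : ℝ) ^ (1 + ε) := Real.rpow_le_rpow_of_exponent_le hm1 (by linarith)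
        _ ≤ N₁ * (N₂ * N₃ * N₄ : ℕ) := by
            refine hN.le.trans_eq ?_
            push_cast
            ring
        _ ≤ ((m : ℝ) ^ (ε / 8) * (N₁ / U : ℕ)) * (N₂ * N₃ * N₄ : ℕ) := by gcongr
        _ = _ := by
            rw [Nat.cast_mul (N₁ / U * N₂ * N₃) N₄, Nat.cast_mul (N₁ / U * N₂) N₃,
              Nat.cast_mul (N₁ / U) N₂]
            push_cast
            ring
    exact_mod_cast h1
  · refine hprod.trans_le ?_
    calc _ ≤ m * m * m * m := by
          gcongr
          exact (Nat.div_le_self _ _).trans h₁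
      _ = _ := by ring
  · refine le_of_mul_le_mul_left ?_ hpos
    rw [← Real.rpow_add hm0]
    refine le_trans (le_of_eq ?_) (hN₁.trans hV)
    ring_nf
  · exact (Nat.div_le_self _ _).trans h₁
  · intro u hu y hy x hx
    rw [Fintype.mem_piFinset] at hx
    have hx0 := mem_Icc.1 (hx 0)
    have hy := mem_Icc.1 hy
    have h := hE u hu (y * x 0) (mem_Icc.2 ⟨Nat.mul_pos hy.1 hx0.1,
      (Nat.mul_le_mul hy.2 hx0.2).trans (Nat.mul_div_le N₁ U)⟩) (x 1) (hx 1) (x 2) (hx 2)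
      (x 3) (hx 3)
    rw [Fin.prod_univ_four]
    simpa only [mul_assoc] using h

theorem exists_rpow_le_of_lt_mul {m : ℕ} {ε : ℝ} {N₁ N₂ N₃ N₄ : ℕ}
    (hN : (m : ℝ) ^ ((1 : ℝ) + ε) < ((N₁ * N₂ * N₃ * N₄ : ℕ) : ℝ)) :
    (m : ℝ) ^ (1 / 4 + ε / 4) ≤ N₁ ∨ (m : ℝ) ^ (1 / 4 + ε / 4) ≤ N₂ ∨
      (m : ℝ) ^ (1 / 4 + ε / 4) ≤ N₃ ∨ (m : ℝ) ^ (1 / 4 + ε / 4) ≤ N₄ := by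
  by_contra! h
  obtain ⟨h₁, h₂, h₃, h₄⟩ := h
  refine absurd hN (not_lt.2 ?_)
  have hpow : (m : ℝ) ^ ((1 : ℝ) + ε) = ((m : ℝ) ^ (1 / 4 + ε / 4)) ^ 4 := by
    rw [← Real.rpow_mul_natCast (Nat.cast_nonneg m)]
    push_cast
    ring_nf
  rw [hpow]
  push_cast
  calc (N₁ * N₂ * N₃ * N₄ : ℝ) ≤ (m : ℝ) ^ (1 / 4 + ε / 4) * (m : ℝ) ^ (1 / 4 + ε / 4) *
        (m : ℝ) ^ (1 / 4 + ε / 4) * (m : ℝ) ^ (1 / 4 + ε / 4) := by gcongr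
    _ = _ := by ring

theorem exists_mem_Icc_cast_eq {m N : ℕ} (hm : 0 < m) (h : m ≤ N) (a : ZMod m) :
    ∃ x ∈ Icc 1 N, (x : ZMod m) = a := by
  have : NeZero m := ⟨hm.ne'⟩
  rcases eq_or_ne a 0 with rfl | ha
  · exact ⟨m, mem_Icc.2 ⟨hm, h⟩, ZMod.natCast_self m⟩
  · exact ⟨a.val, mem_Icc.2 ⟨Nat.pos_of_ne_zero ((ZMod.val_ne_zero a).2 ha), a.val_le.trans h⟩,
      ZMod.natCast_zmod_val a⟩

/-- For every ε > 0 there is ε₁ > 0 such that for all large cubefree m and positive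
N₁, N₂, N₃, N₄ with N₁N₂N₃N₄ > m^(1+ε), the number of units λ mod m not of the form
x₁x₂x₃x₄ with xⱼ ∈ [1,Nⱼ] is O(m^(1-ε₁)). -/
theorem stmt3 :
    ∀ ε : ℝ, 0 < ε → ∃ ε₁ : ℝ, 0 < ε₁ ∧ ∃ C : ℝ, 0 < C ∧ ∃ M : ℕ, ∀ m : ℕ, M ≤ m →
      (∀ p : ℕ, p.Prime → ¬ p ^ 3 ∣ m) →
      ∀ N₁ N₂ N₃ N₄ : ℕ, 0 < N₁ → 0 < N₂ → 0 < N₃ → 0 < N₄ →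
      (m : ℝ) ^ ((1 : ℝ) + ε) < ((N₁ * N₂ * N₃ * N₄ : ℕ) : ℝ) →
      ({lam : (ZMod m)ˣ | ¬ ∃ x₁ x₂ x₃ x₄ : ℕ,
          x₁ ∈ Finset.Icc 1 N₁ ∧ x₂ ∈ Finset.Icc 1 N₂ ∧ x₃ ∈ Finset.Icc 1 N₃ ∧
          x₄ ∈ Finset.Icc 1 N₄ ∧
          (lam : ZMod m) = ((x₁ * x₂ * x₃ * x₄ : ℕ) : ZMod m)}.ncard : ℝ)
        ≤ C * (m : ℝ) ^ ((1 : ℝ) - ε₁) := by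
  classical
  intro ε hε
  obtain ⟨θ, hθ, C, hC, M, hM, hmain⟩ := exists_card_le_of_rpow_le ε hε
  refine ⟨θ, hθ, C, hC, M, fun m hMm hcube N₁ N₂ N₃ N₄ hp₁ hp₂ hp₃ hp₄ hN => ?_⟩
  have hm : 0 < m := hM.trans_le hMm
  have : NeZero m := ⟨hm.ne'⟩
  rw [Set.ncard_eq_toFinset_card']
  set E := Set.toFinset {lam : (ZMod m)ˣ | ¬ ∃ x₁ x₂ x₃ x₄ : ℕ,
          x₁ ∈ Finset.Icc 1 N₁ ∧ x₂ ∈ Finset.Icc 1 N₂ ∧ x₃ ∈ Finset.Icc 1 N₃ ∧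
          x₄ ∈ Finset.Icc 1 N₄ ∧
          (lam : ZMod m) = ((x₁ * x₂ * x₃ * x₄ : ℕ) : ZMod m)} with hEdef
  have hE : ∀ u ∈ E, ∀ x₁ ∈ Icc 1 N₁, ∀ x₂ ∈ Icc 1 N₂, ∀ x₃ ∈ Icc 1 N₃,
      ∀ x₄ ∈ Icc 1 N₄, (u : ZMod m) ≠ (x₁ * x₂ * x₃ * x₄ : ℕ) := by
    intro u hu x₁ h₁ x₂ h₂ x₃ h₃ x₄ h₄ h
    rw [hEdef, Set.mem_toFinset] at hu
    exact hu ⟨x₁, x₂, x₃, x₄, h₁, h₂, h₃, h₄, h⟩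
  clear_value E
  have hone : ∀ {K : ℕ}, 0 < K → 1 ∈ Icc 1 K := fun h => mem_Icc.2 ⟨le_rfl, h⟩
  by_cases hlt : N₁ < m ∧ N₂ < m ∧ N₃ < m ∧ N₄ < m
  · obtain ⟨h₁, h₂, h₃, h₄⟩ := hlt
    rcases exists_rpow_le_of_lt_mul hN with h | h | h | h
    · exact hmain m hMm hcube N₁ N₂ N₃ N₄ h₁.le h₂.le h₃.le h₄.le hN h E hE
    · refine hmain m hMm hcube N₂ N₁ N₃ N₄ h₂.le h₁.le h₃.le h₄.le ?_ h E ?_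
      · rwa [mul_comm N₂]
      · intro u hu x hx y hy z hz w hw
        rw [mul_comm x]
        exact hE u hu y hy x hx z hz w hw
    · refine hmain m hMm hcube N₃ N₁ N₂ N₄ h₃.le h₁.le h₂.le h₄.le ?_ h E ?_
      · rwa [mul_assoc N₃, mul_comm N₃]
      · intro u hu x hx y hy z hz w hw
        rw [mul_assoc x, mul_comm x]
        exact hE u hu y hy z hz x hx w hw
    · refine hmain m hMm hcube N₄ N₁ N₂ N₃ h₄.le h₁.le h₂.le h₃.le ?_ h E ?_
      · rwa [mul_assoc N₄, mul_assoc N₄, mul_comm N₄]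
      · intro u hu x hx y hy z hz w hw
        rw [mul_assoc x, mul_assoc x, mul_comm x]
        exact hE u hu y hy z hz w hw x hx
  · have hempty : E = ∅ := by
      refine eq_empty_of_forall_notMem fun u hu => hlt ⟨?_, ?_, ?_, ?_⟩ <;>
        refine lt_of_not_ge fun h => ?_ <;>
        obtain ⟨x, hx, hxu⟩ := exists_mem_Icc_cast_eq hm h (u : ZMod m)
      · exact hE u hu x hx 1 (hone hp₂) 1 (hone hp₃) 1 (hone hp₄) (by simp [hxu])
      · exact hE u hu 1 (hone hp₁) x hx 1 (hone hp₃) 1 (hone hp₄) (by simp [hxu])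
      · exact hE u hu 1 (hone hp₁) 1 (hone hp₂) x hx 1 (hone hp₄) (by simp [hxu])
      · exact hE u hu 1 (hone hp₁) 1 (hone hp₂) 1 (hone hp₃) x hx (by simp [hxu])
    rw [hempty, card_empty, Nat.cast_zero]
    positivity
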